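/- There exists a Kronecker set E ⊆ Γ and a closed ideal I ≠ {0} of A⁺ with S_I = 1 and h(I) = E such that I ≠ I^A ∩ S_I·H^∞; that is, the Bennett–Gilbert conjecture fails for I. -/

import Mathlib

noncomputable section

/-- An invertible contraction on a (complex) Banach space. -/
structure BanachContraction where
  X : Type
  [grp : NormedAddCommGroup X]
  [mod : NormedSpace ℂ X]
  [cpl : CompleteSpace X]
  T : X →L[ℂ] X
  Tinv : X →L[ℂ] X
  norm_le : ‖T‖ ≤ 1
  mul_inv : T * Tinv = 1
  inv_mul : Tinv * T = 1

attribute [instance] BanachContraction.grp BanachContraction.mod BanachContraction.cpl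

open Complex MeasureTheory Metric Set Filter

/-- The `n`-th Taylor coefficient of `f` at `0`, i.e. `f⁽ⁿ⁾(0)/n!`. -/
def taylorCoeff (f : ℂ → ℂ) (n : ℕ) : ℂ := iteratedDeriv n f 0 / (n.factorial : ℂ)

/-- `A⁺`, the algebra of absolutely convergent Taylor series: functions which, on the
closed unit disk, are sums of a power series with absolutely summable coefficients. -/
def APlus : Set (ℂ → ℂ) :=
  {f | ∃ a : ℕ → ℂ, Summable (fun n => ‖a n‖) ∧
    ∀ z ∈ Metric.closedBall (0 : ℂ) 1, HasSum (fun n => a n * z ^ n) (f z)}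

/-- The norm `‖f‖₁ = ∑ₙ |f⁽ⁿ⁾(0)/n!|` on `A⁺`. -/
def APlusNorm (f : ℂ → ℂ) : ℝ := ∑' n : ℕ, ‖taylorCoeff f n‖

/-- The `n`-th Fourier coefficient of (the boundary values of) `f` on the unit circle. -/
def fcoeff (f : ℂ → ℂ) (n : ℤ) : ℂ :=
  (1 / (2 * Real.pi)) * ∫ θ in (0:ℝ)..(2 * Real.pi),
    f (Complex.exp ((θ : ℂ) * Complex.I)) * Complex.exp (-(n : ℂ) * (θ : ℂ) * Complex.I)

/-- The Wiener algebra `A(Γ)` of absolutely convergent Fourier series on the unit circle,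
viewed as functions `ℂ → ℂ` (only the values on the unit circle are relevant). -/
def WienerAlg : Set (ℂ → ℂ) :=
  {f | Summable (fun n : ℤ => ‖fcoeff f n‖) ∧
    ∀ z ∈ Metric.sphere (0 : ℂ) 1, HasSum (fun n : ℤ => fcoeff f n * z ^ n) (f z)}

/-- The norm `‖f‖₁ = ∑_{n ∈ ℤ} |f̂(n)|` on `A(Γ)`. -/
def WienerNorm (f : ℂ → ℂ) : ℝ := ∑' n : ℤ, ‖fcoeff f n‖

/-- `I` is a closed ideal of `A⁺` (closedness w.r.t. the norm `APlusNorm`). -/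
def IsClosedIdealAPlus (I : Set (ℂ → ℂ)) : Prop :=
  I ⊆ APlus ∧
  (∀ f ∈ I, ∀ g ∈ I, f + g ∈ I) ∧
  (∀ f ∈ APlus, ∀ g ∈ I, f * g ∈ I) ∧
  (∀ f ∈ APlus, (∀ ε > 0, ∃ g ∈ I, APlusNorm (f - g) < ε) → f ∈ I)

/-- `J` is a closed ideal of the Wiener algebra `A(Γ)`. -/
def IsClosedIdealW (J : Set (ℂ → ℂ)) : Prop :=
  J ⊆ WienerAlg ∧
  (∀ f ∈ J, ∀ g ∈ J, f + g ∈ J) ∧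
  (∀ f ∈ WienerAlg, ∀ g ∈ J, f * g ∈ J) ∧
  (∀ f ∈ WienerAlg, (∀ ε > 0, ∃ g ∈ J, WienerNorm (f - g) < ε) → f ∈ J)

/-- `I^A` : the closed ideal generated by `I` in the Wiener algebra `A(Γ)`. -/
def IdealGenW (I : Set (ℂ → ℂ)) : Set (ℂ → ℂ) := ⋂₀ {J | IsClosedIdealW J ∧ I ⊆ J}

/-- The hull `h(I)`: common zeros in the closed unit disk of all elements of `I`. -/
def hull (I : Set (ℂ → ℂ)) : Set ℂ :=
  {z ∈ Metric.closedBall (0 : ℂ) 1 | ∀ f ∈ I, f z = 0}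

/-- `I ≠ {0}`: `I` contains an element not identically zero on the unit disk. -/
def NontrivialIdeal (I : Set (ℂ → ℂ)) : Prop :=
  ∃ f ∈ I, ∃ z ∈ Metric.ball (0 : ℂ) 1, f z ≠ 0

/-- `H^∞(D)`: bounded holomorphic functions on the open unit disk. -/
def Hinf : Set (ℂ → ℂ) :=
  {f | DifferentiableOn ℂ f (Metric.ball (0 : ℂ) 1) ∧
    ∃ C : ℝ, ∀ z ∈ Metric.ball (0 : ℂ) 1, ‖f z‖ ≤ C}

/-- An inner function: a bounded-by-one holomorphic function on the unit disk whose
radial limits have modulus `1` at almost every boundary point. -/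
def IsInnerFunction (u : ℂ → ℂ) : Prop :=
  DifferentiableOn ℂ u (Metric.ball (0 : ℂ) 1) ∧
  (∀ z ∈ Metric.ball (0 : ℂ) 1, ‖u z‖ ≤ 1) ∧
  ∀ᵐ (θ : ℝ) ∂(MeasureTheory.volume.restrict (Set.Ioc (0 : ℝ) (2 * Real.pi))),
    Filter.Tendsto (fun r : ℝ => ‖u ((r : ℂ) * Complex.exp ((θ : ℂ) * Complex.I))‖)
      (nhdsWithin 1 (Set.Iio 1)) (nhds 1)

/-- `S` divides (the inner factor of) `f`, i.e. `f ∈ S·H^∞`. -/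
def InnerDivides (S f : ℂ → ℂ) : Prop :=
  ∃ g ∈ Hinf, ∀ z ∈ Metric.ball (0 : ℂ) 1, f z = S z * g z

/-- `S` is a greatest common divisor of the inner factors of the nonzero elements of `I`:
`S` is inner, divides every nonzero element of `I`, and every inner function with this
property divides `S`. -/
def IsGcdInner (I : Set (ℂ → ℂ)) (S : ℂ → ℂ) : Prop :=
  IsInnerFunction S ∧
  (∀ f ∈ I, (∃ z ∈ Metric.ball (0 : ℂ) 1, f z ≠ 0) → InnerDivides S f) ∧
  ∀ S' : ℂ → ℂ, IsInnerFunction S' →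
    (∀ f ∈ I, (∃ z ∈ Metric.ball (0 : ℂ) 1, f z ≠ 0) → InnerDivides S' f) →
    InnerDivides S' S

/-- The perfect symmetric set `E_ξ` of constant ratio `ξ` on the unit circle. -/
def Eset (ξ : ℝ) : Set ℂ :=
  {z | ∃ ε : ℕ → ℕ, (∀ k, ε k ≤ 1) ∧
    z = Complex.exp (2 * Real.pi * Complex.I *
      (((1 - ξ) * ∑' k : ℕ, (ε k : ℝ) * ξ ^ k : ℝ) : ℂ))}

/-- A Carleson set: a closed subset of the unit circle with
`∫_{-π}^{π} log (2 / dist(e^{iθ}, E)) dθ < ∞`. -/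
def IsCarleson (E : Set ℂ) : Prop :=
  IsClosed E ∧ E ⊆ Metric.sphere (0 : ℂ) 1 ∧
  MeasureTheory.IntegrableOn
    (fun θ : ℝ => Real.log (2 / Metric.infDist (Complex.exp ((θ : ℂ) * Complex.I)) E))
    (Set.Ioc (-Real.pi) Real.pi)

/-- The division ideal `I(f) = {g ∈ A⁺ : fg ∈ I}`. -/
def Idiv (I : Set (ℂ → ℂ)) (f : ℂ → ℂ) : Set (ℂ → ℂ) := {g ∈ APlus | f * g ∈ I}

/-- `f` belongs to `A^∞(D)` and vanishes on `E` together with all its derivatives: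
`f` is holomorphic on the disk, and each derivative extends continuously to the closed
disk with the extension vanishing on `E`. -/
def VanishAllDeriv (E : Set ℂ) (f : ℂ → ℂ) : Prop :=
  ContinuousOn f (Metric.closedBall (0 : ℂ) 1) ∧
  DifferentiableOn ℂ f (Metric.ball (0 : ℂ) 1) ∧
  (∀ z ∈ E, f z = 0) ∧
  ∀ n : ℕ, ∃ g : ℂ → ℂ, ContinuousOn g (Metric.closedBall (0 : ℂ) 1) ∧
    Set.EqOn g (iteratedDeriv n f) (Metric.ball (0 : ℂ) 1) ∧ ∀ z ∈ E, g z = 0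

/-- `J₀⁺(E)`: the closure in `A⁺` of the set of elements of `A^∞(D)` vanishing on `E`
together with all their derivatives. -/
def J0Plus (E : Set ℂ) : Set (ℂ → ℂ) :=
  {f | f ∈ APlus ∧ ∀ ε > 0, ∃ g ∈ APlus, VanishAllDeriv E g ∧ APlusNorm (f - g) < ε}

/-- `I⁺(E) = {f ∈ A⁺ : f ≡ 0 on E}`. -/
def IPlus (E : Set ℂ) : Set (ℂ → ℂ) := {f ∈ APlus | ∀ z ∈ E, f z = 0}

/-- The pairing of `f ∈ A⁺ ≅ ℓ¹(ℕ)` with an element `c ∈ c₀`. -/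
def pairing (f : ℂ → ℂ) (c : ℕ → ℂ) : ℂ := ∑' n : ℕ, taylorCoeff f n * c n

/-- `S` is dense in `A⁺` for the weak-star topology `σ(ℓ¹, c₀)`. -/
def WStarDense (S : Set (ℂ → ℂ)) : Prop :=
  ∀ f ∈ APlus, ∀ (m : ℕ) (c : Fin m → ℕ → ℂ),
    (∀ i, Filter.Tendsto (c i) Filter.atTop (nhds 0)) →
    ∀ ε > 0, ∃ g ∈ S, ∀ i, ‖pairing f (c i) - pairing g (c i)‖ < ε

/-- `S` is closed in `A⁺` for the weak-star topology `σ(ℓ¹, c₀)`. -/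
def WStarClosed (S : Set (ℂ → ℂ)) : Prop :=
  S ⊆ APlus ∧
  ∀ f ∈ APlus,
    (∀ (m : ℕ) (c : Fin m → ℕ → ℂ),
      (∀ i, Filter.Tendsto (c i) Filter.atTop (nhds 0)) →
      ∀ ε > 0, ∃ g ∈ S, ∀ i, ‖pairing f (c i) - pairing g (c i)‖ < ε) → f ∈ S

/-- A Kronecker set: a compact subset of the unit circle on which every continuous
unimodular function is a uniform limit of characters `z ↦ zⁿ`, `n ∈ ℤ`. -/
def IsKronecker (K : Set ℂ) : Prop :=
  IsCompact K ∧ K ⊆ Metric.sphere (0 : ℂ) 1 ∧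
  ∀ f : ℂ → ℂ, ContinuousOn f K → (∀ z ∈ K, ‖f z‖ = 1) →
    ∀ ε > 0, ∃ n : ℤ, ∀ z ∈ K, ‖f z - z ^ n‖ < ε

/-- A Helson set: a compact subset of the unit circle on which every continuous function
is the restriction of an element of the Wiener algebra. -/
def IsHelson (K : Set ℂ) : Prop :=
  IsCompact K ∧ K ⊆ Metric.sphere (0 : ℂ) 1 ∧
  ∀ f : ℂ → ℂ, ContinuousOn f K → ∃ g ∈ WienerAlg, ∀ z ∈ K, f z = g z

/-- The little Lipschitz class `Λ_α(D)`: disc-algebra functions with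
`|f(e^{it₁}) - f(e^{it₂})| / |t₁-t₂|^α → 0` uniformly as `|t₁-t₂| → 0`. -/
def LittleLip (α : ℝ) (f : ℂ → ℂ) : Prop :=
  ContinuousOn f (Metric.closedBall (0 : ℂ) 1) ∧
  DifferentiableOn ℂ f (Metric.ball (0 : ℂ) 1) ∧
  ∀ ε > 0, ∃ δ > 0, ∀ t₁ t₂ : ℝ, t₁ ≠ t₂ → |t₁ - t₂| < δ →
    ‖f (Complex.exp ((t₁ : ℂ) * Complex.I)) - f (Complex.exp ((t₂ : ℂ) * Complex.I))‖ ≤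
      ε * |t₁ - t₂| ^ α

/-- The perfect part of a set: the union of all its perfect subsets. -/
def perfectPart (C : Set ℂ) : Set ℂ := ⋃₀ {P | Perfect P ∧ P ⊆ C}

/-- A distribution on the unit circle, encoded by its sequence of Fourier coefficients
`μ̂(n) = μ(e^{-int})`, which has polynomial growth. -/
structure CircleDistribution where
  coeff : ℤ → ℂ
  growth : ∃ (C : ℝ) (k : ℕ), ∀ n : ℤ, ‖coeff n‖ ≤ C * (1 + (n.natAbs : ℝ)) ^ k

/-- A smooth `2π`-periodic function (test function on the circle). -/
def PeriodicSmooth (φ : ℝ → ℂ) : Prop :=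
  ContDiff ℝ (⊤ : ℕ∞) φ ∧ ∀ θ : ℝ, φ (θ + 2 * Real.pi) = φ θ

/-- Fourier coefficients of a test function. -/
def testCoeff (φ : ℝ → ℂ) (n : ℤ) : ℂ :=
  (1 / (2 * Real.pi)) * ∫ θ in (0:ℝ)..(2 * Real.pi),
    φ θ * Complex.exp (-(n : ℂ) * (θ : ℂ) * Complex.I)

/-- The action of a distribution on a test function: `μ(φ) = ∑ₙ μ̂(n) φ̂(-n)`. -/
def distAct (μ : CircleDistribution) (φ : ℝ → ℂ) : ℂ := ∑' n : ℤ, μ.coeff n * testCoeff φ (-n)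

/-- The support of a distribution on the circle: the points of the circle having no open
neighbourhood `U` such that `μ` kills every test function supported in `U`. -/
def distSupport (μ : CircleDistribution) : Set ℂ :=
  {z ∈ Metric.sphere (0 : ℂ) 1 | ∀ U : Set ℂ, IsOpen U → z ∈ U →
    ∃ φ : ℝ → ℂ, PeriodicSmooth φ ∧
      (∀ θ : ℝ, Complex.exp ((θ : ℂ) * Complex.I) ∉ U → φ θ = 0) ∧ distAct μ φ ≠ 0}

/-- A set of multiplicity: a closed subset of the circle supporting a nonzero
pseudofunction (distribution whose Fourier coefficients tend to `0` as `|n| → ∞`). -/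
def IsMSet (E : Set ℂ) : Prop :=
  IsClosed E ∧ E ⊆ Metric.sphere (0 : ℂ) 1 ∧
  ∃ μ : CircleDistribution, μ.coeff ≠ 0 ∧ distSupport μ ⊆ E ∧
    Filter.Tendsto μ.coeff Filter.cofinite (nhds 0)

/-- A Dirichlet set: `sup_{z ∈ E} |z^{n_k} - 1| → 0` for some sequence `n_k → ∞`. -/
def IsDirichletSet (E : Set ℂ) : Prop :=
  ∃ n : ℕ → ℕ, Filter.Tendsto n Filter.atTop Filter.atTop ∧
    ∀ ε > 0, ∀ᶠ k in Filter.atTop, ∀ z ∈ E, ‖z ^ (n k) - 1‖ < ε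

/-- The Cantor group. -/
abbrev CantorGroup := ℕ → ZMod 2

/-- The normalized Haar measure on the Cantor group. -/
def cantorHaar : Measure CantorGroup := Measure.addHaarMeasure ⊤

instance : IsProbabilityMeasure cantorHaar :=
  ⟨by simpa [cantorHaar] using Measure.addHaarMeasure_self (G := CantorGroup) (K₀ := ⊤)⟩

instance : cantorHaar.IsAddLeftInvariant := by unfold cantorHaar; infer_instance

/-- The real number with base `9/2` digits `ω`. -/
def digitSum (ω : CantorGroup) : ℝ := ∑' k, ((ω k).val : ℝ) * (2 / 9 : ℝ) ^ k

lemma ZMod.val_two_le_one (x : ZMod 2) : ((x.val : ℕ) : ℝ) ≤ 1 := by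
  have := ZMod.val_lt x
  exact_mod_cast Nat.lt_succ_iff.mp this

lemma norm_digit_le (ω : CantorGroup) (k : ℕ) :
    ‖((ω k).val : ℝ) * (2 / 9 : ℝ) ^ k‖ ≤ (2 / 9 : ℝ) ^ k := by
  rw [Real.norm_of_nonneg (by positivity)]
  exact mul_le_of_le_one_left (by positivity) (ZMod.val_two_le_one _)

lemma summable_digit (ω : CantorGroup) :
    Summable fun k => ((ω k).val : ℝ) * (2 / 9 : ℝ) ^ k :=
  Summable.of_norm_bounded (summable_geometric_of_lt_one (by norm_num) (by norm_num))
    (norm_digit_le ω)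

lemma continuous_digitSum : Continuous digitSum := by
  refine continuous_tsum (fun k => ?_)
    (summable_geometric_of_lt_one (by norm_num : (0 : ℝ) ≤ 2 / 9) (by norm_num))
    (fun k ω => norm_digit_le ω k)
  exact ((continuous_of_discreteTopology (f := fun x : ZMod 2 => (x.val : ℝ))).comp
    (continuous_apply k)).mul continuous_const

/-- The map from the Cantor group onto a perfect symmetric subset of the circle. -/
def cantorCircle : C(CantorGroup, Circle) :=
  ⟨fun ω => Circle.exp (2 * Real.pi * digitSum ω), by
    have := continuous_digitSum
    fun_prop⟩

/-- `e(x) = exp(2πix)`. -/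
def expTurn (x : ℝ) : ℂ := Circle.exp (2 * Real.pi * x)

lemma expTurn_add (x y : ℝ) : expTurn (x + y) = expTurn x * expTurn y := by
  simp [expTurn, mul_add, Circle.exp_add]

lemma norm_expTurn (x : ℝ) : ‖expTurn x‖ = 1 := Circle.norm_coe _

lemma continuous_expTurn : Continuous expTurn := by unfold expTurn; fun_prop

lemma cantorCircle_zpow (ω : CantorGroup) (m : ℤ) :
    (cantorCircle ω : ℂ) ^ m = expTurn (m * digitSum ω) := by
  simp only [cantorCircle, expTurn, ContinuousMap.coe_mk, ← Circle.coe_zpow]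
  congr 1
  ext
  simp only [Circle.coe_zpow, Circle.coe_exp]
  rw [← Complex.exp_int_mul]
  congr 1; push_cast; ring

lemma norm_one_add_expTurn_le {x : ℝ} (h : 1 / 11 ≤ |x - round x|) :
    ‖1 + expTurn x‖ ≤ 2 * Real.cos (Real.pi / 11) := by
  have h2 : |x - round x| ≤ 1 / 2 := abs_sub_round x
  set r := x - round x with hr
  have hx : expTurn x = Complex.exp ((2 * Real.pi * r : ℝ) * I) := by
    have : x = (round x : ℤ) + r := by rw [hr]; ring
    have h1 : expTurn ((round x : ℤ) : ℝ) = 1 := by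
      simp only [expTurn, Circle.coe_exp]
      rw [Complex.exp_eq_one_iff]
      exact ⟨round x, by push_cast; ring⟩
    conv_lhs => rw [this]
    rw [expTurn_add, h1, one_mul]
    simp [expTurn, Circle.coe_exp]
  have h3 : (1 : ℂ) + Complex.exp ((2 * Real.pi * r : ℝ) * I)
      = (2 * Real.cos (Real.pi * r) : ℝ) * Complex.exp ((Real.pi * r : ℝ) * I) := by
    have : ((2 * Real.pi * r : ℝ) * I : ℂ) = (Real.pi * r : ℝ) * I + (Real.pi * r : ℝ) * I := by
      push_cast; ring
    rw [this, Complex.exp_add]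
    push_cast
    rw [Complex.cos]
    rw [mul_div_cancel₀ _ (two_ne_zero), add_mul, ← Complex.exp_add (-_ * _)]
    simp
    ring
  rw [hx, h3, norm_mul, Complex.norm_exp_ofReal_mul_I, mul_one, Complex.norm_real,
    Real.norm_eq_abs, abs_mul, abs_two]
  have hpi := Real.pi_pos
  have h4 : Real.cos (Real.pi * r) = Real.cos (Real.pi * |r|) := by
    rw [← Real.cos_abs, abs_mul, abs_of_pos hpi]
  rw [h4, abs_of_nonneg]
  · gcongr
    apply Real.cos_le_cos_of_nonneg_of_le_pi (by positivity)
    · nlinarith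
    · nlinarith
  · apply Real.cos_nonneg_of_mem_Icc
    constructor <;> nlinarith [abs_nonneg r]

lemma exists_far_from_int (y : ℝ) (hy : 1 ≤ |y|) (L : ℕ) (hL : |y| + 1 < 2 ^ L) :
    ∃ i ≤ L, 1 / 11 ≤ |y * (9 / 2) ^ i - round (y * (9 / 2 : ℝ) ^ i)| := by
  by_contra! hcon
  set a : ℕ → ℤ := fun i => round (y * (9 / 2 : ℝ) ^ i) with ha
  have step : ∀ i < L, 2 * a (i + 1) = 9 * a i := by
    intro i hi
    have h1 := abs_lt.mp (hcon i hi.le)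
    have h2 := abs_lt.mp (hcon (i + 1) hi)
    have h3 : y * (9 / 2 : ℝ) ^ (i + 1) = 9 / 2 * (y * (9 / 2) ^ i) := by ring
    change _ < _ - (a i : ℝ) ∧ _ at h1
    change _ < _ - (a (i + 1) : ℝ) ∧ _ at h2
    have h4 : ((2 * a (i + 1) - 9 * a i : ℤ) : ℝ) < 1 := by
      push_cast; linarith [h1.1, h2.1, h1.2, h2.2]
    have h5 : (-1 : ℝ) < ((2 * a (i + 1) - 9 * a i : ℤ) : ℝ) := by
      push_cast; linarith [h1.1, h2.1, h1.2, h2.2]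
    have h6 : 2 * a (i + 1) - 9 * a i < 1 := by exact_mod_cast h4
    have h7 : -1 < 2 * a (i + 1) - 9 * a i := by exact_mod_cast h5
    omega
  have pw : ∀ i ≤ L, 2 ^ i * a i = 9 ^ i * a 0 := by
    intro i
    induction i with
    | zero => intro _; simp
    | succ i ih =>
      intro hi
      have := ih (by omega)
      have h2 := step i (by omega)
      calc (2 : ℤ) ^ (i + 1) * a (i + 1) = 2 ^ i * (2 * a (i + 1)) := by ring
        _ = 9 * (2 ^ i * a i) := by rw [h2]; ring
        _ = 9 ^ (i + 1) * a 0 := by rw [this]; ring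
  have hdvd : (2 : ℤ) ^ L ∣ a 0 := by
    have hco : IsCoprime ((2 : ℤ) ^ L) (9 ^ L) :=
      IsCoprime.pow (by norm_num)
    exact hco.dvd_of_dvd_mul_left ⟨_, (pw L le_rfl).symm⟩
  have h0 := abs_lt.mp (hcon 0 (Nat.zero_le _))
  change _ < _ - (a 0 : ℝ) ∧ _ - (a 0 : ℝ) < _ at h0
  simp only [pow_zero, mul_one] at h0
  have hne : a 0 ≠ 0 := by
    intro h
    rw [h] at h0
    have : |y| < 1 / 11 := by
      rw [abs_lt]
      constructor <;> [have := h0.1; have := h0.2] <;> push_cast at this <;> linarith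
    linarith
  have hle := Int.le_of_dvd (abs_pos.mpr hne) ((dvd_abs _ _).mpr hdvd)
  have hle' : (2 : ℝ) ^ L ≤ |(a 0 : ℝ)| := by exact_mod_cast hle
  have : |(a 0 : ℝ)| ≤ |y| + 1 / 11 := by
    have := abs_sub_abs_le_abs_sub (a 0 : ℝ) y
    have h8 : |(a 0 : ℝ) - y| < 1 / 11 := by rw [abs_lt]; constructor <;> linarith [h0.1, h0.2]
    linarith
  linarith

lemma exists_far_scale (A : ℝ) (hA : 1 ≤ A) : ∃ A' : ℝ, ∀ t : ℝ, A' ≤ |t| →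
    ∃ j : ℕ, A ≤ |t * (2 / 9) ^ j| ∧ |t * (2 / 9) ^ j| ≤ A' ∧
      1 / 11 ≤ |t * (2 / 9) ^ j - round (t * (2 / 9 : ℝ) ^ j)| := by
  obtain ⟨L, hL⟩ := pow_unbounded_of_one_lt (9 / 2 * A + 1) (one_lt_two (α := ℝ))
  refine ⟨(9 / 2) ^ (L + 1) * A, fun t ht => ?_⟩
  have hpow : ∀ n : ℕ, (9 / 2 : ℝ) ^ n * (2 / 9) ^ n = 1 := fun n => by
    rw [← mul_pow]; norm_num
  have hex : ∃ j : ℕ, |t * (2 / 9) ^ j| < A := by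
    have : Tendsto (fun j : ℕ => |t * (2 / 9 : ℝ) ^ j|) atTop (nhds |t * 0|) :=
      ((tendsto_pow_atTop_nhds_zero_of_lt_one (by norm_num) (by norm_num)).const_mul t).abs
    simp only [mul_zero, abs_zero] at this
    exact (this.eventually (gt_mem_nhds (by linarith))).exists
  classical
  set m := Nat.find hex with hm
  have hm1 : |t * (2 / 9) ^ m| < A := Nat.find_spec hex
  have habs : ∀ j : ℕ, |t * (2 / 9 : ℝ) ^ j| = |t| * (2 / 9) ^ j := fun j => by
    rw [abs_mul, abs_of_pos (a := (2 / 9 : ℝ) ^ j) (by positivity)]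
  have hmL : L + 1 < m := by
    by_contra! hle
    rw [habs] at hm1
    have h1 : (2 / 9 : ℝ) ^ (L + 1) ≤ (2 / 9) ^ m :=
      pow_le_pow_of_le_one (by norm_num) (by norm_num) hle
    have h2 : A ≤ |t| * (2 / 9) ^ (L + 1) := by
      calc A = (9 / 2) ^ (L + 1) * (2 / 9) ^ (L + 1) * A := by rw [hpow]; ring
        _ = ((9 / 2) ^ (L + 1) * A) * (2 / 9) ^ (L + 1) := by ring
        _ ≤ _ := by gcongr
    have h3 : |t| * (2 / 9) ^ (L + 1) ≤ |t| * (2 / 9 : ℝ) ^ m := by gcongr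
    linarith
  have hlow : A ≤ |t * (2 / 9) ^ (m - 1)| := by
    have := Nat.find_min hex (m := m - 1) (by omega)
    linarith
  have hm2 : m = (m - 1) + 1 := by omega
  have hup : |t * (2 / 9) ^ (m - 1)| ≤ 9 / 2 * A := by
    rw [hm2, pow_succ, ← mul_assoc, abs_mul, abs_of_pos (a := (2 / 9 : ℝ)) (by norm_num)] at hm1
    linarith
  obtain ⟨i, hi, hfar⟩ := exists_far_from_int (t * (2 / 9) ^ (m - 1)) (by linarith) L (by linarith)
  have hsplit : t * (2 / 9 : ℝ) ^ (m - 1) * (9 / 2) ^ i = t * (2 / 9) ^ (m - 1 - i) := by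
    have : m - 1 = (m - 1 - i) + i := by omega
    conv_lhs => rw [this, pow_add]
    calc _ = t * (2 / 9) ^ (m - 1 - i) * ((9 / 2) ^ i * (2 / 9) ^ i) := by ring
      _ = _ := by rw [hpow, mul_one]
  refine ⟨m - 1 - i, ?_, ?_, ?_⟩
  · rw [← hsplit, abs_mul]
    have : (1 : ℝ) ≤ |(9 / 2) ^ i| := by
      rw [abs_of_pos (by positivity)]; exact one_le_pow₀ (by norm_num)
    nlinarith
  · rw [← hsplit, abs_mul, abs_of_pos (a := (9 / 2 : ℝ) ^ i) (by positivity)]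
    calc _ ≤ 9 / 2 * A * (9 / 2) ^ L := by
          gcongr
          norm_num
      _ = _ := by ring
  · rw [← hsplit]; exact hfar

lemma exists_many_far (R : ℕ) : ∃ A : ℝ, 1 ≤ A ∧ ∀ t : ℝ, A ≤ |t| → ∃ J : Finset ℕ, J.card = R ∧
    ∀ j ∈ J, |t * (2 / 9) ^ j| ≤ A ∧
      1 / 11 ≤ |t * (2 / 9) ^ j - round (t * (2 / 9 : ℝ) ^ j)| := by
  induction R with
  | zero => exact ⟨1, le_rfl, fun t _ => ⟨∅, by simp, by simp⟩⟩
  | succ R ih =>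
    obtain ⟨A, hA1, hA⟩ := ih
    obtain ⟨A', hA'⟩ := exists_far_scale (A + 1) (by linarith)
    refine ⟨max A A', le_trans hA1 (le_max_left _ _), fun t ht => ?_⟩
    obtain ⟨J, hJc, hJ⟩ := hA t ((le_max_left _ _).trans ht)
    obtain ⟨j, h1, h2, h3⟩ := hA' t ((le_max_right _ _).trans ht)
    have hj : j ∉ J := fun h => by linarith [(hJ j h).1]
    refine ⟨insert j J, by rw [Finset.card_insert_of_notMem hj, hJc], fun i hi => ?_⟩
    rcases Finset.mem_insert.mp hi with rfl | hi
    · exact ⟨h2.trans (le_max_right _ _), h3⟩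
    · exact ⟨(hJ i hi).1.trans (le_max_left _ _), (hJ i hi).2⟩

lemma exists_many_far_ge (R n : ℕ) : ∃ A : ℝ, ∀ t : ℝ, A ≤ |t| → ∃ J : Finset ℕ, J.card = R ∧
    ∀ j ∈ J, n ≤ j ∧ ‖1 + expTurn (t * (2 / 9) ^ j)‖ ≤ 2 * Real.cos (Real.pi / 11) := by
  obtain ⟨A, hA1, hA⟩ := exists_many_far R
  refine ⟨(9 / 2) ^ n * (A + 1), fun t ht => ?_⟩
  have h1 : (1 : ℝ) ≤ (9 / 2) ^ n := one_le_pow₀ (by norm_num)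
  obtain ⟨J, hJc, hJ⟩ := hA t (by nlinarith)
  refine ⟨J, hJc, fun j hj => ⟨?_, norm_one_add_expTurn_le (hJ j hj).2⟩⟩
  by_contra! hlt
  have h2 := (hJ j hj).1
  rw [abs_mul, abs_of_pos (a := (2 / 9 : ℝ) ^ j) (by positivity)] at h2
  have h3 : (2 / 9 : ℝ) ^ n ≤ (2 / 9) ^ j :=
    pow_le_pow_of_le_one (by norm_num) (by norm_num) hlt.le
  have h4 : (9 / 2 : ℝ) ^ n * (2 / 9) ^ n = 1 := by rw [← mul_pow]; norm_num
  have : A + 1 ≤ |t| * (2 / 9) ^ j := by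
    calc A + 1 = (9 / 2) ^ n * (A + 1) * (2 / 9) ^ n := by linear_combination (-(A+1)) * h4
      _ ≤ |t| * (2 / 9) ^ j := by gcongr
  linarith

/-- Truncation to the first `n` coordinates. -/
def truncSeq (n : ℕ) (ω : CantorGroup) : CantorGroup := fun k => if k < n then ω k else 0

lemma continuous_truncSeq (n : ℕ) : Continuous (truncSeq n) := by
  refine continuous_pi fun k => ?_
  unfold truncSeq
  by_cases h : k < n
  · simp only [h, if_true]; exact continuous_apply k
  · simp only [h, if_false]; exact continuous_const

lemma tendsto_truncSeq (ω : CantorGroup) : Tendsto (fun n => truncSeq n ω) atTop (nhds ω) := by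
  rw [tendsto_pi_nhds]
  intro k
  refine tendsto_const_nhds.congr' ?_
  filter_upwards [eventually_gt_atTop k] with n hn
  simp [truncSeq, hn]

/-- The digit sum without the digits in `J`. -/
def digitSumOff (J : Finset ℕ) (ω : CantorGroup) : ℝ :=
  digitSum ω - ∑ k ∈ J, ((ω k).val : ℝ) * (2 / 9 : ℝ) ^ k

lemma continuous_digitSumOff (J : Finset ℕ) : Continuous (digitSumOff J) := by
  refine continuous_digitSum.sub (continuous_finsetSum _ fun k _ => ?_)
  exact ((continuous_of_discreteTopology (f := fun x : ZMod 2 => (x.val : ℝ))).comp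
    (continuous_apply k)).mul continuous_const

lemma digitSumOff_eq_tsum (J : Finset ℕ) (ω : CantorGroup) :
    digitSumOff J ω = ∑' k, if k ∈ J then 0 else ((ω k).val : ℝ) * (2 / 9 : ℝ) ^ k := by
  have h := (summable_digit ω).sum_add_tsum_subtype_compl J
  have h2 : (∑' k, if k ∈ J then 0 else ((ω k).val : ℝ) * (2 / 9 : ℝ) ^ k)
      = ∑' x : {x // x ∉ J}, ((ω x).val : ℝ) * (2 / 9 : ℝ) ^ (x : ℕ) := by
    have := tsum_subtype (f := fun k : ℕ => ((ω k).val : ℝ) * (2 / 9 : ℝ) ^ k) (s := {x | x ∉ J})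
    refine Eq.trans ?_ this.symm
    congr 1; ext k
    by_cases hk : k ∈ J <;> simp [hk, Set.indicator]
  rw [digitSumOff, digitSum, h2, ← h]; ring

lemma digitSumOff_add_single {J : Finset ℕ} {j : ℕ} (hj : j ∈ J) (ω : CantorGroup) :
    digitSumOff J (Pi.single j 1 + ω) = digitSumOff J ω := by
  rw [digitSumOff_eq_tsum, digitSumOff_eq_tsum]
  congr 1; ext k
  by_cases hk : k ∈ J
  · simp [hk]
  · have : k ≠ j := fun h => hk (h ▸ hj)
    simp [hk, this]

lemma expTurn_digit_add (t : ℝ) (x : ZMod 2) :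
    expTurn (t * (x.val : ℝ)) + expTurn (t * ((1 + x).val : ℝ)) = 1 + expTurn t := by
  have h0 : expTurn 0 = 1 := by simp [expTurn]
  have h : x = 0 ∨ x = 1 := by revert x; decide
  have h2 : (1 + 1 : ZMod 2) = 0 := by decide
  rcases h with rfl | rfl
  · simp [h0, ZMod.val_one]
  · rw [h2]; simp [h0, ZMod.val_one, add_comm]

lemma Continuous.integrable_cantorHaar {E : Type*} [NormedAddCommGroup E] {f : CantorGroup → E}
    [SecondCountableTopologyEither CantorGroup E] (hf : Continuous f) :
    Integrable f cantorHaar := by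
  obtain ⟨C, hC⟩ := (isCompact_range hf).isBounded.exists_norm_le
  exact Integrable.of_bound hf.aestronglyMeasurable C (ae_of_all _ fun ω => hC _ ⟨ω, rfl⟩)

lemma integral_digit_insert {h : CantorGroup → ℂ} (hc : Continuous h) {j : ℕ} {J : Finset ℕ}
    (hj : j ∉ J) (hinv : ∀ ω, h (Pi.single j 1 + ω) = h ω) (t : ℝ) :
    ∫ ω, h ω * expTurn (t * digitSumOff J ω) ∂cantorHaar =
      (1 + expTurn (t * (2 / 9) ^ j)) / 2 *
        ∫ ω, h ω * expTurn (t * digitSumOff (insert j J) ω) ∂cantorHaar := by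
  set F : CantorGroup → ℂ := fun ω => h ω * expTurn (t * digitSumOff (insert j J) ω) with hF
  have key : ∀ ω, h ω * expTurn (t * digitSumOff J ω)
      = F ω * expTurn (t * (2 / 9) ^ j * ((ω j).val : ℝ)) := by
    intro ω
    rw [hF]
    simp only
    rw [mul_assoc, ← expTurn_add]
    congr 2
    simp only [digitSumOff, Finset.sum_insert hj]
    ring
  have hdc : Continuous fun ω : CantorGroup => ((ω j).val : ℝ) :=
    (continuous_of_discreteTopology (f := fun x : ZMod 2 => (x.val : ℝ))).comp (continuous_apply j)
  have hdc' : Continuous fun ω : CantorGroup => ((1 + ω j).val : ℝ) :=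
    (continuous_of_discreteTopology (f := fun x : ZMod 2 => ((1 + x).val : ℝ))).comp
      (continuous_apply j)
  have hFc : Continuous F := by
    have := continuous_digitSumOff (insert j J)
    have := continuous_expTurn
    fun_prop
  have hFinv : ∀ ω, F (Pi.single j 1 + ω) = F ω := fun ω => by
    simp only [hF, hinv, digitSumOff_add_single (Finset.mem_insert_self j J)]
  have e1 : ∫ ω, h ω * expTurn (t * digitSumOff J ω) ∂cantorHaar =
      ∫ ω, F ω * expTurn (t * (2 / 9) ^ j * ((ω j).val : ℝ)) ∂cantorHaar := by
    simp_rw [key]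
  have e2 : ∫ ω, F ω * expTurn (t * (2 / 9) ^ j * ((ω j).val : ℝ)) ∂cantorHaar =
      ∫ ω, F ω * expTurn (t * (2 / 9) ^ j * ((1 + ω j).val : ℝ)) ∂cantorHaar := by
    rw [← integral_add_left_eq_self _ (Pi.single j 1 : CantorGroup)]
    simp only [hFinv]
    simp
  have hce := continuous_expTurn
  have e3 : (∫ ω, F ω * expTurn (t * (2 / 9) ^ j * ((ω j).val : ℝ)) ∂cantorHaar) +
      ∫ ω, F ω * expTurn (t * (2 / 9) ^ j * ((1 + ω j).val : ℝ)) ∂cantorHaar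
      = (1 + expTurn (t * (2 / 9) ^ j)) * ∫ ω, F ω ∂cantorHaar := by
    rw [← integral_add, ← integral_const_mul]
    · congr 1; ext ω
      rw [← mul_add, expTurn_digit_add]; ring
    · exact Continuous.integrable_cantorHaar (by fun_prop)
    · exact Continuous.integrable_cantorHaar (by fun_prop)
  rw [e1]
  rw [← e2] at e3
  linear_combination e3 / 2

lemma norm_integral_digit_le {h : CantorGroup → ℂ} (hc : Continuous h) {C : ℝ}
    (hC : ∀ ω, ‖h ω‖ ≤ C) (t c : ℝ) (J : Finset ℕ)
    (hJ : ∀ j ∈ J, (∀ ω, h (Pi.single j 1 + ω) = h ω) ∧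
      ‖1 + expTurn (t * (2 / 9) ^ j)‖ ≤ 2 * c) :
    ‖∫ ω, h ω * expTurn (t * digitSum ω) ∂cantorHaar‖ ≤ c ^ J.card * C := by
  have main : ∀ J : Finset ℕ, (∀ j ∈ J, (∀ ω, h (Pi.single j 1 + ω) = h ω) ∧
      ‖1 + expTurn (t * (2 / 9) ^ j)‖ ≤ 2 * c) →
      ‖∫ ω, h ω * expTurn (t * digitSumOff ∅ ω) ∂cantorHaar‖ ≤
        c ^ J.card * ‖∫ ω, h ω * expTurn (t * digitSumOff J ω) ∂cantorHaar‖ := by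
    intro J
    induction J using Finset.induction_on with
    | empty => intro _; simp
    | insert j J hj ih =>
      intro hJ
      have h1 := ih fun i hi => hJ i (Finset.mem_insert_of_mem hi)
      obtain ⟨h2, h3⟩ := hJ j (Finset.mem_insert_self j J)
      rw [integral_digit_insert hc hj h2, norm_mul] at h1
      rw [Finset.card_insert_of_notMem hj]
      have hc0 : 0 ≤ c := by linarith [norm_nonneg (1 + expTurn (t * (2 / 9) ^ j))]
      refine h1.trans ?_
      rw [pow_succ, mul_assoc]
      gcongr
      rw [norm_div]
      simp only [Complex.norm_ofNat]
      linarith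
  have h0 : ∀ ω, digitSumOff ∅ ω = digitSum ω := fun ω => by simp [digitSumOff]
  have := main J hJ
  simp_rw [h0] at this
  refine this.trans ?_
  have hb : ‖∫ ω, h ω * expTurn (t * digitSumOff J ω) ∂cantorHaar‖ ≤ C := by
    have := norm_integral_le_of_norm_le_const (μ := cantorHaar)
      (f := fun ω => h ω * expTurn (t * digitSumOff J ω)) (C := C)
      (ae_of_all _ fun ω => by rw [norm_mul, norm_expTurn, mul_one]; exact hC ω)
    simpa using this
  rcases J.eq_empty_or_nonempty with rfl | ⟨j, hj⟩
  · simpa using hb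
  · have hc0 : 0 ≤ c := by
      linarith [norm_nonneg (1 + expTurn (t * (2 / 9) ^ j)), (hJ j hj).2]
    gcongr

/-- The image of Haar measure under `cantorCircle`, and every measure with a continuous density
against it, has Fourier coefficients tending to `0`. -/
theorem exists_norm_integral_zpow_lt {g : CantorGroup → ℂ} (hg : Continuous g) {ε : ℝ}
    (hε : 0 < ε) : ∃ M : ℕ, ∀ m : ℤ, (M : ℤ) ≤ |m| →
      ‖∫ ω, g ω * (cantorCircle ω : ℂ) ^ m ∂cantorHaar‖ < ε := by
  obtain ⟨C, hC⟩ := (isCompact_range hg).isBounded.exists_norm_le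
  have hC' : ∀ ω, ‖g ω‖ ≤ C := fun ω => hC _ ⟨ω, rfl⟩
  have hC0 : 0 ≤ C := (norm_nonneg _).trans (hC' 0)
  have hlim : Tendsto (fun n => ∫ ω, ‖g ω - g (truncSeq n ω)‖ ∂cantorHaar) atTop (nhds 0) := by
    have := tendsto_integral_of_dominated_convergence (μ := cantorHaar)
      (F := fun n ω => ‖g ω - g (truncSeq n ω)‖) (f := fun _ => 0) (fun _ => 2 * C)
      (fun n => by
        have := continuous_truncSeq n
        exact Continuous.aestronglyMeasurable (by fun_prop))
      (integrable_const _)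
      (fun n => ae_of_all _ fun ω => by
        rw [norm_norm]
        refine (norm_sub_le _ _).trans ?_
        linarith [hC' ω, hC' (truncSeq n ω)])
      (ae_of_all _ fun ω => by
        have h1 := (hg.tendsto ω).comp (tendsto_truncSeq ω)
        have h2 := (tendsto_const_nhds (x := g ω)).sub h1
        simpa using h2.norm)
    simpa using this
  obtain ⟨n, hn⟩ := (hlim.eventually (gt_mem_nhds (half_pos hε))).exists
  have hcos0 : 0 ≤ Real.cos (Real.pi / 11) := by
    apply Real.cos_nonneg_of_mem_Icc
    constructor <;> linarith [Real.pi_pos]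
  have hcos1 : Real.cos (Real.pi / 11) < 1 := by
    rw [← Real.cos_zero]
    apply Real.cos_lt_cos_of_nonneg_of_le_pi le_rfl <;> linarith [Real.pi_pos]
  obtain ⟨R, hR⟩ : ∃ R : ℕ, Real.cos (Real.pi / 11) ^ R * C < ε / 2 := by
    have := (tendsto_pow_atTop_nhds_zero_of_lt_one hcos0 hcos1).mul_const C
    rw [zero_mul] at this
    exact (this.eventually (gt_mem_nhds (half_pos hε))).exists
  obtain ⟨A, hA⟩ := exists_many_far_ge R n
  obtain ⟨M, hM⟩ := exists_nat_ge A
  refine ⟨M, fun m hm => ?_⟩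
  obtain ⟨J, hJc, hJ⟩ := hA m (hM.trans (by exact_mod_cast hm))
  have hgt : Continuous fun ω => g (truncSeq n ω) := hg.comp (continuous_truncSeq n)
  have hb := norm_integral_digit_le hgt (fun ω => hC' _) m (Real.cos (Real.pi / 11)) J
    (fun j hj => ⟨fun ω => by
      congr 1; ext k
      simp only [truncSeq]
      split_ifs with hk
      · have : k ≠ j := by have := (hJ j hj).1; omega
        simp [this]
      · rfl, (hJ j hj).2⟩)
  rw [hJc] at hb
  simp_rw [cantorCircle_zpow]
  have hce := continuous_expTurn
  have hcd := continuous_digitSum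
  have hct := continuous_truncSeq n
  have hsplit : ∫ ω, g ω * expTurn (m * digitSum ω) ∂cantorHaar =
      (∫ ω, (g ω - g (truncSeq n ω)) * expTurn (m * digitSum ω) ∂cantorHaar) +
      ∫ ω, g (truncSeq n ω) * expTurn (m * digitSum ω) ∂cantorHaar := by
    rw [← integral_add]
    · congr 1; ext ω; ring
    · exact Continuous.integrable_cantorHaar (by fun_prop)
    · exact Continuous.integrable_cantorHaar (by fun_prop)
  rw [hsplit]
  refine (norm_add_le _ _).trans_lt ?_
  have h1 : ‖∫ ω, (g ω - g (truncSeq n ω)) * expTurn (m * digitSum ω) ∂cantorHaar‖ < ε / 2 := by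
    refine (norm_integral_le_integral_norm _).trans_lt ?_
    simpa [norm_mul, norm_expTurn] using hn
  linarith

/-- `f` is on the unit circle the sum of the absolutely convergent Fourier series `∑ aₙ zⁿ`. -/
def IsWienerRep (f : ℂ → ℂ) (a : ℤ → ℂ) : Prop :=
  Summable (fun n => ‖a n‖) ∧ ∀ z ∈ sphere (0 : ℂ) 1, HasSum (fun n : ℤ => a n * z ^ n) (f z)

lemma exp_mem_sphere (θ : ℝ) : Complex.exp ((θ : ℂ) * I) ∈ sphere (0 : ℂ) 1 := by
  simp [Complex.norm_exp_ofReal_mul_I]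

lemma integral_exp_int (k : ℤ) :
    ∫ θ in (0 : ℝ)..(2 * Real.pi), Complex.exp ((k : ℂ) * (θ : ℂ) * I)
      = if k = 0 then (2 * Real.pi : ℂ) else 0 := by
  split_ifs with h
  · simp [h]
  · have hk : (k : ℂ) * I ≠ 0 := mul_ne_zero (by exact_mod_cast h) I_ne_zero
    have := integral_exp_mul_complex (a := 0) (b := 2 * Real.pi) hk
    have h2 : ∀ θ : ℝ, (k : ℂ) * (θ : ℂ) * I = (k : ℂ) * I * θ := fun θ => by ring
    simp_rw [h2, this]
    have h3 : Complex.exp ((k : ℂ) * I * ((2 * Real.pi : ℝ) : ℂ)) = 1 := by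
      rw [Complex.exp_eq_one_iff]; exact ⟨k, by push_cast; ring⟩
    rw [h3]; simp

lemma IsWienerRep.fcoeff_eq {f : ℂ → ℂ} {a : ℤ → ℂ} (h : IsWienerRep f a) (n : ℤ) :
    fcoeff f n = a n := by
  have key : HasSum (fun k : ℤ => ∫ θ in (0 : ℝ)..(2 * Real.pi),
      a k * Complex.exp (((k - n : ℤ) : ℂ) * (θ : ℂ) * I))
      (∫ θ in (0 : ℝ)..(2 * Real.pi), f (Complex.exp ((θ : ℂ) * I)) *
        Complex.exp (-(n : ℂ) * (θ : ℂ) * I)) := by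
    refine intervalIntegral.hasSum_integral_of_dominated_convergence (fun k _ => ‖a k‖)
      (fun k => Continuous.aestronglyMeasurable (by fun_prop))
      (fun k => ae_of_all _ fun θ _ => ?_) (ae_of_all _ fun θ _ => h.1) (by simp)
      (ae_of_all _ fun θ _ => ?_)
    · rw [norm_mul]
      have : (((k - n : ℤ) : ℂ) * (θ : ℂ) * I) = (((k - n : ℤ) * θ : ℝ) : ℂ) * I := by
        push_cast; ring
      rw [this, Complex.norm_exp_ofReal_mul_I, mul_one]
    · have := (h.2 _ (exp_mem_sphere θ)).mul_right (Complex.exp (-(n : ℂ) * (θ : ℂ) * I))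
      refine this.congr_fun ?_ |> fun h => h
      intro k
      rw [mul_assoc (a k), ← Complex.exp_int_mul (θ * I) k, ← Complex.exp_add]
      congr 2; push_cast; ring
  simp_rw [intervalIntegral.integral_const_mul, integral_exp_int, sub_eq_zero] at key
  have h2 := hasSum_ite_eq n (a n * (2 * Real.pi : ℂ))
  have h3 : ∀ k, a k * (if k = n then (2 * Real.pi : ℂ) else 0)
      = if k = n then a n * (2 * Real.pi : ℂ) else 0 := fun k => by
    split_ifs with hk <;> simp [hk]
  simp_rw [h3] at key
  rw [fcoeff, key.unique h2]
  have : (Real.pi : ℂ) ≠ 0 := by exact_mod_cast Real.pi_ne_zero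
  field_simp

lemma IsWienerRep.mem {f : ℂ → ℂ} {a : ℤ → ℂ} (h : IsWienerRep f a) : f ∈ WienerAlg := by
  have : fcoeff f = a := funext h.fcoeff_eq
  exact ⟨by rw [this]; exact h.1, by rw [this]; exact h.2⟩

lemma IsWienerRep.wienerNorm_eq {f : ℂ → ℂ} {a : ℤ → ℂ} (h : IsWienerRep f a) :
    WienerNorm f = ∑' n, ‖a n‖ := by
  have : fcoeff f = a := funext h.fcoeff_eq
  rw [WienerNorm, this]

lemma isWienerRep_fcoeff {f : ℂ → ℂ} (h : f ∈ WienerAlg) : IsWienerRep f (fcoeff f) := h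

lemma IsWienerRep.add {f g : ℂ → ℂ} {a b : ℤ → ℂ} (hf : IsWienerRep f a) (hg : IsWienerRep g b) :
    IsWienerRep (f + g) (a + b) := by
  refine ⟨Summable.of_nonneg_of_le (fun _ => norm_nonneg _) (fun n => norm_add_le _ _)
    (hf.1.add hg.1), fun z hz => ?_⟩
  simpa [add_mul] using (hf.2 z hz).add (hg.2 z hz)

lemma IsWienerRep.const_mul {f : ℂ → ℂ} {a : ℤ → ℂ} (hf : IsWienerRep f a) (c : ℂ) :
    IsWienerRep (fun z => c * f z) (fun n => c * a n) := by
  refine ⟨by simpa using hf.1.mul_left ‖c‖, fun z hz => ?_⟩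
  simpa [mul_assoc] using (hf.2 z hz).mul_left c

lemma IsWienerRep.congr {f g : ℂ → ℂ} {a : ℤ → ℂ} (hf : IsWienerRep f a)
    (h : ∀ z ∈ sphere (0 : ℂ) 1, f z = g z) : IsWienerRep g a :=
  ⟨hf.1, fun z hz => h z hz ▸ hf.2 z hz⟩

lemma ne_zero_of_mem_sphere_one {z : ℂ} (hz : z ∈ sphere (0 : ℂ) 1) : z ≠ 0 := by
  rintro rfl; simp at hz

/-- The change of variables `(n, k) ↦ (n - k, k)`. -/
def convEquiv : ℤ × ℤ ≃ ℤ × ℤ where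
  toFun p := (p.1 - p.2, p.2)
  invFun p := (p.1 + p.2, p.2)
  left_inv p := by simp
  right_inv p := by simp

lemma IsWienerRep.mul {f g : ℂ → ℂ} {a b : ℤ → ℂ} (hf : IsWienerRep f a) (hg : IsWienerRep g b) :
    ∃ c, IsWienerRep (fun z => f z * g z) c ∧ ∑' n, ‖c n‖ ≤ (∑' n, ‖a n‖) * ∑' n, ‖b n‖ := by
  let e : ℤ × ℤ ≃ ℤ × ℤ := convEquiv
  have hpos : Summable fun p : ℤ × ℤ => ‖a p.1‖ * ‖b p.2‖ :=
    hf.1.mul_of_nonneg hg.1 (fun _ => norm_nonneg _) (fun _ => norm_nonneg _)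
  have hab : Summable fun p : ℤ × ℤ => ‖a (p.1 - p.2)‖ * ‖b p.2‖ :=
    (e.summable_iff (f := fun p : ℤ × ℤ => ‖a p.1‖ * ‖b p.2‖)).mpr hpos
  have hfib : ∀ n, Summable fun k => ‖a (n - k)‖ * ‖b k‖ := fun n => hab.prod_factor n
  have hout : Summable fun n => ∑' k, ‖a (n - k)‖ * ‖b k‖ := hab.prod
  have hle : ∀ n, ‖∑' k, a (n - k) * b k‖ ≤ ∑' k, ‖a (n - k)‖ * ‖b k‖ := fun n => by
    refine (norm_tsum_le_tsum_norm ?_).trans_eq ?_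
    · simpa only [norm_mul] using hfib n
    · simp only [norm_mul]
  have htot : ∑' n, ∑' k, ‖a (n - k)‖ * ‖b k‖ = (∑' n, ‖a n‖) * ∑' n, ‖b n‖ := by
    refine (hab.tsum_prod).symm.trans ?_
    refine Eq.trans ?_ (hf.1.tsum_mul_tsum hg.1 hpos).symm
    exact e.tsum_eq (fun p : ℤ × ℤ => ‖a p.1‖ * ‖b p.2‖)
  have hsum : Summable fun n => ‖∑' k, a (n - k) * b k‖ :=
    Summable.of_nonneg_of_le (fun _ => norm_nonneg _) hle hout
  refine ⟨fun n => ∑' k, a (n - k) * b k, ⟨hsum, fun z hz => ?_⟩, ?_⟩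
  · have hz1 : ‖z‖ = 1 := by simpa using hz
    have hz0 := ne_zero_of_mem_sphere_one hz
    have h1 : HasSum (fun p : ℤ × ℤ => (a p.1 * z ^ p.1) * (b p.2 * z ^ p.2)) (f z * g z) := by
      refine HasSum.mul (f := fun n : ℤ => a n * z ^ n) (g := fun n : ℤ => b n * z ^ n)
        (hf.2 z hz) (hg.2 z hz) (Summable.of_norm ?_)
      simpa [hz1] using hpos
    have h2 : HasSum (fun p : ℤ × ℤ => a (p.1 - p.2) * b p.2 * z ^ p.1) (f z * g z) := by
      have h5 := (e.hasSum_iff).mpr h1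
      convert h5 using 1
      ext p
      have : z ^ p.1 = z ^ (p.1 - p.2) * z ^ p.2 := by rw [← zpow_add₀ hz0]; simp
      simp only [Function.comp, e, convEquiv, Equiv.coe_fn_mk]
      rw [this]; ring
    refine h2.prod_fiberwise fun n => ?_
    have h4 : Summable fun k => a (n - k) * b k :=
      Summable.of_norm (by simpa only [norm_mul] using hfib n)
    exact h4.hasSum.mul_right (z ^ n)
  · rw [← htot]
    exact hsum.tsum_le_tsum hle hout

lemma IsWienerRep.comp_pow {f : ℂ → ℂ} {a : ℤ → ℂ} (hf : IsWienerRep f a) {L : ℕ} (hL : L ≠ 0) :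
    ∃ c, IsWienerRep (fun z => f (z ^ L)) c ∧ ∑' n, ‖c n‖ = ∑' n, ‖a n‖ := by
  have hL' : (L : ℤ) ≠ 0 := by exact_mod_cast hL
  have hinj : Function.Injective fun n : ℤ => (L : ℤ) * n := mul_right_injective₀ hL'
  have hzero : ∀ x ∉ Set.range (fun n : ℤ => (L : ℤ) * n),
      (Function.extend (fun n : ℤ => (L : ℤ) * n) a 0) x = 0 := fun x hx => by
    rw [Function.extend_apply' _ _ _ (by simpa using hx)]; rfl
  have hcomp : ∀ n : ℤ, (Function.extend (fun n : ℤ => (L : ℤ) * n) a 0) ((L : ℤ) * n) = a n :=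
    fun n => hinj.extend_apply a 0 n
  refine ⟨Function.extend (fun n : ℤ => (L : ℤ) * n) a 0, ⟨?_, fun z hz => ?_⟩, ?_⟩
  · rw [← hinj.summable_iff (fun x hx => by simp [hzero x hx])]
    simpa [Function.comp_def, hcomp] using hf.1
  · have hz1 : ‖z‖ = 1 := by simpa using hz
    rw [← hinj.hasSum_iff (fun x hx => by simp [hzero x hx])]
    have := hf.2 (z ^ L) (by simp [hz1])
    simpa [Function.comp_def, hcomp, zpow_mul] using this
  · rw [← hinj.tsum_eq (f := fun n => ‖Function.extend (fun n : ℤ => (L : ℤ) * n) a 0 n‖)]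
    · simp [hcomp]
    · intro x hx
      by_contra h
      exact hx (by simp [hzero x h])

lemma isWienerRep_single (n : ℤ) (c : ℂ) :
    IsWienerRep (fun z => c * z ^ n) (Pi.single n c) := by
  refine ⟨(summable_of_ne_finset_zero (s := {n}) fun m hm => ?_), fun z _ => ?_⟩
  · have : m ≠ n := by simpa using hm
    simp [this]
  · have := hasSum_single (f := fun m : ℤ => (Pi.single n c : ℤ → ℂ) m * z ^ m) n
      fun m hm => by simp [hm]
    simpa using this

lemma periodic_comp_exp (f : ℂ → ℂ) :
    Function.Periodic (fun θ : ℝ => f (Complex.exp ((θ : ℂ) * I))) (2 * Real.pi) := fun θ => by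
  simp only
  congr 1
  rw [Complex.exp_eq_exp_iff_exists_int]
  exact ⟨1, by push_cast; ring⟩

lemma mem_wienerAlg_of_summable {f : ℂ → ℂ}
    (hf : Continuous fun θ : ℝ => f (Complex.exp ((θ : ℂ) * I)))
    (h : Summable fun n => ‖fcoeff f n‖) : f ∈ WienerAlg := by
  have : Fact (0 < 2 * Real.pi) := ⟨by positivity⟩
  let F : C(AddCircle (2 * Real.pi), ℂ) :=
    ⟨(periodic_comp_exp f).lift, continuous_coinduced_dom.mpr hf⟩
  have hF : ∀ θ : ℝ, F (θ : AddCircle (2 * Real.pi)) = f (Complex.exp ((θ : ℂ) * I)) :=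
    fun θ => rfl
  have hcoe : ∀ θ : ℝ, ((AddCircle.toCircle (θ : AddCircle (2 * Real.pi)) : Circle) : ℂ)
      = Complex.exp ((θ : ℂ) * I) := fun θ => by
    rw [AddCircle.toCircle_apply_mk, Circle.coe_exp]
    congr 2
    have := Real.pi_ne_zero
    rw [div_self (by positivity), one_mul]
  have hfour : ∀ (n : ℤ) (x : AddCircle (2 * Real.pi)),
      fourier n x = ((AddCircle.toCircle x : Circle) : ℂ) ^ n := fun n x => by
    rw [fourier_apply, AddCircle.toCircle_zsmul]; simp
  have hc : ∀ n, fourierCoeff F n = fcoeff f n := fun n => by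
    rw [fourierCoeff_eq_intervalIntegral F n 0, fcoeff, zero_add]
    rw [Complex.real_smul]
    congr 1
    · push_cast; rfl
    · congr 1; ext θ
      rw [hfour, hcoe, smul_eq_mul, mul_comm, hF]
      congr 1
      rw [← Complex.exp_int_mul]; congr 1; push_cast; ring
  refine ⟨h, fun z hz => ?_⟩
  have hz1 : ‖z‖ = 1 := by simpa using hz
  have hs : Summable (fourierCoeff F) := by
    refine Summable.of_norm ?_
    simpa only [hc] using h
  obtain ⟨θ, hθ⟩ : ∃ θ : ℝ, Complex.exp ((θ : ℂ) * I) = z := ⟨z.arg, by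
    have := Complex.norm_mul_exp_arg_mul_I z
    rwa [hz1, Complex.ofReal_one, one_mul] at this⟩
  have := has_pointwise_sum_fourier_series_of_summable hs (θ : AddCircle (2 * Real.pi))
  simp only [hfour, hcoe, hθ, hc, smul_eq_mul] at this
  rw [hF, hθ] at this
  exact this

lemma integral_mul_exp_of_contDiff {G : ℝ → ℂ} (hG : ContDiff ℝ 1 G)
    (hper : G (2 * Real.pi) = G 0) {n : ℤ} (hn : n ≠ 0) :
    ∫ θ in (0 : ℝ)..(2 * Real.pi), G θ * Complex.exp (-(n : ℂ) * (θ : ℂ) * I)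
      = (1 / (n * I)) * ∫ θ in (0 : ℝ)..(2 * Real.pi),
        deriv G θ * Complex.exp (-(n : ℂ) * (θ : ℂ) * I) := by
  have hk : (n : ℂ) * I ≠ 0 := mul_ne_zero (by exact_mod_cast hn) I_ne_zero
  have hv : ∀ θ : ℝ, HasDerivAt (fun θ : ℝ => -(1 / (n * I)) * Complex.exp (-(n : ℂ) * (θ : ℂ) * I))
      (Complex.exp (-(n : ℂ) * (θ : ℂ) * I)) θ := fun θ => by
    have h1 : HasDerivAt (fun θ : ℝ => -(n : ℂ) * (θ : ℂ) * I) (-(n : ℂ) * 1 * I) θ :=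
      (((hasDerivAt_id θ).ofReal_comp).const_mul _).mul_const _
    have h2 := (h1.cexp).const_mul (-(1 / (n * I)) : ℂ)
    have hn' : (n : ℂ) ≠ 0 := by exact_mod_cast hn
    refine h2.congr_deriv ?_
    field_simp
  have := intervalIntegral.integral_mul_deriv_eq_deriv_mul (a := 0) (b := 2 * Real.pi)
    (u := G) (u' := deriv G)
    (v := fun θ : ℝ => -(1 / (n * I)) * Complex.exp (-(n : ℂ) * (θ : ℂ) * I))
    (v' := fun θ : ℝ => Complex.exp (-(n : ℂ) * (θ : ℂ) * I))
    (fun θ _ => (hG.differentiable (by norm_num) θ).hasDerivAt) (fun θ _ => hv θ)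
    ((hG.continuous_deriv le_rfl).intervalIntegrable _ _)
    (Continuous.intervalIntegrable (by fun_prop) _ _)
  rw [this, hper]
  have h3 : Complex.exp (-(n : ℂ) * ((2 * Real.pi : ℝ) : ℂ) * I) =
      Complex.exp (-(n : ℂ) * ((0 : ℝ) : ℂ) * I) := by
    have : Complex.exp (-(n : ℂ) * ((2 * Real.pi : ℝ) : ℂ) * I) = 1 := by
      rw [Complex.exp_eq_one_iff]; exact ⟨-n, by push_cast; ring⟩
    rw [this]; simp
  rw [h3, sub_self, zero_sub, ← intervalIntegral.integral_const_mul,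
    ← intervalIntegral.integral_neg]
  congr 1; ext θ; ring

theorem mem_wienerAlg_of_contDiff {f : ℂ → ℂ}
    (hf : ContDiff ℝ 2 fun θ : ℝ => f (Complex.exp ((θ : ℂ) * I))) : f ∈ WienerAlg := by
  set G : ℝ → ℂ := fun θ : ℝ => f (Complex.exp ((θ : ℂ) * I)) with hGdef
  have hper : Function.Periodic G (2 * Real.pi) := periodic_comp_exp f
  have hG1 : ContDiff ℝ 1 (deriv G) := by
    have : ContDiff ℝ (1 + 1) G := by convert hf using 1; norm_num
    exact (contDiff_succ_iff_deriv.mp this).2.2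
  have hper1 : deriv G (2 * Real.pi) = deriv G 0 := by
    have h : (fun θ => G (θ + 2 * Real.pi)) = G := funext hper
    have h2 := deriv_comp_add_const (f := G) (2 * Real.pi) 0
    rw [h, zero_add] at h2
    exact h2.symm
  have hper0 : G (2 * Real.pi) = G 0 := by simpa using hper 0
  have hG2 : Continuous (deriv (deriv G)) := hG1.continuous_deriv le_rfl
  obtain ⟨C, hC⟩ : ∃ C, ∀ θ ∈ Set.uIcc 0 (2 * Real.pi), ‖deriv (deriv G) θ‖ ≤ C :=
    isCompact_uIcc.exists_bound_of_continuousOn hG2.continuousOn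
  have hbound : ∀ n : ℤ, n ≠ 0 → ‖fcoeff f n‖ ≤ C * (1 / (n : ℝ) ^ 2) := by
    intro n hn
    have hn' : (0 : ℝ) < (n : ℝ) ^ 2 := by positivity
    have e1 := integral_mul_exp_of_contDiff (hf.of_le (by norm_num)) hper0 hn
    rw [integral_mul_exp_of_contDiff hG1 hper1 hn] at e1
    have e2 : ‖∫ θ in (0 : ℝ)..(2 * Real.pi),
        deriv (deriv G) θ * Complex.exp (-(n : ℂ) * (θ : ℂ) * I)‖ ≤ C * |2 * Real.pi - 0| := by
      refine intervalIntegral.norm_integral_le_of_norm_le_const fun θ hθ => ?_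
      have : (-(n : ℂ) * (θ : ℂ) * I) = ((-n * θ : ℝ) : ℂ) * I := by push_cast; ring
      rw [norm_mul, this, Complex.norm_exp_ofReal_mul_I, mul_one]
      exact hC θ (Set.uIoc_subset_uIcc hθ)
    rw [fcoeff, e1, ← mul_assoc, ← mul_assoc, norm_mul]
    have e3 : ‖(1 / (2 * Real.pi) : ℂ) * (1 / (n * I)) * (1 / (n * I))‖
        = 1 / (2 * Real.pi) * (1 / (n : ℝ) ^ 2) := by
      simp only [norm_mul, norm_div, norm_one, Complex.norm_I, mul_one, Complex.norm_intCast,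
        Complex.norm_real, Complex.norm_ofNat, Real.norm_eq_abs, abs_of_pos Real.pi_pos]
      rw [← sq_abs (n : ℝ)]; ring
    rw [e3]
    rw [sub_zero, abs_of_pos (by positivity)] at e2
    calc _ ≤ 1 / (2 * Real.pi) * (1 / (n : ℝ) ^ 2) * (C * (2 * Real.pi)) := by gcongr
      _ = _ := by have := Real.pi_ne_zero; field_simp
  refine mem_wienerAlg_of_summable hf.continuous ?_
  refine Summable.of_norm_bounded_eventually (g := fun n : ℤ => C * (1 / (n : ℝ) ^ 2))
    ((Real.summable_one_div_int_pow.mpr one_lt_two).mul_left C) ?_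
  rw [Filter.eventually_cofinite]
  refine (Set.finite_singleton (0 : ℤ)).subset fun n hn => ?_
  by_contra h
  exact hn (by simpa using hbound n h)

/-- Extension of a one-sided sequence by zero. -/
def extendInt (a : ℕ → ℂ) (n : ℤ) : ℂ := if 0 ≤ n then a n.toNat else 0

lemma extendInt_natCast (a : ℕ → ℂ) (n : ℕ) : extendInt a n = a n := by simp [extendInt]

lemma extendInt_of_neg (a : ℕ → ℂ) {n : ℤ} (hn : n < 0) : extendInt a n = 0 := by
  simp [extendInt, not_le.mpr hn]

lemma extendInt_of_notMem_range (a : ℕ → ℂ) (n : ℤ) (hn : n ∉ Set.range ((↑) : ℕ → ℤ)) :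
    extendInt a n = 0 := by
  refine extendInt_of_neg a ?_
  by_contra! h
  exact hn ⟨n.toNat, Int.toNat_of_nonneg h⟩

lemma isWienerRep_extendInt {f : ℂ → ℂ} {a : ℕ → ℂ} (ha : Summable fun n => ‖a n‖)
    (hf : ∀ z ∈ closedBall (0 : ℂ) 1, HasSum (fun n => a n * z ^ n) (f z)) :
    IsWienerRep f (extendInt a) := by
  refine ⟨?_, fun z hz => ?_⟩
  · rw [← Nat.cast_injective.summable_iff (f := fun n : ℤ => ‖extendInt a n‖)
      (fun x hx => by simp [extendInt_of_notMem_range a x hx])]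
    simpa [Function.comp_def, extendInt_natCast] using ha
  · rw [← Nat.cast_injective.hasSum_iff (f := fun n : ℤ => extendInt a n * z ^ n)
      (fun x hx => by simp [extendInt_of_notMem_range a x hx])]
    simpa [Function.comp_def, extendInt_natCast] using hf z (sphere_subset_closedBall hz)

lemma mem_APlus_of_differentiableOn {f : ℂ → ℂ} {R : ℝ} (hR : 1 < R)
    (hf : DifferentiableOn ℂ f (ball 0 R)) : f ∈ APlus := by
  obtain ⟨r, hr1, hrR⟩ := exists_between hR
  lift r to NNReal using by linarith
  have h := (hf.mono (closedBall_subset_ball hrR)).hasFPowerSeriesOnBall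
    (by exact_mod_cast (zero_lt_one.trans hr1))
  set p := cauchyPowerSeries f 0 r
  refine ⟨p.coeff, ?_, fun z hz => ?_⟩
  · have h2 : ((1 : NNReal) : ENNReal) < p.radius :=
      lt_of_lt_of_le (by exact_mod_cast hr1) h.r_le
    have := p.summable_norm_mul_pow h2
    simpa [FormalMultilinearSeries.norm_apply_eq_norm_coef] using this
  · have hz' : ‖z‖ ≤ 1 := by simpa using hz
    have := h.hasSum (y := z) (by
      rw [mem_eball_zero_iff]
      rw [← ofReal_norm, ← ENNReal.ofReal_coe_nnreal]
      exact ENNReal.ofReal_lt_ofReal_iff_of_nonneg (norm_nonneg _) |>.mpr (by linarith))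
    simpa [mul_comm] using this

lemma norm_fcoeff_le {f : ℂ → ℂ} {C : ℝ} (h : ∀ z ∈ sphere (0 : ℂ) 1, ‖f z‖ ≤ C) (n : ℤ) :
    ‖fcoeff f n‖ ≤ C := by
  have e2 : ‖∫ θ in (0 : ℝ)..(2 * Real.pi), f (Complex.exp ((θ : ℂ) * I)) *
      Complex.exp (-(n : ℂ) * (θ : ℂ) * I)‖ ≤ C * |2 * Real.pi - 0| := by
    refine intervalIntegral.norm_integral_le_of_norm_le_const fun θ _ => ?_
    have : (-(n : ℂ) * (θ : ℂ) * I) = ((-n * θ : ℝ) : ℂ) * I := by push_cast; ring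
    rw [norm_mul, this, Complex.norm_exp_ofReal_mul_I, mul_one]
    exact h _ (exp_mem_sphere θ)
  rw [sub_zero, abs_of_pos (by positivity)] at e2
  rw [fcoeff, norm_mul]
  have e3 : ‖(1 / (2 * Real.pi) : ℂ)‖ = 1 / (2 * Real.pi) := by
    simp [abs_of_pos Real.pi_pos]
  rw [e3]
  calc _ ≤ 1 / (2 * Real.pi) * (C * (2 * Real.pi)) := by gcongr
    _ = C := by have := Real.pi_ne_zero; field_simp

lemma contDiff_comp_exp_of_contDiffAt {f : ℂ → ℂ}
    (hf : ∀ z ∈ sphere (0 : ℂ) 1, ContDiffAt ℝ 2 f z) :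
    ContDiff ℝ 2 fun θ : ℝ => f (Complex.exp ((θ : ℂ) * I)) := by
  have h1 : ContDiff ℝ 2 fun θ : ℝ => Complex.exp ((θ : ℂ) * I) :=
    (Complex.ofRealCLM.contDiff.mul contDiff_const).cexp
  rw [contDiff_iff_contDiffAt]
  intro θ
  exact (hf _ (exp_mem_sphere θ)).comp θ h1.contDiffAt

lemma DifferentiableOn.contDiffAt_real {f : ℂ → ℂ} {s : Set ℂ} (hf : DifferentiableOn ℂ f s)
    (hs : IsOpen s) {z : ℂ} (hz : z ∈ s) : ContDiffAt ℝ 2 f z :=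
  ((hf.contDiffOn hs).contDiffAt (hs.mem_nhds hz)).restrict_scalars ℝ

/-- A smooth function supported near `1` whose Fourier coefficients of nonpositive index are
nearly those of the constant function `1`. -/
theorem exists_wienerRep_peak {η ε : ℝ} (hη : 0 < η) (hε : 0 < ε) :
    ∃ (p : ℂ → ℂ) (b : ℤ → ℂ), IsWienerRep p b ∧
      (∀ w ∈ sphere (0 : ℂ) 1, η < ‖w - 1‖ → p w = 0) ∧
      ∀ j ≤ 0, ‖b j - (if j = 0 then 1 else 0)‖ ≤ ε := by
  set δ : ℝ := η ^ 2 / 16 with hδdef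
  have hδ : 0 < δ := by positivity
  set κ : ℝ := δ / (2 + δ) ^ 2 with hκdef
  have hκ : 0 < κ := by positivity
  obtain ⟨M, hM⟩ : ∃ M : ℕ, Real.exp (-κ) ^ M ≤ ε := by
    have := tendsto_pow_atTop_nhds_zero_of_lt_one (Real.exp_pos (-κ)).le
      (by rw [Real.exp_lt_one_iff]; linarith)
    exact ((this.eventually (gt_mem_nhds hε)).exists).imp fun _ h => h.le
  set c : ℂ → ℂ := fun w => w / ((1 + δ : ℝ) - w) with hcdef
  have hne : ∀ w ∈ ball (0 : ℂ) (1 + δ), ((1 + δ : ℝ) : ℂ) - w ≠ 0 := by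
    intro w hw h
    rw [sub_eq_zero] at h
    rw [← h] at hw
    simp [abs_of_pos (by positivity : 0 < 1 + δ), -ofReal_add] at hw
  set q : ℂ → ℂ := fun w => Complex.exp (M * c w) with hqdef
  have hqd : DifferentiableOn ℂ q (ball 0 (1 + δ)) := by
    have : DifferentiableOn ℂ c (ball 0 (1 + δ)) :=
      differentiableOn_id.div ((differentiableOn_const _).sub differentiableOn_id) hne
    exact (this.const_mul _).cexp
  have hsub : sphere (0 : ℂ) 1 ⊆ ball 0 (1 + δ) := fun z hz => by
    have : ‖z‖ = 1 := by simpa using hz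
    simp [this, hδ]
  obtain ⟨a, ha, haq⟩ := mem_APlus_of_differentiableOn (by linarith) hqd
  have ha0 : a 0 = 1 := by
    have h1 := haq 0 (by simp)
    have h2 := hasSum_single (f := fun n => a n * (0 : ℂ) ^ n) 0 fun n hn => by simp [hn]
    have h3 := h1.unique h2
    simpa [hqdef, hcdef] using h3.symm
  have hqrep := isWienerRep_extendInt ha haq
  let ψ : ContDiffBump (1 : ℂ) := ⟨η / 2, η, by positivity, by linarith⟩
  set p : ℂ → ℂ := fun w => (ψ w : ℂ) * q w with hpdef
  have hprep : IsWienerRep p (fcoeff p) := by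
    refine isWienerRep_fcoeff (mem_wienerAlg_of_contDiff (contDiff_comp_exp_of_contDiffAt ?_))
    intro z hz
    have h1 : ContDiffAt ℝ 2 (fun w => (ψ w : ℂ)) z :=
      (Complex.ofRealCLM.contDiff.comp ψ.contDiff).contDiffAt
    exact h1.mul (hqd.contDiffAt_real isOpen_ball (hsub hz))
  refine ⟨p, fcoeff p, hprep, fun w hw hηw => ?_, fun j hj => ?_⟩
  · have : ψ w = 0 := ψ.zero_of_le_dist (by rw [dist_eq_norm]; exact hηw.le)
    simp [hpdef, this]
  · have hdiff := hprep.add (hqrep.const_mul (-1))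
    have hj2 : extendInt a j = if j = 0 then 1 else 0 := by
      split_ifs with h
      · subst h; simpa [ha0] using extendInt_natCast a 0
      · exact extendInt_of_neg a (lt_of_le_of_ne hj h)
    have h4 := hdiff.fcoeff_eq j
    simp only [Pi.add_apply, hj2] at h4
    have h5 : fcoeff p j - (if j = 0 then 1 else 0) =
        fcoeff (p + fun z => -1 * q z) j := by rw [h4]; ring
    rw [h5]
    refine norm_fcoeff_le (fun z hz => ?_) j
    have hz1 : ‖z‖ = 1 := by simpa using hz
    have h6 : (p + fun z => -1 * q z) z = ((ψ z - 1 : ℝ) : ℂ) * q z := by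
      simp [hpdef]; ring
    rw [h6, norm_mul, Complex.norm_real, Real.norm_eq_abs]
    by_cases hzη : ‖z - 1‖ ≤ η / 2
    · have : ψ z = 1 := ψ.one_of_mem_closedBall (by simpa [dist_eq_norm] using hzη)
      simp [this, hε.le]
    · push Not at hzη
      have hψ : |ψ z - 1| ≤ 1 := by
        rw [abs_le]; constructor <;> linarith [ψ.nonneg (x := z), ψ.le_one (x := z)]
      have hre : (c z).re ≤ -κ := by
        have hx : z.re * z.re + z.im * z.im = 1 := by
          rw [← Complex.normSq_apply, Complex.normSq_eq_norm_sq, hz1]; norm_num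
        have hx2 : z.re ≤ 1 - 2 * δ := by
          have h7 : ‖z - 1‖ ^ 2 = (z.re - 1) ^ 2 + z.im ^ 2 := by
            rw [← Complex.normSq_eq_norm_sq, Complex.normSq_apply]; simp; ring
          have h8 : (η / 2) ^ 2 ≤ ‖z - 1‖ ^ 2 := by gcongr
          rw [hδdef]; nlinarith
        have hx1 : -1 ≤ z.re := by nlinarith [sq_nonneg z.im]
        have hD : (c z).re = ((1 + δ) * z.re - 1) / ((1 + δ) ^ 2 - 2 * (1 + δ) * z.re + 1) := by
          rw [hcdef]
          simp only [Complex.div_re, Complex.normSq_apply]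
          simp
          rw [← add_div]
          congr 1 <;> nlinarith
        have hD1 : 0 < (1 + δ) ^ 2 - 2 * (1 + δ) * z.re + 1 := by nlinarith
        have hD2 : (1 + δ) ^ 2 - 2 * (1 + δ) * z.re + 1 ≤ (2 + δ) ^ 2 := by nlinarith
        rw [hD, div_le_iff₀ hD1, hκdef]
        have : δ / (2 + δ) ^ 2 * ((1 + δ) ^ 2 - 2 * (1 + δ) * z.re + 1) ≤ δ := by
          rw [div_mul_eq_mul_div, div_le_iff₀ (by positivity)]
          gcongr
        nlinarith
      have hq : ‖q z‖ ≤ ε := by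
        rw [hqdef, Complex.norm_exp]
        refine le_trans ?_ hM
        rw [← Real.exp_nat_mul]
        gcongr
        simp
        have : (0 : ℝ) ≤ M := by positivity
        nlinarith
      calc |ψ z - 1| * ‖q z‖ ≤ 1 * ε := by gcongr
        _ = ε := one_mul _

lemma IsWienerRep.continuousOn {f : ℂ → ℂ} {a : ℤ → ℂ} (h : IsWienerRep f a) :
    ContinuousOn f (sphere (0 : ℂ) 1) := by
  have : ContinuousOn (fun z => ∑' n : ℤ, a n * z ^ n) (sphere (0 : ℂ) 1) := by
    refine continuousOn_tsum (fun n => ?_) h.1 fun n z hz => ?_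
    · exact continuousOn_const.mul (continuousOn_id.zpow₀ n fun z hz =>
        Or.inl (ne_zero_of_mem_sphere_one hz))
    · have : ‖z‖ = 1 := by simpa using hz
      simp [this]
  exact this.congr fun z hz => (h.2 z hz).tsum_eq.symm

/-- The Fourier coefficients of the image under `cantorCircle` of the measure with density `g`. -/
def cantorCoeff (g : C(CantorGroup, ℂ)) (n : ℤ) : ℂ :=
  ∫ ω, g ω * (cantorCircle ω : ℂ) ^ n ∂cantorHaar

lemma continuous_coe_zpow (u : C(CantorGroup, Circle)) (n : ℤ) :
    Continuous fun ω => (u ω : ℂ) ^ n :=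
  Continuous.zpow₀ (by fun_prop) n fun ω => Or.inl (Circle.coe_ne_zero _)

lemma norm_coe_zpow (u : C(CantorGroup, Circle)) (n : ℤ) (ω : CantorGroup) :
    ‖(u ω : ℂ) ^ n‖ = 1 := by
  rw [norm_zpow, Circle.norm_coe, one_zpow]

lemma coe_pow_mul_inv_mem_sphere (v u : C(CantorGroup, Circle)) (N : ℕ) (ω : CantorGroup) :
    (v ω : ℂ) ^ N * (u ω : ℂ)⁻¹ ∈ sphere (0 : ℂ) 1 := by
  rw [mem_sphere_zero_iff_norm, norm_mul, norm_inv, norm_pow, Circle.norm_coe, Circle.norm_coe]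
  simp

lemma tsum_norm_compl_lt {β : ℤ → ℂ} (hβ : Summable fun j => ‖β j‖) {ε : ℝ} (hε : 0 < ε) :
    ∃ s : Finset ℤ, (Summable fun j => if j ∈ s then 0 else ‖β j‖) ∧
      ∑' j, (if j ∈ s then 0 else ‖β j‖) < ε := by
  have h0 : Tendsto (fun s : Finset ℤ => ∑ j ∈ s, ‖β j‖) atTop (nhds (∑' j, ‖β j‖)) := hβ.hasSum
  obtain ⟨s, hs⟩ := (h0.eventually (Metric.ball_mem_nhds _ hε)).exists
  refine ⟨s, ?_⟩
  have h1 : HasSum (fun j => if j ∈ s then ‖β j‖ else 0) (∑ j ∈ s, ‖β j‖) := by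
    have : HasSum (fun j => if j ∈ s then ‖β j‖ else 0)
        (∑ j ∈ s, if j ∈ s then ‖β j‖ else 0) :=
      hasSum_sum_of_ne_finset_zero fun j hj => by simp [hj]
    convert this using 1
    exact Finset.sum_congr rfl fun j hj => by simp [hj]
  have h2 := hβ.hasSum.sub h1
  have h3 : (fun j => ‖β j‖ - if j ∈ s then ‖β j‖ else 0) =
      fun j => if j ∈ s then 0 else ‖β j‖ := by
    ext j; split_ifs <;> simp
  rw [h3] at h2
  refine ⟨h2.summable, ?_⟩
  rw [h2.tsum_eq]
  have := abs_lt.mp (mem_ball_iff_norm.mp hs)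
  linarith [this.1]

lemma hasSum_integral_peak {p : ℂ → ℂ} {b : ℤ → ℂ} (hp : IsWienerRep p b)
    (g : C(CantorGroup, ℂ)) (u : C(CantorGroup, Circle)) (N : ℕ) (n : ℤ) :
    HasSum (fun j : ℤ => b j * ∫ ω, (g ω * (u ω : ℂ) ^ (-j)) *
        (cantorCircle ω : ℂ) ^ (j * N + n) ∂cantorHaar)
      (∫ ω, g ω * p ((cantorCircle ω : ℂ) ^ N * (u ω : ℂ)⁻¹) * (cantorCircle ω : ℂ) ^ n
        ∂cantorHaar) := by
  obtain ⟨C, hC⟩ := (isCompact_range g.continuous).isBounded.exists_norm_le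
  have hC' : ∀ ω, ‖g ω‖ ≤ C := fun ω => hC _ ⟨ω, rfl⟩
  have hz : ∀ (ω) (n : ℤ), ‖(cantorCircle ω : ℂ) ^ n‖ = 1 := fun ω n => norm_coe_zpow _ n ω
  have hu : ∀ (ω) (n : ℤ), ‖(u ω : ℂ) ^ n‖ = 1 := fun ω n => norm_coe_zpow u n ω
  have hcont : ∀ j : ℤ, Continuous fun ω => b j * ((g ω * (u ω : ℂ) ^ (-j)) *
        (cantorCircle ω : ℂ) ^ (j * N + n)) := fun j =>
    continuous_const.mul ((g.continuous.mul (continuous_coe_zpow u _)).mul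
      (continuous_coe_zpow _ _))
  have hbd : ∀ (j : ℤ) (ω), ‖b j * ((g ω * (u ω : ℂ) ^ (-j)) *
        (cantorCircle ω : ℂ) ^ (j * N + n))‖ ≤ ‖b j‖ * C := fun j ω => by
    rw [norm_mul, norm_mul, norm_mul, hz, hu, mul_one, mul_one]
    gcongr
    exact hC' ω
  have key := hasSum_integral_of_dominated_convergence (μ := cantorHaar)
    (F := fun (j : ℤ) ω => b j * ((g ω * (u ω : ℂ) ^ (-j)) * (cantorCircle ω : ℂ) ^ (j * N + n)))
    (f := fun ω => g ω * p ((cantorCircle ω : ℂ) ^ N * (u ω : ℂ)⁻¹) * (cantorCircle ω : ℂ) ^ n)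
    (fun j _ => ‖b j‖ * C) (fun j => (hcont j).aestronglyMeasurable)
    (fun j => ae_of_all _ (hbd j)) (ae_of_all _ fun _ => hp.1.mul_right C)
    (integrable_const _)
    (ae_of_all _ fun ω => by
      have h1 := hp.2 ((cantorCircle ω : ℂ) ^ N * (u ω : ℂ)⁻¹) (coe_pow_mul_inv_mem_sphere _ u N ω)
      have h2 := (h1.mul_left (g ω)).mul_right ((cantorCircle ω : ℂ) ^ n)
      refine (congrArg (HasSum · _) (funext fun j => ?_)).mpr h2
      have hne : (cantorCircle ω : ℂ) ≠ 0 := Circle.coe_ne_zero _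
      rw [zpow_add₀ hne, mul_zpow, inv_zpow', mul_comm j, zpow_mul, zpow_natCast]
      ring)
  simpa only [integral_const_mul] using key

lemma exists_step_bound (g : C(CantorGroup, ℂ)) (u : C(CantorGroup, Circle)) {p : ℂ → ℂ}
    {b : ℤ → ℂ} (hp : IsWienerRep p b) {ε C ε' : ℝ} (hε : 0 ≤ ε)
    (hb : ∀ j ≤ 0, ‖b j - (if j = 0 then 1 else 0)‖ ≤ ε) (hC : ∀ ω, ‖g ω‖ ≤ C) (hε' : 0 < ε') :
    ∃ N₀ : ℕ, ∀ N : ℕ, N₀ ≤ N → ∀ n : ℤ, 0 ≤ n →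
      ‖(∫ ω, g ω * p ((cantorCircle ω : ℂ) ^ N * (u ω : ℂ)⁻¹) *
        (cantorCircle ω : ℂ) ^ n ∂cantorHaar) - cantorCoeff g n‖ ≤ ε * C + ε' := by
  have hC0 : 0 ≤ C := (norm_nonneg _).trans (hC 0)
  set β : ℤ → ℂ := fun j => b j + (Pi.single 0 (-1) : ℤ → ℂ) j with hβdef
  have hrep : IsWienerRep (p + fun z => -1 * z ^ (0 : ℤ)) β := hp.add (isWienerRep_single 0 (-1))
  have hβ : ∀ j ≤ 0, ‖β j‖ ≤ ε := fun j hj => by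
    have := hb j hj
    simp only [hβdef, Pi.single_apply]
    convert this using 2
    split_ifs <;> ring
  set S := ∑' j, ‖β j‖ with hS
  have hS0 : 0 ≤ S := tsum_nonneg fun _ => norm_nonneg _
  obtain ⟨τ, hτ, hτS⟩ : ∃ τ : ℝ, 0 < τ ∧ τ * S ≤ ε' / 2 := by
    refine ⟨ε' / 2 / (S + 1), by positivity, ?_⟩
    rw [div_mul_eq_mul_div, div_le_iff₀ (by positivity)]
    nlinarith
  obtain ⟨s, hs1, hs2⟩ := tsum_norm_compl_lt hrep.1 (ε := ε' / 2 / (C + 1)) (by positivity)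
  have hraj : ∀ j : ℤ, ∃ M : ℕ, ∀ m : ℤ, (M : ℤ) ≤ |m| →
      ‖∫ ω, (g ω * (u ω : ℂ) ^ (-j)) * (cantorCircle ω : ℂ) ^ m ∂cantorHaar‖ < τ := fun j =>
    exists_norm_integral_zpow_lt (g.continuous.mul (continuous_coe_zpow u _)) hτ
  choose M hM using hraj
  set K := s.sup M + 1 with hK
  refine ⟨2 * K, fun N hN n hn => ?_⟩
  have hN' : 2 * (K : ℤ) ≤ N := by exact_mod_cast hN
  have hsum := hasSum_integral_peak hrep g u N n
  have heq : (∫ ω, g ω * p ((cantorCircle ω : ℂ) ^ N * (u ω : ℂ)⁻¹) *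
        (cantorCircle ω : ℂ) ^ n ∂cantorHaar) - cantorCoeff g n =
      ∫ ω, g ω * (p + fun z : ℂ => -1 * z ^ (0 : ℤ)) ((cantorCircle ω : ℂ) ^ N * (u ω : ℂ)⁻¹) *
        (cantorCircle ω : ℂ) ^ n ∂cantorHaar := by
    have hpc : Continuous fun ω => p ((cantorCircle ω : ℂ) ^ N * (u ω : ℂ)⁻¹) := by
      refine hp.continuousOn.comp_continuous ?_ fun ω => coe_pow_mul_inv_mem_sphere _ u N ω
      have h1 := continuous_coe_zpow cantorCircle N
      have h2 := continuous_coe_zpow u (-1)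
      simp only [zpow_natCast, zpow_neg_one] at h1 h2
      exact h1.mul h2
    have hzc := continuous_coe_zpow cantorCircle n
    rw [cantorCoeff, ← integral_sub]
    · congr 1; ext ω; simp; ring
    · exact Continuous.integrable_cantorHaar ((g.continuous.mul hpc).mul hzc)
    · exact Continuous.integrable_cantorHaar (g.continuous.mul hzc)
  rw [heq, ← hsum.tsum_eq]
  obtain ⟨j₀, hj₀⟩ : ∃ j₀ : ℤ, ∀ j : ℤ, |j * N + n| < K → j = j₀ := by
    by_cases h : ∃ j₀ : ℤ, |j₀ * N + n| < K
    · obtain ⟨j₀, h0⟩ := h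
      refine ⟨j₀, fun j hj => ?_⟩
      by_contra hne
      have h1 : |(j - j₀) * N| < 2 * K := by
        have : (j - j₀) * N = (j * N + n) - (j₀ * N + n) := by ring
        rw [this]
        exact (abs_sub _ _).trans_lt (by linarith)
      rw [abs_mul] at h1
      have h2 : 1 ≤ |j - j₀| := Int.one_le_abs (sub_ne_zero.mpr hne)
      have h3 : |(N : ℤ)| = N := abs_of_nonneg (by positivity)
      rw [h3] at h1
      nlinarith
    · exact ⟨0, fun j hj => (h ⟨j, hj⟩).elim⟩
  have hbd : ∀ j : ℤ, ‖∫ ω, (g ω * (u ω : ℂ) ^ (-j)) *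
        (cantorCircle ω : ℂ) ^ (j * N + n) ∂cantorHaar‖ ≤ C := fun j => by
    have := norm_integral_le_of_norm_le_const (μ := cantorHaar)
      (f := fun ω => (g ω * (u ω : ℂ) ^ (-j)) * (cantorCircle ω : ℂ) ^ (j * N + n)) (C := C)
      (ae_of_all _ fun ω => by
        rw [norm_mul, norm_mul, norm_coe_zpow, norm_coe_zpow, mul_one, mul_one]; exact hC ω)
    simpa using this
  set B : ℤ → ℝ := fun j => τ * ‖β j‖ + C * (if j ∈ s then 0 else ‖β j‖) +
    (if j = j₀ then ε * C else 0) with hB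
  have hBs : HasSum B (τ * S + C * ∑' j, (if j ∈ s then 0 else ‖β j‖) + ε * C) :=
    ((hrep.1.hasSum.mul_left τ).add (hs1.hasSum.mul_left C)).add (hasSum_ite_eq j₀ (ε * C))
  have hle : ∀ j : ℤ, ‖β j * ∫ ω, (g ω * (u ω : ℂ) ^ (-j)) *
        (cantorCircle ω : ℂ) ^ (j * N + n) ∂cantorHaar‖ ≤ B j := fun j => by
    rw [norm_mul]
    have t1 : 0 ≤ τ * ‖β j‖ := by positivity
    have t2 : 0 ≤ C * (if j ∈ s then 0 else ‖β j‖) := by split_ifs <;> positivity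
    have t3 : 0 ≤ (if j = j₀ then ε * C else 0) := by split_ifs <;> positivity
    by_cases hjs : j ∈ s
    · by_cases hjK : |j * N + n| < K
      · have hj0 : j ≤ 0 := by
          by_contra! hpos
          have := (abs_lt.mp hjK).2
          nlinarith
        have h1 := hj₀ j hjK
        have h2 := mul_le_mul (hβ j hj0) (hbd j) (norm_nonneg _) hε
        simp only [hB]
        rw [if_pos h1]
        linarith
      · push Not at hjK
        have h1 : (M j : ℤ) ≤ |j * N + n| := by
          have : M j ≤ s.sup M := Finset.le_sup hjs
          have : (M j : ℤ) ≤ K := by exact_mod_cast this.trans (Nat.le_succ _)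
          linarith
        have h2 := mul_le_mul_of_nonneg_left (hM j _ h1).le (norm_nonneg (β j))
        simp only [hB]
        linarith
    · have h2 := mul_le_mul_of_nonneg_left (hbd j) (norm_nonneg (β j))
      simp only [hB, if_neg hjs] at t3 ⊢
      linarith
  refine (tsum_of_norm_bounded hBs hle).trans ?_
  have h3 : C * ∑' j, (if j ∈ s then 0 else ‖β j‖) ≤ ε' / 2 := by
    have h4 : C * ∑' j, (if j ∈ s then 0 else ‖β j‖) ≤ C * (ε' / 2 / (C + 1)) := by gcongr
    refine h4.trans ?_
    rw [mul_div_assoc', div_le_iff₀ (by positivity)]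
    nlinarith
  linarith

lemma norm_mul_inv_sub_one (z u : Circle) (N : ℕ) :
    ‖(z : ℂ) ^ N * (u : ℂ)⁻¹ - 1‖ = ‖(z : ℂ) ^ N - u‖ := by
  have hu : (u : ℂ) ≠ 0 := Circle.coe_ne_zero u
  have : (z : ℂ) ^ N - u = ((z : ℂ) ^ N * (u : ℂ)⁻¹ - 1) * u := by field_simp
  rw [this, norm_mul, Circle.norm_coe, mul_one]

lemma exists_density_step (g : C(CantorGroup, ℂ)) (u : C(CantorGroup, Circle)) {η : ℝ}
    (hη : 0 < η) {ε : ℝ} (hε : 0 < ε) (k : ℕ) :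
    ∃ (N : ℕ) (g' : C(CantorGroup, ℂ)), k ≤ N ∧ 0 < N ∧
      (∀ ω, η < ‖(cantorCircle ω : ℂ) ^ N - u ω‖ → g' ω = 0) ∧
      (∀ ω, g ω = 0 → g' ω = 0) ∧
      ∀ n : ℤ, 0 ≤ n → ‖cantorCoeff g' n - cantorCoeff g n‖ ≤ ε := by
  obtain ⟨C, hC⟩ := (isCompact_range g.continuous).isBounded.exists_norm_le
  have hC' : ∀ ω, ‖g ω‖ ≤ C := fun ω => hC _ ⟨ω, rfl⟩
  have hC0 : 0 ≤ C := (norm_nonneg _).trans (hC' 0)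
  obtain ⟨p, b, hp, hp0, hb⟩ := exists_wienerRep_peak hη
    (show 0 < ε / 2 / (C + 1) by positivity)
  obtain ⟨N₀, hN₀⟩ := exists_step_bound g u hp (by positivity) hb hC' (half_pos hε)
  set N := N₀ + k + 1 with hN
  have hpc : Continuous fun ω => p ((cantorCircle ω : ℂ) ^ N * (u ω : ℂ)⁻¹) := by
    refine hp.continuousOn.comp_continuous ?_ fun ω => coe_pow_mul_inv_mem_sphere _ u N ω
    have h1 := continuous_coe_zpow cantorCircle N
    have h2 := continuous_coe_zpow u (-1)
    simp only [zpow_natCast, zpow_neg_one] at h1 h2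
    exact h1.mul h2
  refine ⟨N, ⟨fun ω => g ω * p ((cantorCircle ω : ℂ) ^ N * (u ω : ℂ)⁻¹), g.continuous.mul hpc⟩,
    by omega, by omega, fun ω hω => ?_, fun ω hω => by simp [hω], fun n hn => ?_⟩
  · have := hp0 ((cantorCircle ω : ℂ) ^ N * (u ω : ℂ)⁻¹)
      (coe_pow_mul_inv_mem_sphere _ u N ω) (by rw [norm_mul_inv_sub_one]; exact hω)
    simp [this]
  · refine (hN₀ N (by omega) n hn).trans ?_
    have : ε / 2 / (C + 1) * C ≤ ε / 2 := by
      rw [div_mul_eq_mul_div, div_le_iff₀ (by positivity)]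
      nlinarith
    linarith

/-- Densities concentrating on a prescribed intersection of sets of simultaneous approximation,
whose Fourier coefficients of nonnegative index converge to a nontrivial null sequence. -/
theorem exists_pseudo_density (u : ℕ → C(CantorGroup, Circle)) (η : ℕ → ℝ) (hη : ∀ k, 0 < η k) :
    ∃ (N : ℕ → ℕ) (g : ℕ → C(CantorGroup, ℂ)) (φ : ℕ → ℂ),
      (∀ k, k ≤ N k ∧ 0 < N k) ∧
      (∀ i j ω, i < j → η i < ‖(cantorCircle ω : ℂ) ^ N i - u i ω‖ → g j ω = 0) ∧
      (∀ n : ℕ, Tendsto (fun j => cantorCoeff (g j) n) atTop (nhds (φ n))) ∧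
      (∀ (j : ℕ) (n : ℕ), ‖cantorCoeff (g j) n‖ ≤ 2) ∧
      Tendsto φ atTop (nhds 0) ∧ 1 / 2 ≤ ‖φ 0‖ := by
  have hstep := fun (k : ℕ) (g : C(CantorGroup, ℂ)) =>
    exists_density_step g (u k) (hη k) (show (0 : ℝ) < 1 / 4 * (1 / 2) ^ k by positivity) k
  choose N g' h1 h2 h3 h4 h5 using hstep
  let g : ℕ → C(CantorGroup, ℂ) := fun k => Nat.rec 1 (fun k gk => g' k gk) k
  have hg0 : g 0 = 1 := rfl
  have hgs : ∀ k, g (k + 1) = g' k (g k) := fun k => rfl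
  have hgeo : ∀ n : ℕ, ∀ j : ℕ, dist (cantorCoeff (g j) n) (cantorCoeff (g (j + 1)) n)
      ≤ 1 / 4 * (1 / 2) ^ j := fun n j => by
    rw [dist_comm, dist_eq_norm, hgs]
    exact h5 j (g j) n (by positivity)
  have hlim : ∀ n : ℕ, ∃ a, Tendsto (fun j => cantorCoeff (g j) n) atTop (nhds a) := fun n =>
    cauchySeq_tendsto_of_complete (cauchySeq_of_le_geometric _ _ (by norm_num) (hgeo n))
  choose φ hφ using hlim
  have hdist : ∀ n j : ℕ, dist (cantorCoeff (g j) n) (φ n) ≤ (1 / 2) ^ (j + 1) := fun n j => by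
    have := dist_le_of_le_geometric_of_tendsto _ _ (by norm_num) (hgeo n) (hφ n) j
    refine this.trans_eq ?_
    rw [pow_succ]; ring
  have hone : cantorCoeff 1 ((0 : ℕ) : ℤ) = 1 := by simp [cantorCoeff]
  have hone' : ∀ n : ℕ, ‖cantorCoeff 1 (n : ℤ)‖ ≤ 1 := fun n => by
    have := norm_integral_le_of_norm_le_const (μ := cantorHaar)
      (f := fun ω => (1 : C(CantorGroup, ℂ)) ω * (cantorCircle ω : ℂ) ^ (n : ℤ)) (C := 1)
      (ae_of_all _ fun ω => by rw [norm_mul, norm_coe_zpow]; simp)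
    simpa [cantorCoeff] using this
  refine ⟨fun k => N k (g k), g, φ, fun k => ⟨h1 k _, h2 k _⟩, ?_, hφ, ?_, ?_, ?_⟩
  · intro i j ω hij hω
    induction j, hij using Nat.le_induction with
    | base => rw [hgs]; exact h3 i (g i) ω hω
    | succ j _ ih => rw [hgs]; exact h4 j (g j) ω ih
  · intro j n
    have e1 := hdist n j
    have e2 := hdist n 0
    have e3 : dist (cantorCoeff (g j) n) (cantorCoeff (g 0) n) ≤ 1 := by
      refine (dist_triangle_right _ _ (φ n)).trans ?_
      have : (1 / 2 : ℝ) ^ (j + 1) ≤ (1 / 2) ^ 1 :=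
        pow_le_pow_of_le_one (by norm_num) (by norm_num) (by omega)
      linarith
    rw [dist_eq_norm, hg0] at e3
    have e4 := norm_le_norm_add_norm_sub' (cantorCoeff (g j) n) (cantorCoeff 1 n)
    linarith [hone' n]
  · rw [Metric.tendsto_atTop]
    intro ε hε
    obtain ⟨k, hk⟩ := exists_pow_lt_of_lt_one (half_pos hε) (show (1 / 2 : ℝ) < 1 by norm_num)
    obtain ⟨M, hM⟩ := exists_norm_integral_zpow_lt (g k).continuous (half_pos hε)
    refine ⟨M, fun n hn => ?_⟩
    have e1 := hM n (by rw [abs_of_nonneg (by positivity)]; exact_mod_cast hn)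
    have e2 := hdist n k
    have e3 : (1 / 2 : ℝ) ^ (k + 1) ≤ (1 / 2) ^ k :=
      pow_le_pow_of_le_one (by norm_num) (by norm_num) (by omega)
    rw [dist_zero_right]
    rw [dist_comm, dist_eq_norm] at e2
    have e4 := norm_le_norm_add_norm_sub' (φ n) (cantorCoeff (g k) n)
    change ‖cantorCoeff (g k) n‖ < ε / 2 at e1
    linarith
  · have e2 := hdist 0 0
    rw [hg0, hone, dist_comm, dist_eq_norm] at e2
    have e4 := norm_sub_norm_le (1 : ℂ) (φ 0)
    rw [norm_sub_rev, norm_one] at e4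
    norm_num at e2 ⊢
    linarith

/-- The set on which the first `k` simultaneous approximations `cantorCircle ^ N i ≈ u i` hold. -/
def approxSet (N : ℕ → ℕ) (u : ℕ → C(CantorGroup, Circle)) (η : ℕ → ℝ) (k : ℕ) :
    Set CantorGroup :=
  {ω | ∀ i < k, ‖(cantorCircle ω : ℂ) ^ N i - u i ω‖ ≤ η i}

lemma isClosed_approxSet (N : ℕ → ℕ) (u : ℕ → C(CantorGroup, Circle)) (η : ℕ → ℝ) (k : ℕ) :
    IsClosed (approxSet N u η k) := by
  simp only [approxSet, ofPred_forall]
  refine isClosed_iInter fun i => isClosed_iInter fun _ => isClosed_le ?_ continuous_const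
  have h1 := continuous_coe_zpow cantorCircle (N i)
  simp only [zpow_natCast] at h1
  exact (h1.sub (by fun_prop)).norm

lemma approxSet_anti (N : ℕ → ℕ) (u : ℕ → C(CantorGroup, Circle)) (η : ℕ → ℝ) :
    Antitone (approxSet N u η) := fun _ _ h _ hω i hi => hω i (hi.trans_le h)

/-- The embedding of the Cantor group in the unit circle, with values in `ℂ`. -/
def cantorPoint (ω : CantorGroup) : ℂ := cantorCircle ω

lemma continuous_cantorPoint : Continuous cantorPoint  := by
  have := continuous_coe_zpow cantorCircle 1
  simp only [zpow_one] at this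
  exact this

lemma norm_cantorPoint (ω : CantorGroup) : ‖cantorPoint ω‖ = 1 := Circle.norm_coe _

/-- A sequence of maps `CantorGroup → Circle` in which every term of a dense sequence occurs
infinitely often. -/
def recurrentDenseSeq (k : ℕ) : C(CantorGroup, Circle) :=
  TopologicalSpace.denseSeq C(CantorGroup, Circle) k.unpair.1

lemma exists_recurrentDenseSeq_near (F : C(CantorGroup, Circle)) {ε : ℝ} (hε : 0 < ε) (M : ℕ) :
    ∃ k, M ≤ k ∧ 1 / ((k : ℝ) + 1) < ε ∧ ∀ ω, ‖(F ω : ℂ) - recurrentDenseSeq k ω‖ < ε := by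
  obtain ⟨i, hi⟩ :=
    (TopologicalSpace.denseRange_denseSeq C(CantorGroup, Circle)).exists_dist_lt F hε
  obtain ⟨l, hl⟩ := exists_nat_one_div_lt hε
  have hle : max l M ≤ Nat.pair i (max l M) := Nat.right_le_pair _ _
  refine ⟨Nat.pair i (max l M), (le_max_right _ _).trans hle, lt_of_le_of_lt ?_ hl, fun ω => ?_⟩
  · have : (l : ℝ) ≤ (Nat.pair i (max l M) : ℕ) := by exact_mod_cast (le_max_left _ _).trans hle
    gcongr
  · have h1 := (ContinuousMap.dist_apply_le_dist (f := F)
      (g := TopologicalSpace.denseSeq C(CantorGroup, Circle) i) ω).trans_lt hi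
    change dist (F ω : ℂ) _ < ε at h1
    rw [dist_eq_norm] at h1
    simpa [recurrentDenseSeq] using h1

lemma isKronecker_image_iInter_approxSet (N : ℕ → ℕ) :
    IsKronecker (cantorPoint ''
      ⋂ k, approxSet N recurrentDenseSeq (fun k => 1 / ((k : ℝ) + 1)) k) := by
  set K := ⋂ k, approxSet N recurrentDenseSeq (fun k => 1 / ((k : ℝ) + 1)) k with hK
  have hKc : IsClosed K := isClosed_iInter fun k => isClosed_approxSet _ _ _ k
  refine ⟨hKc.isCompact.image continuous_cantorPoint, ?_, fun f hf hf1 ε hε => ?_⟩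
  · rintro _ ⟨ω, -, rfl⟩
    simpa using norm_cantorPoint ω
  rcases K.eq_empty_or_nonempty with hne | hne
  · exact ⟨0, by simp [hne]⟩
  obtain ⟨r, hr, hrange, hrc⟩ := PiNat.exists_retraction_of_isClosed hKc hne
  have hrK : ∀ ω, r ω ∈ K := fun ω => hrange ▸ mem_range_self ω
  have hfr : Continuous fun ω => f (cantorPoint (r ω)) :=
    hf.comp_continuous (continuous_cantorPoint.comp hrc) fun ω => ⟨_, hrK ω, rfl⟩
  let F : C(CantorGroup, Circle) :=
    ⟨fun ω => ⟨f (cantorPoint (r ω)),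
      mem_sphere_zero_iff_norm.mpr (hf1 _ ⟨_, hrK ω, rfl⟩)⟩, hfr.subtype_mk _⟩
  obtain ⟨k, -, hk, hFk⟩ := exists_recurrentDenseSeq_near F (half_pos hε) 0
  refine ⟨N k, ?_⟩
  rintro _ ⟨ω, hω, rfl⟩
  have h1 := mem_iInter.mp hω (k + 1) k (Nat.lt_succ_self k)
  have h2 := hFk ω
  have h3 : (F ω : ℂ) = f (cantorPoint ω) := by
    change f (cantorPoint (r ω)) = _
    rw [hr ω hω]
  rw [h3] at h2
  have h4 := norm_sub_le_norm_sub_add_norm_sub (f (cantorPoint ω))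
    (recurrentDenseSeq k ω : ℂ) (cantorPoint ω ^ N k)
  rw [norm_sub_rev (recurrentDenseSeq k ω : ℂ)] at h4
  rw [zpow_natCast]
  change ‖cantorPoint ω ^ N k - _‖ ≤ _ at h1
  linarith

lemma norm_taylorCoeff_le_of_deriv_two {f : ℂ → ℂ} {B : ℝ}
    (hd : DifferentiableOn ℂ f (ball 0 1))
    (hB : ∀ z ∈ ball (0 : ℂ) 1, ‖deriv (deriv f) z‖ ≤ B) (n : ℕ) :
    ‖taylorCoeff f (n + 2)‖ ≤ B / ((n + 1 : ℝ) * (n + 2)) := by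
  have hd2 : DifferentiableOn ℂ (deriv (deriv f)) (ball 0 1) :=
    (hd.deriv isOpen_ball).deriv isOpen_ball
  have hr : ∀ r ∈ Ioo (0 : ℝ) 1,
      ‖iteratedDeriv n (deriv (deriv f)) 0‖ * r ^ n ≤ n.factorial * B := fun r hr => by
    have hsub : closedBall (0 : ℂ) r ⊆ ball 0 1 := closedBall_subset_ball hr.2
    have := Complex.norm_iteratedDeriv_le_of_forall_mem_sphere_norm_le (n := n) (C := B)
      (c := (0 : ℂ)) (f := deriv (deriv f)) hr.1
      (hd2.mono (closure_ball_subset_closedBall.trans hsub)).diffContOnCl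
      (fun z hz => hB z (hsub (sphere_subset_closedBall hz)))
    rwa [le_div_iff₀ (pow_pos hr.1 n)] at this
  have h1 : ‖iteratedDeriv n (deriv (deriv f)) 0‖ ≤ n.factorial * B := by
    have ht : Tendsto (fun r : ℝ => ‖iteratedDeriv n (deriv (deriv f)) 0‖ * r ^ n)
        (nhdsWithin 1 (Iio 1)) (nhds (‖iteratedDeriv n (deriv (deriv f)) 0‖ * 1 ^ n)) := by
      refine Tendsto.mono_left ?_ nhdsWithin_le_nhds
      exact (continuous_const.mul (continuous_id.pow n)).tendsto 1
    rw [one_pow, mul_one] at ht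
    refine le_of_tendsto ht ?_
    filter_upwards [Ioo_mem_nhdsLT (show (0 : ℝ) < 1 by norm_num)] with r h using hr r h
  rw [taylorCoeff, norm_div, iteratedDeriv_succ', iteratedDeriv_succ', Complex.norm_natCast,
    div_le_div_iff₀ (by positivity) (by positivity)]
  have h2 : ((n + 2).factorial : ℝ) = (n + 2) * (n + 1) * n.factorial := by
    rw [Nat.factorial_succ, Nat.factorial_succ]; push_cast; ring
  rw [h2]
  have h3 : (0 : ℝ) ≤ (n + 1) * (n + 2) := by positivity
  nlinarith [mul_le_mul_of_nonneg_right h1 h3]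

lemma mem_APlus_of_deriv_two_bounded {f : ℂ → ℂ} {B : ℝ}
    (hd : DifferentiableOn ℂ f (ball 0 1)) (hc : ContinuousOn f (closedBall 0 1))
    (hB : ∀ z ∈ ball (0 : ℂ) 1, ‖deriv (deriv f) z‖ ≤ B) : f ∈ APlus := by
  have hB0 : 0 ≤ B := (norm_nonneg _).trans (hB 0 (by simp))
  have hs : Summable fun n => ‖taylorCoeff f n‖ := by
    rw [← summable_nat_add_iff 2]
    have h2 : Summable fun n : ℕ => B * (1 / ((n + 1 : ℕ) : ℝ) ^ 2) :=
      ((summable_nat_add_iff 1).mpr (Real.summable_one_div_nat_pow.mpr one_lt_two)).mul_left B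
    refine Summable.of_nonneg_of_le (fun _ => norm_nonneg _) (fun n => ?_) h2
    refine (norm_taylorCoeff_le_of_deriv_two hd hB n).trans ?_
    rw [div_eq_mul_one_div]
    gcongr
    push_cast
    nlinarith
  have hball : ∀ z ∈ ball (0 : ℂ) 1, HasSum (fun n => taylorCoeff f n * z ^ n) (f z) :=
    fun z hz => by
      have := Complex.hasSum_taylorSeries_on_ball (r := 1) (by simpa using hd) (by simpa using hz)
      refine (congrArg (HasSum · _) (funext fun n => ?_)).mp this
      rw [taylorCoeff, sub_zero, smul_eq_mul, smul_eq_mul]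
      field_simp
  have hT : ContinuousOn (fun z => ∑' n : ℕ, taylorCoeff f n * z ^ n) (closedBall (0 : ℂ) 1) := by
    refine continuousOn_tsum (fun n => by fun_prop) hs fun n z hz => ?_
    have : ‖z‖ ≤ 1 := by simpa using hz
    rw [norm_mul, norm_pow]
    exact mul_le_of_le_one_right (norm_nonneg _) (pow_le_one₀ (norm_nonneg _) this)
  have heq : EqOn (fun z => ∑' n : ℕ, taylorCoeff f n * z ^ n) f (closedBall (0 : ℂ) 1) := by
    refine EqOn.of_subset_closure (s := ball (0 : ℂ) 1) (fun z hz => (hball z hz).tsum_eq) hT hc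
      ball_subset_closedBall ?_
    rw [closure_ball (0 : ℂ) one_ne_zero]
  refine ⟨taylorCoeff f, hs, fun z hz => ?_⟩
  have hz1 : ‖z‖ ≤ 1 := by simpa using hz
  have hsum : Summable fun n => taylorCoeff f n * z ^ n :=
    Summable.of_norm_bounded hs fun n => by
      rw [norm_mul, norm_pow]
      exact mul_le_of_le_one_right (norm_nonneg _) (pow_le_one₀ (norm_nonneg _) hz1)
  rw [← heq hz]
  exact hsum.hasSum

lemma re_mul_re_add_le {z p : ℂ} (hz : ‖z‖ ≤ 1) (hp : ‖p‖ = 1) :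
    z.re * p.re + z.im * p.im ≤ 1 := by
  have h1 : z.re ^ 2 + z.im ^ 2 ≤ 1 := by
    have := Complex.sq_norm z
    rw [Complex.normSq_apply] at this
    nlinarith [norm_nonneg z]
  have h2 : p.re ^ 2 + p.im ^ 2 = 1 := by
    have := Complex.sq_norm p
    rw [Complex.normSq_apply, hp] at this
    nlinarith
  nlinarith [sq_nonneg (z.re - p.re), sq_nonneg (z.im - p.im)]

lemma norm_sub_le_norm_sub_smul {z p : ℂ} (hz : ‖z‖ ≤ 1) (hp : ‖p‖ = 1) {t : ℝ} (ht : 1 ≤ t) :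
    ‖z - p‖ ≤ ‖z - t * p‖ := by
  have h2 : p.re ^ 2 + p.im ^ 2 = 1 := by
    have := Complex.sq_norm p
    rw [Complex.normSq_apply, hp] at this
    nlinarith
  refine le_of_sq_le_sq ?_ (norm_nonneg _)
  rw [Complex.sq_norm, Complex.sq_norm, Complex.normSq_apply, Complex.normSq_apply]
  simp
  have h3 := re_mul_re_add_le hz hp
  nlinarith [mul_nonneg (sub_nonneg.mpr ht) (sub_nonneg.mpr h3), sq_nonneg (t - 1)]

lemma re_div_smul_sub {z p : ℂ} (hp : ‖p‖ = 1) (t : ℝ) :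
    (p / (t * p - z)).re = (t - (z.re * p.re + z.im * p.im)) / ‖t * p - z‖ ^ 2 := by
  have h2 : p.re ^ 2 + p.im ^ 2 = 1 := by
    have := Complex.sq_norm p
    rw [Complex.normSq_apply, hp] at this
    nlinarith
  rw [Complex.div_re, Complex.sq_norm, ← add_div]
  congr 1
  simp
  linear_combination t * h2

lemma norm_cantorPoint_sub_le {ω ω' : CantorGroup} {j : ℕ} (h : ∀ i < j, ω i = ω' i) :
    ‖cantorPoint ω - cantorPoint ω'‖ ≤ 9 * (2 / 9) ^ j := by
  have h1 : ‖cantorPoint ω - cantorPoint ω'‖ ≤ |2 * Real.pi * (digitSum ω - digitSum ω')| := by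
    have e1 : ∀ ω, cantorPoint ω = Complex.exp (I * (2 * Real.pi * digitSum ω : ℝ)) := fun ω => by
      rw [mul_comm]; exact Circle.coe_exp _
    have e2 : cantorPoint ω - cantorPoint ω' = cantorPoint ω' *
        (Complex.exp (I * (2 * Real.pi * (digitSum ω - digitSum ω') : ℝ)) - 1) := by
      rw [e1, e1, mul_sub, ← Complex.exp_add, mul_one]
      congr 2
      push_cast
      ring
    rw [e2, norm_mul, norm_cantorPoint, one_mul]
    exact Real.norm_exp_I_mul_ofReal_sub_one_le
  refine h1.trans ?_
  have hs := summable_digit ω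
  have hs' := summable_digit ω'
  have h2 : |digitSum ω - digitSum ω'| ≤ (2 / 9) ^ j * (9 / 7) := by
    have e1 : digitSum ω - digitSum ω' = ∑' k, ((((ω (k + j)).val : ℝ) * (2 / 9 : ℝ) ^ (k + j))
        - ((ω' (k + j)).val : ℝ) * (2 / 9 : ℝ) ^ (k + j)) := by
      rw [digitSum, digitSum, ← hs.sum_add_tsum_nat_add j, ← hs'.sum_add_tsum_nat_add j,
        ((summable_nat_add_iff j).mpr hs).tsum_sub ((summable_nat_add_iff j).mpr hs')]
      rw [Finset.sum_congr rfl fun i hi => by rw [h i (Finset.mem_range.mp hi)]]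
      ring
    have hg : HasSum (fun k : ℕ => (2 / 9 : ℝ) ^ j * (2 / 9) ^ k) ((2 / 9) ^ j * (9 / 7)) := by
      have := hasSum_geometric_of_lt_one (r := (2 / 9 : ℝ)) (by norm_num) (by norm_num)
      norm_num at this
      exact this.mul_left _
    rw [e1, ← Real.norm_eq_abs]
    refine tsum_of_norm_bounded hg fun k => ?_
    rw [← sub_mul, norm_mul, norm_pow, pow_add, mul_comm ((2 / 9 : ℝ) ^ j)]
    rw [Real.norm_of_nonneg (show (0 : ℝ) ≤ 2 / 9 by norm_num)]
    refine mul_le_of_le_one_left (by positivity) ?_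
    rw [Real.norm_eq_abs, abs_le]
    have a1 := ZMod.val_two_le_one (ω (k + j))
    have a2 := ZMod.val_two_le_one (ω' (k + j))
    constructor <;> linarith [Nat.cast_nonneg (α := ℝ) (ω (k + j)).val,
      Nat.cast_nonneg (α := ℝ) (ω' (k + j)).val]
  rw [abs_mul, abs_of_pos Real.two_pi_pos]
  have h3 := Real.pi_lt_d2
  have h4 : (0 : ℝ) < (2 / 9) ^ j := by positivity
  calc 2 * Real.pi * |digitSum ω - digitSum ω'| ≤ 2 * 3.15 * ((2 / 9) ^ j * (9 / 7)) := by gcongr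
    _ ≤ 9 * (2 / 9) ^ j := by linarith

section PoleSum

variable {ι : Type*} {w t : ι → ℝ} {P : ι → ℂ} {R : Set ℂ}

/-- The sum of simple fractions with poles at the points `t i * P i`. -/
def poleSum (w t : ι → ℝ) (P : ι → ℂ) (z : ℂ) : ℂ := ∑' i, w i * (P i / (t i * P i - z))

lemma norm_pole_le (hw0 : ∀ i, 0 ≤ w i) (hP : ∀ i, ‖P i‖ = 1)
    (hR : ∀ i, (t i * P i : ℂ) ∈ R) {r : ℝ} (hr : 0 < r) {z : ℂ} (hz : r ≤ infDist z R) (i : ι) :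
    ‖(w i : ℂ) * (P i / (t i * P i - z))‖ ≤ w i * (1 / r) := by
  rw [norm_mul, Complex.norm_of_nonneg (hw0 i), norm_div, hP]
  have h1 : r ≤ ‖(t i * P i : ℂ) - z‖ := by
    rw [← dist_eq_norm, dist_comm]
    exact hz.trans (infDist_le_dist_of_mem (hR i))
  have := hw0 i
  gcongr

lemma norm_poleSum_le (hw : Summable w) (hw0 : ∀ i, 0 ≤ w i) (hP : ∀ i, ‖P i‖ = 1)
    (hR : ∀ i, (t i * P i : ℂ) ∈ R) {r : ℝ} (hr : 0 < r) {z : ℂ} (hz : r ≤ infDist z R) :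
    ‖poleSum w t P z‖ ≤ (∑' i, w i) / r := by
  rw [div_eq_mul_one_div]
  exact tsum_of_norm_bounded (hw.hasSum.mul_right _) (norm_pole_le hw0 hP hR hr hz)

lemma differentiableOn_poleSum (hw : Summable w) (hw0 : ∀ i, 0 ≤ w i) (hP : ∀ i, ‖P i‖ = 1)
    (hR : ∀ i, (t i * P i : ℂ) ∈ R) (hRc : IsClosed R) (hRn : R.Nonempty) :
    DifferentiableOn ℂ (poleSum w t P) Rᶜ := by
  intro z hz
  have hd : 0 < infDist z R := (hRc.notMem_iff_infDist_pos hRn).mp hz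
  set V := {y : ℂ | infDist z R / 2 < infDist y R} with hV
  have hVo : IsOpen V := isOpen_lt continuous_const (continuous_infDist_pt R)
  have hzV : z ∈ V := by simp only [hV, mem_ofPred_eq]; linarith
  refine DifferentiableAt.differentiableWithinAt ?_
  refine (differentiableOn_tsum_of_summable_norm (hw.mul_right (1 / (infDist z R / 2)))
    (fun i => ?_) hVo fun i y hy => norm_pole_le hw0 hP hR (half_pos hd) (le_of_lt hy) i
    ).differentiableAt (hVo.mem_nhds hzV)
  intro y hy
  have hne : (t i * P i : ℂ) - y ≠ 0 := by
    intro h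
    have h2 : y ∈ R := by rw [← sub_eq_zero.mp h]; exact hR i
    have h3 : infDist z R / 2 < infDist y R := hy
    rw [infDist_zero_of_mem h2] at h3
    linarith
  fun_prop (disch := assumption)

lemma le_re_poleSum (hw : Summable w) (hw0 : ∀ i, 0 ≤ w i) (hP : ∀ i, ‖P i‖ = 1)
    (ht : ∀ i, 1 ≤ t i) (hR : ∀ i, (t i * P i : ℂ) ∈ R) {z : ℂ} (hz : ‖z‖ ≤ 1)
    (hzR : 0 < infDist z R) (i : ι) :
    0 ≤ w i * ((t i - (z.re * (P i).re + z.im * (P i).im)) / ‖(t i * P i : ℂ) - z‖ ^ 2) ∧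
    w i * ((t i - (z.re * (P i).re + z.im * (P i).im)) / ‖(t i * P i : ℂ) - z‖ ^ 2) ≤
      (poleSum w t P z).re := by
  have hs : Summable fun i => (w i : ℂ) * (P i / (t i * P i - z)) :=
    Summable.of_norm_bounded (hw.mul_right (1 / infDist z R))
      (norm_pole_le hw0 hP hR hzR le_rfl)
  have hre : HasSum (fun i => w i * ((t i - (z.re * (P i).re + z.im * (P i).im)) /
      ‖(t i * P i : ℂ) - z‖ ^ 2)) (poleSum w t P z).re := by
    refine (congrArg (HasSum · _) (funext fun i => ?_)).mp (Complex.hasSum_re hs.hasSum)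
    rw [Complex.re_ofReal_mul, re_div_smul_sub (hP i)]
  have hnn : ∀ i, 0 ≤ w i * ((t i - (z.re * (P i).re + z.im * (P i).im)) /
      ‖(t i * P i : ℂ) - z‖ ^ 2) := fun i => by
    have := re_mul_re_add_le hz (hP i)
    have := ht i
    exact mul_nonneg (hw0 i) (div_nonneg (by linarith) (by positivity))
  exact ⟨hnn i, le_hasSum hre i fun j _ => hnn j⟩

/-- Cauchy estimates in terms of the distance to the singular set. -/
lemma norm_iteratedDeriv_le_infDist {h : ℂ → ℂ} {W : ℝ} (hd : DifferentiableOn ℂ h Rᶜ)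
    (hRc : IsClosed R) (hRn : R.Nonempty)
    (hW : ∀ z, 0 < infDist z R → ‖h z‖ ≤ W / infDist z R) {z : ℂ} (hz : 0 < infDist z R)
    (hW0 : 0 ≤ W) (n : ℕ) :
    ‖iteratedDeriv n h z‖ ≤ n.factorial * (2 * W / infDist z R) / (infDist z R / 2) ^ n := by
  have hsub : ∀ y ∈ closedBall z (infDist z R / 2), infDist z R / 2 ≤ infDist y R := fun y hy => by
    have h1 := infDist_le_infDist_add_dist (s := R) (x := z) (y := y)
    rw [dist_comm] at h1
    have h2 : dist y z ≤ infDist z R / 2 := hy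
    linarith
  refine Complex.norm_iteratedDeriv_le_of_forall_mem_sphere_norm_le n (half_pos hz)
    ((hd.mono fun y hy => ?_).diffContOnCl) fun y hy => ?_
  · have := hsub y (closure_ball_subset_closedBall hy)
    rw [mem_compl_iff, hRc.notMem_iff_infDist_pos hRn]
    linarith
  · have h1 := hsub y (sphere_subset_closedBall hy)
    refine (hW y (by linarith)).trans ?_
    rw [div_le_div_iff₀ (by linarith) hz]
    nlinarith

end PoleSum

lemma deriv_deriv_exp_neg_mul {h : ℂ → ℂ} {U : Set ℂ} (hU : IsOpen U) (hd : DifferentiableOn ℂ h U)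
    (c : ℂ) {z : ℂ} (hz : z ∈ U) :
    deriv (deriv fun z => Complex.exp (-c * h z)) z =
      (c ^ 2 * deriv h z ^ 2 - c * deriv (deriv h) z) * Complex.exp (-c * h z) := by
  have h1 : ∀ y ∈ U, HasDerivAt (fun z => Complex.exp (-c * h z))
      (Complex.exp (-c * h y) * (-c * deriv h y)) y := fun y hy =>
    (((hd.differentiableAt (hU.mem_nhds hy)).hasDerivAt).const_mul (-c)).cexp
  have h2 : deriv (fun z => Complex.exp (-c * h z)) =ᶠ[nhds z]
      fun y => Complex.exp (-c * h y) * (-c * deriv h y) := by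
    filter_upwards [hU.mem_nhds hz] with y hy using (h1 y hy).deriv
  rw [h2.deriv_eq]
  have h3 := ((hd.deriv hU).differentiableAt (hU.mem_nhds hz)).hasDerivAt.const_mul (-c)
  refine ((h1 z hz).mul h3).deriv.trans ?_
  ring

lemma norm_deriv_deriv_exp_neg_mul_le {R : Set ℂ} {h : ℂ → ℂ} {W : ℝ}
    (hd : DifferentiableOn ℂ h Rᶜ) (hRc : IsClosed R) (hRn : R.Nonempty)
    (hW : ∀ z, 0 < infDist z R → ‖h z‖ ≤ W / infDist z R) (hW0 : 0 ≤ W) {z : ℂ}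
    {M ε : ℝ} (hM : 1 ≤ M) (hε : 0 < ε) (hz : 1 / M ≤ infDist z R) :
    ‖deriv (deriv fun z => Complex.exp (-(ε : ℂ) * h z)) z‖ ≤
      (16 * W ^ 2 * ε ^ 2 + 16 * W * ε) * M ^ 4 * Real.exp (-ε * (h z).re) := by
  have hM0 : 0 < 1 / M := by positivity
  have hz0 : 0 < infDist z R := hM0.trans_le hz
  have hinv : (infDist z R)⁻¹ ≤ M := by
    rw [inv_le_comm₀ hz0 (by positivity), ← one_div]; exact hz
  have hzU : z ∈ Rᶜ := (hRc.notMem_iff_infDist_pos hRn).mpr hz0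
  rw [deriv_deriv_exp_neg_mul hRc.isOpen_compl hd _ hzU, norm_mul, Complex.norm_exp]
  have e1 := norm_iteratedDeriv_le_infDist hd hRc hRn hW hz0 hW0 1
  have e2 := norm_iteratedDeriv_le_infDist hd hRc hRn hW hz0 hW0 2
  rw [iteratedDeriv_one] at e1
  rw [iteratedDeriv_succ, iteratedDeriv_one] at e2
  set D := infDist z R
  have f1 : ‖deriv h z‖ ≤ 4 * W * M ^ 2 := by
    refine e1.trans ?_
    have : ((Nat.factorial 1 : ℕ) : ℝ) * (2 * W / D) / (D / 2) ^ 1 = 4 * W * (D⁻¹) ^ 2 := by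
      simp; field_simp; ring
    rw [this]
    gcongr
  have f2 : ‖deriv (deriv h) z‖ ≤ 16 * W * M ^ 4 := by
    refine e2.trans ?_
    have : ((Nat.factorial 2 : ℕ) : ℝ) * (2 * W / D) / (D / 2) ^ 2 = 16 * W * (D⁻¹) ^ 3 := by
      simp; field_simp; ring
    rw [this]
    have h3 : M ^ 3 ≤ M ^ 4 := pow_le_pow_right₀ hM (by norm_num)
    have h4 : D⁻¹ ^ 3 ≤ M ^ 3 := by gcongr
    have := h4.trans h3
    gcongr
  have f3 : ‖(ε : ℂ) ^ 2 * deriv h z ^ 2 - ε * deriv (deriv h) z‖ ≤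
      (16 * W ^ 2 * ε ^ 2 + 16 * W * ε) * M ^ 4 := by
    refine (norm_sub_le _ _).trans ?_
    rw [norm_mul, norm_mul, norm_pow, norm_pow, Complex.norm_of_nonneg hε.le]
    have g1 : ‖deriv h z‖ ^ 2 ≤ (4 * W * M ^ 2) ^ 2 := by gcongr
    have g2 : ε ^ 2 * ‖deriv h z‖ ^ 2 ≤ ε ^ 2 * (4 * W * M ^ 2) ^ 2 := by gcongr
    have g3 : ε * ‖deriv (deriv h) z‖ ≤ ε * (16 * W * M ^ 4) := by gcongr
    refine (add_le_add g2 g3).trans (le_of_eq ?_)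
    ring
  have f4 : (-(ε : ℂ) * h z).re = -ε * (h z).re := by simp
  rw [f4]
  gcongr

/-- A point of `K` in every cylinder that meets `K`. -/
lemma exists_cylinder_points {K : Set CantorGroup} (hne : K.Nonempty) :
    ∃ p : (i : Σ j : ℕ, Fin j → ZMod 2) → CantorGroup, (∀ i, p i ∈ K) ∧
      ∀ ω ∈ K, ∀ j : ℕ, ∀ i < j, ω i = p ⟨j, fun i => ω i⟩ i := by
  classical
  refine ⟨fun c => if h : ∃ ω ∈ K, ∀ i : Fin c.1, ω i = c.2 i then h.choose else hne.some,
    fun c => ?_, fun ω hω j i hi => ?_⟩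
  · dsimp only
    split_ifs with h
    · exact h.choose_spec.1
    · exact hne.some_mem
  · have h : ∃ ω' ∈ K, ∀ i : Fin j, ω' i = ω i := ⟨ω, hω, fun _ => rfl⟩
    dsimp only
    rw [dif_pos h]
    exact (h.choose_spec.2 ⟨i, hi⟩).symm

lemma summable_cylinder_weights :
    Summable fun i : (Σ j : ℕ, Fin j → ZMod 2) => (4 / 9 : ℝ) ^ i.1 := by
  refine (summable_sigma_of_nonneg fun i => by positivity).mpr ⟨fun j => ?_, ?_⟩
  · exact Summable.of_finite
  · have : (fun j : ℕ => ∑' _ : Fin j → ZMod 2, (4 / 9 : ℝ) ^ j) =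
        fun j : ℕ => (8 / 9 : ℝ) ^ j := by
      funext j
      rw [tsum_fintype, Finset.sum_const, Finset.card_univ, Fintype.card_fun, ZMod.card,
        Fintype.card_fin, nsmul_eq_mul]
      push_cast
      rw [← mul_pow]
      norm_num
    simp only [this]
    exact summable_geometric_of_lt_one (by norm_num) (by norm_num)

/-- The union of the outward radial segments starting on a subset of the circle. -/
def rays (K : Set CantorGroup) : Set ℂ :=
  (fun q : ℝ × CantorGroup => (q.1 : ℂ) * cantorPoint q.2) '' (Icc 1 2 ×ˢ K)

lemma isClosed_rays {K : Set CantorGroup} (hK : IsClosed K) : IsClosed (rays K) := by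
  refine ((isCompact_Icc.prod hK.isCompact).image ?_).isClosed
  have := continuous_cantorPoint
  fun_prop

lemma rays_nonempty {K : Set CantorGroup} (hne : K.Nonempty) : (rays K).Nonempty :=
  ⟨_, (1, hne.some), ⟨by simp, hne.some_mem⟩, rfl⟩

lemma infDist_le_infDist_rays {K : Set CantorGroup} (hne : K.Nonempty) {z : ℂ} (hz : ‖z‖ ≤ 1) :
    infDist z (cantorPoint '' K) ≤ infDist z (rays K) := by
  refine (le_infDist (rays_nonempty hne)).mpr ?_
  rintro _ ⟨⟨t, ω⟩, ⟨ht, hω⟩, rfl⟩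
  refine (infDist_le_dist_of_mem (mem_image_of_mem cantorPoint hω)).trans ?_
  rw [dist_eq_norm, dist_eq_norm]
  exact norm_sub_le_norm_sub_smul hz (norm_cantorPoint ω) ht.1

/-- A holomorphic function with nonnegative real part on the disc and which tends quickly to
infinity near a given closed subset of a thin perfect set. -/
theorem exists_large_holomorphic {K : Set CantorGroup} (hK : IsClosed K) (hne : K.Nonempty) :
    ∃ (h : ℂ → ℂ) (W : ℝ), 0 ≤ W ∧ DifferentiableOn ℂ h (rays K)ᶜ ∧
      (∀ z, 0 < infDist z (rays K) → ‖h z‖ ≤ W / infDist z (rays K)) ∧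
      ∀ z, ‖z‖ ≤ 1 → 0 < infDist z (cantorPoint '' K) → ∀ k : ℕ,
        infDist z (cantorPoint '' K) ≤ 2 * (2 / 9) ^ k → 2 ^ k / 144 ≤ (h z).re := by
  obtain ⟨p, hpK, hp⟩ := exists_cylinder_points hne
  let w : (Σ j : ℕ, Fin j → ZMod 2) → ℝ := fun i => (4 / 9) ^ i.1
  let t : (Σ j : ℕ, Fin j → ZMod 2) → ℝ := fun i => 1 + (2 / 9) ^ i.1
  let P : (Σ j : ℕ, Fin j → ZMod 2) → ℂ := fun i => cantorPoint (p i)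
  have hw : Summable w := summable_cylinder_weights
  have hw0 : ∀ i, 0 ≤ w i := fun i => by positivity
  have ht : ∀ i, 1 ≤ t i := fun i => le_add_of_nonneg_right (by positivity)
  have hP : ∀ i, ‖P i‖ = 1 := fun i => norm_cantorPoint _
  have hR : ∀ i, (t i * P i : ℂ) ∈ rays K := fun i => by
    refine ⟨(t i, p i), ⟨⟨ht i, ?_⟩, hpK i⟩, rfl⟩
    have : (2 / 9 : ℝ) ^ i.1 ≤ 1 := pow_le_one₀ (by norm_num) (by norm_num)
    simp only [t]
    linarith
  refine ⟨poleSum w t P, ∑' i, w i, tsum_nonneg hw0,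
    differentiableOn_poleSum hw hw0 hP hR (isClosed_rays hK) (rays_nonempty hne),
    fun z hz => norm_poleSum_le hw hw0 hP hR hz le_rfl, fun z hz hd k hk => ?_⟩
  have hdR := hd.trans_le (infDist_le_infDist_rays hne hz)
  obtain ⟨_, ⟨ω, hω, rfl⟩, hdist⟩ :=
    (hK.isCompact.image continuous_cantorPoint).exists_infDist_eq_dist
    (hne.image _) z
  rw [hdist, dist_eq_norm] at hk
  set i : (Σ j : ℕ, Fin j → ZMod 2) := ⟨k, fun i => ω i⟩ with hi
  refine le_trans ?_ (le_re_poleSum hw hw0 hP ht hR hz hdR i).2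
  have h1 : ‖cantorPoint ω - P i‖ ≤ 9 * (2 / 9) ^ k := norm_cantorPoint_sub_le (hp ω hω k)
  have h2 := re_mul_re_add_le hz (hP i)
  set x : ℝ := (2 / 9) ^ k with hx
  have hx0 : 0 < x := by positivity
  have h3 : ‖(t i * P i : ℂ) - z‖ ≤ 12 * x := by
    have e1 : (t i * P i : ℂ) - z = x * P i - (cantorPoint ω - P i) - (z - cantorPoint ω) := by
      simp only [t, hi, hx]; push_cast; ring
    rw [e1]
    refine (norm_sub_le _ _).trans ?_
    have e2 := norm_sub_le (x * P i : ℂ) (cantorPoint ω - P i)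
    rw [norm_mul, hP, Complex.norm_of_nonneg hx0.le, mul_one] at e2
    linarith
  have hpos : 0 < ‖(t i * P i : ℂ) - z‖ := by
    rw [← dist_eq_norm, dist_comm]
    exact hdR.trans_le (infDist_le_dist_of_mem (hR i))
  have h4 : x / (12 * x) ^ 2 ≤
      (t i - (z.re * (P i).re + z.im * (P i).im)) / ‖(t i * P i : ℂ) - z‖ ^ 2 := by
    have : x ≤ t i - (z.re * (P i).re + z.im * (P i).im) := by
      simp only [t, hi]; linarith
    gcongr
    exact hx0.le.trans this
  refine le_trans ?_ (mul_le_mul_of_nonneg_left h4 (hw0 i))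
  have h5 : w i = 2 ^ k * x := by
    simp only [w, hi, hx]; rw [← mul_pow]; norm_num
  rw [h5]
  have : 2 ^ k * x * (x / (12 * x) ^ 2) = 2 ^ k / 144 := by
    field_simp; norm_num
  rw [this]

/-- The outer function `exp (-ε h)` extended by zero to a singular set `F`. -/
def outerFun (F : Set ℂ) (h : ℂ → ℂ) (ε : ℝ) (z : ℂ) : ℂ :=
  open Classical in if z ∈ F then 0 else Complex.exp (-(ε : ℂ) * h z)

lemma outerFun_of_notMem {F : Set ℂ} {h : ℂ → ℂ} {ε : ℝ} {z : ℂ} (hz : z ∉ F) :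
    outerFun F h ε z = Complex.exp (-(ε : ℂ) * h z) := if_neg hz

lemma outerFun_of_mem {F : Set ℂ} {h : ℂ → ℂ} {ε : ℝ} {z : ℂ} (hz : z ∈ F) :
    outerFun F h ε z = 0 := if_pos hz

lemma exp_neg_mul_pow_le {ε : ℝ} (hε : 0 < ε) (k : ℕ) :
    ((9 / 4) * (9 / 2) ^ k) ^ 4 * Real.exp (-ε * (2 ^ k / 144)) ≤
      (9 / 4) ^ 4 * (362880 * (144 / ε) ^ 9) := by
  set y : ℝ := ε * (2 ^ k / 144) with hy
  have hy0 : 0 < y := by positivity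
  have h1 := Real.pow_div_factorial_le_exp y hy0.le 9
  have h2 : Real.exp (-ε * (2 ^ k / 144)) ≤ 362880 * (144 / ε) ^ 9 * (1 / 512) ^ k := by
    have e1 : -ε * (2 ^ k / 144) = -y := by rw [hy]; ring
    rw [e1, Real.exp_neg, inv_le_comm₀ (Real.exp_pos _) (by positivity)]
    refine le_trans (le_of_eq ?_) h1
    have e2 : (512 : ℝ) ^ k = (2 ^ k) ^ 9 := by rw [← pow_mul, mul_comm, pow_mul]; norm_num
    have e3 : (Nat.factorial 9 : ℝ) = 362880 := by norm_num [Nat.factorial]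
    rw [e3, hy, one_div, inv_pow, e2]
    field_simp
  have h3 : ((9 / 4 : ℝ) * (9 / 2) ^ k) ^ 4 = (9 / 4) ^ 4 * (6561 / 16) ^ k := by
    rw [mul_pow, ← pow_mul, mul_comm k, pow_mul]; norm_num
  rw [h3]
  calc (9 / 4 : ℝ) ^ 4 * (6561 / 16) ^ k * Real.exp (-ε * (2 ^ k / 144))
      ≤ (9 / 4) ^ 4 * (6561 / 16) ^ k * (362880 * (144 / ε) ^ 9 * (1 / 512) ^ k) := by gcongr
    _ = (9 / 4) ^ 4 * (362880 * (144 / ε) ^ 9) * (6561 / 8192) ^ k := by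
      have : (6561 / 8192 : ℝ) ^ k = (6561 / 16) ^ k * (1 / 512) ^ k := by
        rw [← mul_pow]; norm_num
      rw [this]; ring
    _ ≤ (9 / 4) ^ 4 * (362880 * (144 / ε) ^ 9) := by
      refine mul_le_of_le_one_right (by positivity) (pow_le_one₀ (by norm_num) (by norm_num))

lemma isClosed_image_cantorPoint {K : Set CantorGroup} (hK : IsClosed K) :
    IsClosed (cantorPoint '' K) := (hK.isCompact.image continuous_cantorPoint).isClosed

lemma notMem_rays {K : Set CantorGroup} (hK : IsClosed K) (hne : K.Nonempty) {z : ℂ}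
    (hz : ‖z‖ ≤ 1) (hzF : z ∉ cantorPoint '' K) : z ∈ (rays K)ᶜ :=
  ((isClosed_rays hK).notMem_iff_infDist_pos (rays_nonempty hne)).mpr <|
    (((isClosed_image_cantorPoint hK).notMem_iff_infDist_pos (hne.image _)).mp hzF).trans_le
      (infDist_le_infDist_rays hne hz)

theorem exists_outer_family {K : Set CantorGroup} (hK : IsClosed K) (hne : K.Nonempty) :
    ∃ (h : ℂ → ℂ) (U : Set ℂ), IsOpen U ∧ closedBall 0 1 \ (cantorPoint '' K) ⊆ U ∧
      DifferentiableOn ℂ h U ∧ (∀ z ∈ closedBall 0 1 \ (cantorPoint '' K), 0 ≤ (h z).re) ∧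
      ∀ ε > 0, outerFun (cantorPoint '' K) h ε ∈ APlus := by
  obtain ⟨h, W, hW0, hd, hW, hlow⟩ := exists_large_holomorphic hK hne
  set F := cantorPoint '' K with hF
  have hFc : IsClosed F := isClosed_image_cantorPoint hK
  have hFn : F.Nonempty := hne.image _
  have hU : ∀ z ∈ closedBall (0 : ℂ) 1 \ F, z ∈ (rays K)ᶜ := fun z hz =>
    notMem_rays hK hne (by simpa using hz.1) hz.2
  have hpos : ∀ z, z ∉ F → 0 < infDist z F := fun z hz => (hFc.notMem_iff_infDist_pos hFn).mp hz
  have hle2 : ∀ z, ‖z‖ ≤ 1 → infDist z F ≤ 2 := fun z hz => by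
    obtain ⟨q, hq⟩ := hFn
    refine (infDist_le_dist_of_mem hq).trans ?_
    obtain ⟨ω, -, rfl⟩ := hq
    rw [dist_eq_norm]
    refine (norm_sub_le _ _).trans ?_
    rw [norm_cantorPoint]; linarith
  have hball : ∀ z ∈ ball (0 : ℂ) 1, z ∉ F := by
    rintro z hz ⟨ω, -, rfl⟩
    simp [norm_cantorPoint] at hz
  refine ⟨h, (rays K)ᶜ, (isClosed_rays hK).isOpen_compl, hU, hd, fun z hz => ?_, fun ε hε => ?_⟩
  · have h1 := hlow z (by simpa using hz.1) (hpos z hz.2) 0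
      (by simpa using hle2 z (by simpa using hz.1))
    refine le_trans ?_ h1
    positivity
  have hdE : DifferentiableOn ℂ (fun z => Complex.exp (-(ε : ℂ) * h z)) (rays K)ᶜ :=
    (hd.const_mul _).cexp
  have heq : ∀ z, z ∉ F → outerFun F h ε =ᶠ[nhds z] fun z => Complex.exp (-(ε : ℂ) * h z) :=
    fun z hz => by
      filter_upwards [hFc.isOpen_compl.mem_nhds hz] with y hy using outerFun_of_notMem hy
  have hdiff : ∀ z ∈ closedBall (0 : ℂ) 1 \ F, DifferentiableAt ℂ (outerFun F h ε) z :=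
    fun z hz => (heq z hz.2).differentiableAt_iff.mpr
      (hdE.differentiableAt ((isClosed_rays hK).isOpen_compl.mem_nhds (hU z hz)))
  refine mem_APlus_of_deriv_two_bounded
    (B := (16 * W ^ 2 * ε ^ 2 + 16 * W * ε) * ((9 / 4) ^ 4 * (362880 * (144 / ε) ^ 9)))
    (fun z hz => (hdiff z ⟨ball_subset_closedBall hz, hball z hz⟩).differentiableWithinAt)
    (fun z hz => ?_) fun z hz => ?_
  · by_cases hzF : z ∈ F
    · rw [ContinuousWithinAt, outerFun_of_mem hzF, Metric.tendsto_nhdsWithin_nhds]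
      intro δ hδ
      have h2 : Tendsto (fun k : ℕ => Real.exp (-ε * (2 ^ k / 144))) atTop (nhds 0) := by
        refine Real.tendsto_exp_atBot.comp ?_
        have h3 : Tendsto (fun k : ℕ => (2 : ℝ) ^ k) atTop atTop :=
          tendsto_pow_atTop_atTop_of_one_lt one_lt_two
        exact (h3.atTop_div_const (by norm_num)).const_mul_atTop_of_neg (by linarith)
      obtain ⟨k, hk⟩ := (h2.eventually (gt_mem_nhds hδ)).exists
      refine ⟨2 * (2 / 9) ^ k, by positivity, fun y hy hyz => ?_⟩
      rw [dist_zero_right]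
      by_cases hyF : y ∈ F
      · rwa [outerFun_of_mem hyF, norm_zero]
      rw [outerFun_of_notMem hyF, Complex.norm_exp]
      refine lt_of_le_of_lt ?_ hk
      have h4 := hlow y (by simpa using hy) (hpos y hyF) k
        ((infDist_le_dist_of_mem hzF).trans hyz.le)
      have f4 : (-(ε : ℂ) * h y).re = -ε * (h y).re := by simp
      rw [f4, Real.exp_le_exp]
      nlinarith
    · exact (hdiff z ⟨hz, hzF⟩).continuousAt.continuousWithinAt
  · have hz1 : ‖z‖ ≤ 1 := by simpa using ball_subset_closedBall hz
    have hzF := hball z hz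
    rw [((heq z hzF).deriv).deriv_eq]
    obtain ⟨k, hk1, hk2⟩ := exists_nat_pow_near_of_lt_one
      (x := infDist z F / 2) (y := 2 / 9) (by linarith [hpos z hzF])
      (by linarith [hle2 z hz1]) (by norm_num) (by norm_num)
    have hM : (1 : ℝ) ≤ 9 / 4 * (9 / 2) ^ k := by
      have : (1 : ℝ) ≤ (9 / 2) ^ k := one_le_pow₀ (by norm_num)
      linarith
    have hMd : 1 / (9 / 4 * (9 / 2) ^ k) ≤ infDist z (rays K) := by
      refine le_trans ?_ (infDist_le_infDist_rays hne hz1)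
      have : (1 : ℝ) / (9 / 4 * (9 / 2) ^ k) = 2 * (2 / 9) ^ (k + 1) := by
        rw [show (2 / 9 : ℝ) = (9 / 2)⁻¹ by norm_num, inv_pow, pow_succ]; field_simp; norm_num
      rw [this]
      linarith
    refine (norm_deriv_deriv_exp_neg_mul_le hd (isClosed_rays hK) (rays_nonempty hne) hW hW0
      hM hε hMd).trans ?_
    rw [mul_assoc]
    refine mul_le_mul_of_nonneg_left (le_trans ?_ (exp_neg_mul_pow_le hε k)) (by positivity)
    have h4 := hlow z hz1 (hpos z hzF) k (by linarith)
    refine mul_le_mul_of_nonneg_left (Real.exp_le_exp.mpr ?_) (by positivity)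
    nlinarith

/-- `f` is the sum on the closed unit disc of the absolutely convergent Taylor series with
coefficients `a`. -/
def IsTaylorRep (f : ℂ → ℂ) (a : ℕ → ℂ) : Prop :=
  Summable (fun n => ‖a n‖) ∧ ∀ z ∈ closedBall (0 : ℂ) 1, HasSum (fun n => a n * z ^ n) (f z)

lemma IsTaylorRep.mem {f : ℂ → ℂ} {a : ℕ → ℂ} (h : IsTaylorRep f a) : f ∈ APlus := ⟨a, h⟩

lemma IsTaylorRep.taylorCoeff_eq {f : ℂ → ℂ} {a : ℕ → ℂ} (h : IsTaylorRep f a) (n : ℕ) :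
    taylorCoeff f n = a n := by
  have hp : HasFPowerSeriesOnBall f (FormalMultilinearSeries.ofScalars ℂ a) 0 1 := by
    refine ⟨?_, one_pos, fun {y} hy => ?_⟩
    · refine FormalMultilinearSeries.le_radius_of_summable_norm (r := 1) _ ?_
      refine h.1.of_nonneg_of_le (fun n => by positivity) fun n => ?_
      rw [NNReal.coe_one, one_pow, mul_one]
      exact (FormalMultilinearSeries.ofScalars_norm (E := ℂ) a n).le
    · have hy1 : y ∈ closedBall (0 : ℂ) 1 := by
        rw [← ENNReal.ofReal_one, Metric.eball_ofReal] at hy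
        exact ball_subset_closedBall hy
      have := h.2 y hy1
      simpa [FormalMultilinearSeries.ofScalars_apply_eq, mul_comm] using this
  have h1 := hp.factorial_smul 1 n
  rw [taylorCoeff, iteratedDeriv_eq_iteratedFDeriv]
  rw [← h1]
  have hn : ((n.factorial : ℕ) : ℂ) ≠ 0 := by exact_mod_cast n.factorial_ne_zero
  simp
  field_simp

lemma isTaylorRep_taylorCoeff {f : ℂ → ℂ} (hf : f ∈ APlus) : IsTaylorRep f (taylorCoeff f) := by
  obtain ⟨a, ha⟩ := hf
  have : taylorCoeff f = a := funext fun n => IsTaylorRep.taylorCoeff_eq ha n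
  rw [this]
  exact ha

lemma IsTaylorRep.add {f g : ℂ → ℂ} {a b : ℕ → ℂ} (hf : IsTaylorRep f a) (hg : IsTaylorRep g b) :
    IsTaylorRep (f + g) (a + b) := by
  refine ⟨(hf.1.add hg.1).of_nonneg_of_le (fun _ => norm_nonneg _) fun n => norm_add_le _ _,
    fun z hz => ?_⟩
  simpa [add_mul] using (hf.2 z hz).add (hg.2 z hz)

lemma IsTaylorRep.sub {f g : ℂ → ℂ} {a b : ℕ → ℂ} (hf : IsTaylorRep f a) (hg : IsTaylorRep g b) :
    IsTaylorRep (f - g) (a - b) := by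
  refine ⟨(hf.1.add hg.1).of_nonneg_of_le (fun _ => norm_nonneg _) fun n => norm_sub_le _ _,
    fun z hz => ?_⟩
  simpa [sub_mul] using (hf.2 z hz).sub (hg.2 z hz)

lemma summable_norm_mul_pow {a : ℕ → ℂ} (ha : Summable fun n => ‖a n‖) {z : ℂ}
    (hz : z ∈ closedBall (0 : ℂ) 1) : Summable fun n => ‖a n * z ^ n‖ := by
  have : ‖z‖ ≤ 1 := by simpa using hz
  refine ha.of_nonneg_of_le (fun _ => norm_nonneg _) fun n => ?_
  rw [norm_mul, norm_pow]
  exact mul_le_of_le_one_right (norm_nonneg _) (pow_le_one₀ (norm_nonneg _) this)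

lemma IsTaylorRep.mul {f g : ℂ → ℂ} {a b : ℕ → ℂ} (hf : IsTaylorRep f a) (hg : IsTaylorRep g b) :
    IsTaylorRep (f * g) fun n => ∑ kl ∈ Finset.HasAntidiagonal.antidiagonal n, a kl.1 * b kl.2 := by
  refine ⟨summable_norm_sum_mul_antidiagonal_of_summable_norm hf.1 hg.1, fun z hz => ?_⟩
  have h1 := summable_norm_mul_pow hf.1 hz
  have h2 := summable_norm_mul_pow hg.1 hz
  have h3 := tsum_mul_tsum_eq_tsum_sum_antidiagonal_of_summable_norm h1 h2
  have h4 := (summable_norm_sum_mul_antidiagonal_of_summable_norm h1 h2).of_norm.hasSum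
  rw [← h3, (hf.2 z hz).tsum_eq, (hg.2 z hz).tsum_eq] at h4
  refine (congrArg (HasSum · _) (funext fun n => ?_)).mp h4
  rw [Finset.sum_mul]
  refine Finset.sum_congr rfl fun kl hkl => ?_
  rw [← Finset.HasAntidiagonal.mem_antidiagonal.mp hkl, pow_add]
  ring

lemma IsTaylorRep.norm_le {f : ℂ → ℂ} {a : ℕ → ℂ} (h : IsTaylorRep f a) {z : ℂ}
    (hz : z ∈ closedBall (0 : ℂ) 1) : ‖f z‖ ≤ ∑' n, ‖a n‖ := by
  have hz1 : ‖z‖ ≤ 1 := by simpa using hz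
  rw [← (h.2 z hz).tsum_eq]
  refine tsum_of_norm_bounded h.1.hasSum fun n => ?_
  rw [norm_mul, norm_pow]
  exact mul_le_of_le_one_right (norm_nonneg _) (pow_le_one₀ (norm_nonneg _) hz1)

lemma IsTaylorRep.aPlusNorm_eq {f : ℂ → ℂ} {a : ℕ → ℂ} (h : IsTaylorRep f a) :
    APlusNorm f = ∑' n, ‖a n‖ := by
  simp only [APlusNorm, h.taylorCoeff_eq]

/-- The pairing of a summable sequence with the `m`-th shift of a bounded one. -/
def shiftPairing (φ : ℕ → ℂ) (m : ℕ) (a : ℕ → ℂ) : ℂ := ∑' n, a n * φ (n + m)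

section ShiftPairing

variable {φ a b : ℕ → ℂ} {C : ℝ}

lemma hasSum_shiftPairing (hφ : ∀ n, ‖φ n‖ ≤ C) (ha : Summable fun n => ‖a n‖) (m : ℕ) :
    HasSum (fun n => a n * φ (n + m)) (shiftPairing φ m a) := by
  refine (Summable.of_norm_bounded (ha.mul_right C) fun n => ?_).hasSum
  rw [norm_mul]
  exact mul_le_mul_of_nonneg_left (hφ _) (norm_nonneg _)

lemma shiftPairing_add (hφ : ∀ n, ‖φ n‖ ≤ C) (ha : Summable fun n => ‖a n‖)
    (hb : Summable fun n => ‖b n‖) (m : ℕ) :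
    shiftPairing φ m (a + b) = shiftPairing φ m a + shiftPairing φ m b := by
  have := (hasSum_shiftPairing hφ ha m).add (hasSum_shiftPairing hφ hb m)
  rw [← this.tsum_eq, shiftPairing]
  simp [add_mul]

lemma shiftPairing_sub (hφ : ∀ n, ‖φ n‖ ≤ C) (ha : Summable fun n => ‖a n‖)
    (hb : Summable fun n => ‖b n‖) (m : ℕ) :
    shiftPairing φ m (a - b) = shiftPairing φ m a - shiftPairing φ m b := by
  have := (hasSum_shiftPairing hφ ha m).sub (hasSum_shiftPairing hφ hb m)
  rw [← this.tsum_eq, shiftPairing]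
  simp [sub_mul]

lemma norm_shiftPairing_le (hφ : ∀ n, ‖φ n‖ ≤ C) (ha : Summable fun n => ‖a n‖) (m : ℕ) :
    ‖shiftPairing φ m a‖ ≤ (∑' n, ‖a n‖) * C := by
  refine tsum_of_norm_bounded (ha.hasSum.mul_right C) fun n => ?_
  rw [norm_mul]
  exact mul_le_mul_of_nonneg_left (hφ _) (norm_nonneg _)

lemma shiftPairing_cauchyProduct (hφ : ∀ n, ‖φ n‖ ≤ C) (ha : Summable fun n => ‖a n‖)
    (hb : Summable fun n => ‖b n‖) (m : ℕ) :
    shiftPairing φ m (fun n => ∑ kl ∈ Finset.HasAntidiagonal.antidiagonal n, a kl.1 * b kl.2) =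
      ∑' k, a k * shiftPairing φ (k + m) b := by
  have hs : Summable fun p : ℕ × ℕ => a p.1 * b p.2 * φ (p.1 + p.2 + m) := by
    have h1 : Summable fun p : ℕ × ℕ => ‖a p.1‖ * ‖b p.2‖ :=
      ha.mul_of_nonneg hb (fun _ => norm_nonneg _) fun _ => norm_nonneg _
    refine Summable.of_norm_bounded (h1.mul_right C) fun p => ?_
    rw [norm_mul, norm_mul]
    exact mul_le_mul_of_nonneg_left (hφ _) (by positivity)
  have e1 : ∑' p : ℕ × ℕ, a p.1 * b p.2 * φ (p.1 + p.2 + m) =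
      ∑' k, a k * shiftPairing φ (k + m) b := by
    rw [hs.tsum_prod]
    refine tsum_congr fun k => ?_
    rw [← (hasSum_shiftPairing hφ hb (k + m)).tsum_eq, ← tsum_mul_left]
    refine tsum_congr fun l => ?_
    rw [mul_assoc, show k + l + m = l + (k + m) by ring]
  rw [← e1, ← Finset.HasAntidiagonal.sigmaAntidiagonalEquivProd.tsum_eq, shiftPairing]
  refine Eq.trans ?_
    (Finset.HasAntidiagonal.sigmaAntidiagonalEquivProd.summable_iff.mpr hs).tsum_sigma.symm
  refine tsum_congr fun n => ?_
  rw [tsum_fintype, Finset.sum_mul, ← Finset.sum_coe_sort]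
  refine Finset.sum_congr rfl fun kl _ => ?_
  have := Finset.HasAntidiagonal.mem_antidiagonal.mp kl.2
  simp [Finset.HasAntidiagonal.sigmaAntidiagonalEquivProd, this]

end ShiftPairing

/-- The elements of `A⁺` which vanish on `E` and are annihilated by all shifts of `φ`. -/
def annihilatorIdeal (E : Set ℂ) (φ : ℕ → ℂ) : Set (ℂ → ℂ) :=
  {f ∈ APlus | (∀ z ∈ E, f z = 0) ∧ ∀ m, shiftPairing φ m (taylorCoeff f) = 0}

lemma isClosedIdealAPlus_annihilatorIdeal {E : Set ℂ} (hE : E ⊆ closedBall 0 1) {φ : ℕ → ℂ}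
    {C : ℝ} (hφ : ∀ n, ‖φ n‖ ≤ C) : IsClosedIdealAPlus (annihilatorIdeal E φ) := by
  have hC : 0 ≤ C := (norm_nonneg _).trans (hφ 0)
  refine ⟨fun f hf => hf.1, fun f hf g hg => ?_, fun f hf g hg => ?_, fun f hf hε => ?_⟩
  · have rf := isTaylorRep_taylorCoeff hf.1
    have rg := isTaylorRep_taylorCoeff hg.1
    have rfg := rf.add rg
    refine ⟨rfg.mem, fun z hz => by simp [hf.2.1 z hz, hg.2.1 z hz], fun m => ?_⟩
    rw [funext rfg.taylorCoeff_eq, shiftPairing_add hφ rf.1 rg.1, hf.2.2, hg.2.2, add_zero]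
  · have rf := isTaylorRep_taylorCoeff hf
    have rg := isTaylorRep_taylorCoeff hg.1
    have rfg := rf.mul rg
    refine ⟨rfg.mem, fun z hz => by simp [hg.2.1 z hz], fun m => ?_⟩
    rw [funext rfg.taylorCoeff_eq, shiftPairing_cauchyProduct hφ rf.1 rg.1]
    simp [hg.2.2]
  · have rf := isTaylorRep_taylorCoeff hf
    refine ⟨hf, fun z hz => ?_, fun m => ?_⟩
    · refine norm_le_zero_iff.mp (le_of_forall_pos_le_add fun ε hε' => ?_)
      obtain ⟨g, hg, hfg⟩ := hε ε hε'
      have r := rf.sub (isTaylorRep_taylorCoeff hg.1)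
      have h1 := r.norm_le (hE hz)
      rw [← r.aPlusNorm_eq, Pi.sub_apply, hg.2.1 z hz, sub_zero] at h1
      linarith
    · refine norm_le_zero_iff.mp (le_of_forall_pos_le_add fun ε hε' => ?_)
      obtain ⟨g, hg, hfg⟩ := hε (ε / (C + 1)) (by positivity)
      have rg := isTaylorRep_taylorCoeff hg.1
      have r := rf.sub rg
      have h1 := norm_shiftPairing_le hφ r.1 m
      rw [← r.aPlusNorm_eq, shiftPairing_sub hφ rf.1 rg.1, hg.2.2, sub_zero] at h1
      have h2 : APlusNorm (f - g) * C ≤ ε / (C + 1) * C := by gcongr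
      have h3 : ε / (C + 1) * C ≤ ε := by
        rw [div_mul_eq_mul_div, div_le_iff₀ (by positivity)]; nlinarith
      linarith

lemma hasSum_cantorCoeff {f : ℂ → ℂ} {a : ℕ → ℂ} (hf : IsTaylorRep f a) (g : C(CantorGroup, ℂ))
    (m : ℕ) :
    HasSum (fun n : ℕ => a n * cantorCoeff g ((n + m : ℕ) : ℤ))
      (∫ ω, g ω * f (cantorPoint ω) * cantorPoint ω ^ m ∂cantorHaar) := by
  obtain ⟨C, hC⟩ := (isCompact_range g.continuous).isBounded.exists_norm_le
  have hC' : ∀ ω, ‖g ω‖ ≤ C := fun ω => hC _ ⟨ω, rfl⟩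
  have hc := continuous_cantorPoint
  have key := hasSum_integral_of_dominated_convergence (μ := cantorHaar)
    (F := fun (n : ℕ) ω => a n * (g ω * cantorPoint ω ^ (n + m)))
    (f := fun ω => g ω * f (cantorPoint ω) * cantorPoint ω ^ m)
    (fun n _ => ‖a n‖ * C) (fun n => Continuous.aestronglyMeasurable (by fun_prop))
    (fun n => ae_of_all _ fun ω => by
      rw [norm_mul, norm_mul, norm_pow, norm_cantorPoint, one_pow, mul_one]
      exact mul_le_mul_of_nonneg_left (hC' ω) (norm_nonneg _))
    (ae_of_all _ fun _ => hf.1.mul_right C)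
    (integrable_const _)
    (ae_of_all _ fun ω => by
      have h1 := ((hf.2 (cantorPoint ω) (by simp [norm_cantorPoint])).mul_left (g ω)).mul_right
        (cantorPoint ω ^ m)
      refine (congrArg (HasSum · _) (funext fun n => ?_)).mpr h1
      rw [pow_add]; ring)
  refine (congrArg (HasSum · _) (funext fun n => ?_)).mp key
  simp only [integral_const_mul, cantorCoeff, zpow_natCast]
  rfl

/-- A function of `A⁺` vanishing on the supports of the densities `g j` for large `j` is
annihilated by all shifts of the limit of their Fourier coefficients. -/
lemma shiftPairing_eq_zero {g : ℕ → C(CantorGroup, ℂ)} {φ : ℕ → ℂ}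
    (hφ : ∀ n : ℕ, Tendsto (fun j => cantorCoeff (g j) n) atTop (nhds (φ n)))
    (hb : ∀ j n : ℕ, ‖cantorCoeff (g j) n‖ ≤ 2) {f : ℂ → ℂ} (hf : f ∈ APlus)
    (hz : ∀ᶠ j in atTop, ∀ ω, g j ω * f (cantorPoint ω) = 0) (m : ℕ) :
    shiftPairing φ m (taylorCoeff f) = 0 := by
  have rf := isTaylorRep_taylorCoeff hf
  have h1 : Tendsto (fun j => ∑' n : ℕ, taylorCoeff f n * cantorCoeff (g j) ((n + m : ℕ) : ℤ)) atTop
      (nhds (shiftPairing φ m (taylorCoeff f))) := by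
    refine tendsto_tsum_of_dominated_convergence (bound := fun n => ‖taylorCoeff f n‖ * 2)
      (rf.1.mul_right 2) (fun n => (hφ (n + m)).const_mul _) (Eventually.of_forall fun j n => ?_)
    rw [norm_mul]
    exact mul_le_mul_of_nonneg_left (hb j _) (norm_nonneg _)
  refine tendsto_nhds_unique h1 (tendsto_const_nhds.congr' ?_)
  filter_upwards [hz] with j hj
  rw [(hasSum_cantorCoeff rf (g j) m).tsum_eq]
  simp [hj]

lemma norm_mul_two_pi_le_of_circle {G : ℂ → ℂ} (hG : DifferentiableOn ℂ G (ball 0 1)) {r : ℝ}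
    (hr1 : r < 1) {z : ℂ} (hz : ‖z‖ < r) {M : ℝ → ℝ} (hM : Continuous M)
    (hGM : ∀ θ, ‖G (circleMap 0 r θ)‖ ≤ M θ) :
    2 * Real.pi * ‖G z‖ ≤ r / (r - ‖z‖) * ∫ θ in (0 : ℝ)..(2 * Real.pi), M θ := by
  have hr0 : 0 < r := (norm_nonneg z).trans_lt hz
  have hsub : closedBall (0 : ℂ) r ⊆ ball 0 1 := closedBall_subset_ball hr1
  have h1 := ((hG.mono (closure_ball_subset_closedBall.trans hsub)).diffContOnCl
    ).two_pi_i_inv_smul_circleIntegral_sub_inv_smul (w := z) (by simpa using hz)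
  have h2 : ‖∮ w in C(0, r), (w - z)⁻¹ • G w‖ ≤
      r / (r - ‖z‖) * ∫ θ in (0 : ℝ)..(2 * Real.pi), M θ := by
    rw [← intervalIntegral.integral_const_mul]
    refine intervalIntegral.norm_integral_le_of_norm_le Real.two_pi_pos.le
      (ae_of_all _ fun θ _ => ?_) ((continuous_const.mul hM).intervalIntegrable _ _)
    have h3 : r - ‖z‖ ≤ ‖circleMap 0 r θ - z‖ := by
      have := norm_sub_norm_le (circleMap 0 r θ) z
      rwa [norm_circleMap_zero, abs_of_pos hr0] at this
    have h4 : 0 < r - ‖z‖ := sub_pos.mpr hz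
    rw [deriv_circleMap, norm_smul, norm_smul, norm_mul, norm_inv, norm_circleMap_zero,
      Complex.norm_I, mul_one, abs_of_pos hr0, ← mul_assoc, ← div_eq_mul_inv]
    have h5 := hGM θ
    have : 0 ≤ M θ := (norm_nonneg _).trans h5
    gcongr
  rw [← h1, norm_smul]
  have h5 : ‖(2 * Real.pi * I : ℂ)⁻¹‖ = (2 * Real.pi)⁻¹ := by
    simp [abs_of_pos Real.pi_pos]
  rw [h5, mul_inv_cancel_left₀ Real.two_pi_pos.ne']
  exact h2

/-- If a function bounded by one is divisible by an inner function, the quotient is bounded by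
one. -/
theorem norm_quotient_le_one_of_inner {S f g : ℂ → ℂ} (hS : IsInnerFunction S) (hg : g ∈ Hinf)
    (hf : ∀ z ∈ ball (0 : ℂ) 1, ‖f z‖ ≤ 1) (hfg : ∀ z ∈ ball (0 : ℂ) 1, f z = S z * g z)
    {z : ℂ} (hz : z ∈ ball (0 : ℂ) 1) : ‖g z‖ ≤ 1 := by
  obtain ⟨hgd, C₀, hC₀⟩ := hg
  set C := max C₀ 1 with hC
  have hC1 : 1 ≤ C := le_max_right _ _
  have hz1 : ‖z‖ < 1 := by simpa using hz
  have hle : ∀ w ∈ ball (0 : ℂ) 1, ‖g w‖ ≤ C / max 1 (C * ‖S w‖) := fun w hw => by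
    rw [le_div_iff₀ (lt_of_lt_of_le one_pos (le_max_left _ _))]
    have h1 : ‖g w‖ ≤ C := (hC₀ w hw).trans (le_max_left _ _)
    have h2 := hf w hw
    rw [hfg w hw, norm_mul] at h2
    rcases max_cases 1 (C * ‖S w‖) with h | h <;> rw [h.1]
    · simpa using h1
    · nlinarith [norm_nonneg (g w)]
  have hcm : ∀ r : ℝ, 0 ≤ r → r < 1 → ∀ θ, circleMap 0 r θ ∈ ball (0 : ℂ) 1 := fun r h0 h1 θ => by
    rw [mem_ball_zero_iff, norm_circleMap_zero, abs_of_nonneg h0]; exact h1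
  have hcont : ∀ r : ℝ, 0 ≤ r → r < 1 → ∀ n : ℕ,
      Continuous fun θ => (C / max 1 (C * ‖S (circleMap 0 r θ)‖)) ^ n := fun r h0 h1 n => by
    have : Continuous fun θ => S (circleMap 0 r θ) :=
      hS.1.continuousOn.comp_continuous (continuous_circleMap 0 r) (hcm r h0 h1)
    refine (continuous_const.div (continuous_const.max (continuous_const.mul this.norm))
      fun θ => ?_).pow n
    exact (lt_of_lt_of_le one_pos (le_max_left _ _)).ne'
  have hr : ∀ᶠ r : ℝ in nhdsWithin 1 (Iio 1), ‖z‖ < r ∧ r < 1 := Ioo_mem_nhdsLT hz1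
  have hpow : ∀ n : ℕ, ‖g z‖ ^ n ≤ 1 / (1 - ‖z‖) := fun n => by
    have hlim : Tendsto (fun r : ℝ => ∫ θ in (0 : ℝ)..(2 * Real.pi),
        (C / max 1 (C * ‖S (circleMap 0 r θ)‖)) ^ n) (nhdsWithin 1 (Iio 1))
        (nhds (∫ θ in (0 : ℝ)..(2 * Real.pi), (1 : ℝ))) := by
      refine intervalIntegral.tendsto_integral_filter_of_dominated_convergence (fun _ => C ^ n)
        ?_ ?_ intervalIntegrable_const ?_
      · filter_upwards [hr] with r h
        exact (hcont r ((norm_nonneg z).trans h.1.le) h.2 n).aestronglyMeasurable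
      · refine Eventually.of_forall fun r => ae_of_all _ fun θ _ => ?_
        rw [Real.norm_of_nonneg (by positivity)]
        gcongr
        exact div_le_self (by linarith) (le_max_left _ _)
      · have h3 := hS.2.2
        rw [ae_restrict_iff' measurableSet_Ioc] at h3
        filter_upwards [h3] with θ h4 hθ
        rw [uIoc_of_le Real.two_pi_pos.le] at hθ
        have h5 := h4 hθ
        have h6 : Tendsto (fun r : ℝ => (C / max 1 (C * ‖S (r * Complex.exp (θ * I))‖)) ^ n)
            (nhdsWithin 1 (Iio 1)) (nhds ((C / max 1 (C * 1)) ^ n)) :=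
          (tendsto_const_nhds.div (tendsto_const_nhds.max (h5.const_mul C))
            (lt_of_lt_of_le one_pos (le_max_left _ _)).ne').pow n
        have h7 : (C / max 1 (C * 1)) ^ n = 1 := by
          rw [mul_one, max_eq_right hC1, div_self (by linarith), one_pow]
        rw [h7] at h6
        simpa only [circleMap, zero_add] using h6
    have hlim2 : Tendsto (fun r : ℝ => r / (r - ‖z‖) * ∫ θ in (0 : ℝ)..(2 * Real.pi),
        (C / max 1 (C * ‖S (circleMap 0 r θ)‖)) ^ n) (nhdsWithin 1 (Iio 1))
        (nhds (1 / (1 - ‖z‖) * ∫ θ in (0 : ℝ)..(2 * Real.pi), (1 : ℝ))) := by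
      refine Tendsto.mul ?_ hlim
      have h0 : Tendsto (fun r : ℝ => r) (nhdsWithin 1 (Iio 1)) (nhds 1) :=
        tendsto_id.mono_left nhdsWithin_le_nhds
      exact h0.div (h0.sub_const _) (sub_pos.mpr hz1).ne'
    have hfin : 2 * Real.pi * ‖g z ^ n‖ ≤
        1 / (1 - ‖z‖) * ∫ θ in (0 : ℝ)..(2 * Real.pi), (1 : ℝ) := by
      refine ge_of_tendsto hlim2 ?_
      filter_upwards [hr] with r h
      have hr0 := (norm_nonneg z).trans h.1.le
      refine norm_mul_two_pi_le_of_circle (hgd.pow n) h.2 h.1 (hcont r hr0 h.2 n) fun θ => ?_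
      rw [Pi.pow_apply, norm_pow]
      exact pow_le_pow_left₀ (norm_nonneg _) (hle _ (hcm r hr0 h.2 θ)) n
    rw [intervalIntegral.integral_const, smul_eq_mul, mul_one, sub_zero, norm_pow] at hfin
    have hp := Real.two_pi_pos
    nlinarith
  by_contra! hgt
  obtain ⟨n, hn⟩ := pow_unbounded_of_one_lt (1 / (1 - ‖z‖)) hgt
  exact absurd (hpow n) (not_le.mpr hn)

lemma mem_Hinf_of_mem_APlus {f : ℂ → ℂ} (hf : f ∈ APlus) : f ∈ Hinf := by
  have r := isTaylorRep_taylorCoeff hf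
  refine ⟨?_, _, fun z hz => r.norm_le (ball_subset_closedBall hz)⟩
  have h : DifferentiableOn ℂ (fun z => ∑' n : ℕ, taylorCoeff f n * z ^ n) (ball 0 1) := by
    refine differentiableOn_tsum_of_summable_norm r.1 (fun n => by fun_prop) isOpen_ball
      fun n z hz => ?_
    rw [norm_mul, norm_pow]
    have : ‖z‖ ≤ 1 := by simpa using ball_subset_closedBall hz
    exact mul_le_of_le_one_right (norm_nonneg _) (pow_le_one₀ (norm_nonneg _) this)
  exact h.congr fun z hz => (r.2 z (ball_subset_closedBall hz)).tsum_eq.symm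

lemma innerDivides_one {f : ℂ → ℂ} (hf : f ∈ APlus) : InnerDivides (fun _ => 1) f :=
  ⟨f, mem_Hinf_of_mem_APlus hf, fun z _ => by simp⟩

/-- An ideal containing functions `exp (-ε h)`, `Re h ≥ 0`, has trivial greatest common inner
divisor. -/
theorem isGcdInner_one {I : Set (ℂ → ℂ)} (hI : I ⊆ APlus) {h : ℂ → ℂ}
    (hre : ∀ z ∈ ball (0 : ℂ) 1, 0 ≤ (h z).re)
    (hex : ∀ ε : ℝ, 0 < ε → ∃ f ∈ I, ∀ z ∈ ball (0 : ℂ) 1, f z = Complex.exp (-(ε : ℂ) * h z)) :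
    IsGcdInner I fun _ => 1 := by
  refine ⟨⟨differentiableOn_const _, by simp, by simp⟩, fun f hf _ => innerDivides_one (hI hf),
    fun S hS hdiv => ?_⟩
  have hge : ∀ z ∈ ball (0 : ℂ) 1, 1 ≤ ‖S z‖ := fun z hz => by
    have hlim : Tendsto (fun ε : ℝ => ‖Complex.exp (-(ε : ℂ) * h z)‖) (nhdsWithin 0 (Ioi 0))
        (nhds 1) := by
      have hc : Continuous fun ε : ℝ => ‖Complex.exp (-(ε : ℂ) * h z)‖ := by fun_prop
      have := (hc.tendsto 0).mono_left (nhdsWithin_le_nhds (s := Ioi 0))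
      simpa using this
    refine le_of_tendsto hlim ?_
    filter_upwards [self_mem_nhdsWithin] with ε hε
    obtain ⟨f, hf, hfe⟩ := hex ε hε
    obtain ⟨g, hg, hfg⟩ := hdiv f hf ⟨0, by simp, by
      rw [hfe 0 (by simp)]; exact Complex.exp_ne_zero _⟩
    have hf1 : ∀ z ∈ ball (0 : ℂ) 1, ‖f z‖ ≤ 1 := fun w hw => by
      rw [hfe w hw, Complex.norm_exp, Real.exp_le_one_iff]
      have := hre w hw
      have hε' : 0 < ε := hε
      simp
      positivity
    have := norm_quotient_le_one_of_inner hS hg hf1 hfg hz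
    rw [← hfe z hz, hfg z hz, norm_mul]
    exact mul_le_of_le_one_right (norm_nonneg _) this
  have hne : ∀ z ∈ ball (0 : ℂ) 1, S z ≠ 0 := fun z hz h0 => by
    have := hge z hz
    rw [h0, norm_zero] at this
    linarith
  refine ⟨fun z => (S z)⁻¹, ⟨hS.1.inv hne, 1, fun z hz => ?_⟩, fun z hz => ?_⟩
  · rw [norm_inv]
    exact inv_le_one_of_one_le₀ (hge z hz)
  · exact (mul_inv_cancel₀ (hne z hz)).symm

lemma exists_mem_sub_mem_of_approx {V : Type*} [NormedAddCommGroup V] [CompleteSpace V]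
    {J T : AddSubgroup V} (hJ : IsClosed (J : Set V)) (hT : IsClosed (T : Set V))
    (h : ∀ a : V, ∀ ε > 0, ∃ c ∈ T, ∃ r : V, ‖c‖ ≤ ‖a‖ ∧ ‖r‖ < ε ∧ a - c - r ∈ J)
    {a : V} (ha : ‖a‖ ≤ 1) : ∃ c ∈ T, ‖c‖ ≤ 2 ∧ a - c ∈ J := by
  choose! C hCT R hCa hR hCR using h
  have hp : ∀ n : ℕ, (0 : ℝ) < (1 / 2) ^ n := fun n => by positivity
  let r : ℕ → V := fun n => Nat.rec a (fun i x => R x ((1 / 2) ^ (i + 1))) n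
  have hr1 : ∀ n, r (n + 1) = R (r n) ((1 / 2) ^ (n + 1)) := fun n => rfl
  have hr : ∀ n, ‖r n‖ ≤ (1 / 2) ^ n := fun n => by
    cases n with
    | zero => simpa [r] using ha
    | succ n => rw [hr1]; exact (hR _ _ (hp _)).le
  let c : ℕ → V := fun n => C (r n) ((1 / 2) ^ (n + 1))
  have hc : ∀ n, ‖c n‖ ≤ (1 / 2) ^ n := fun n => (hCa _ _ (hp _)).trans (hr n)
  have hg := hasSum_geometric_two
  have hcs : Summable c := Summable.of_norm_bounded hg.summable hc
  have hpart : ∀ n, a - ∑ i ∈ Finset.range n, c i - r n ∈ J := fun n => by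
    induction n with
    | zero => simp [r]
    | succ n ih =>
      have := J.add_mem ih (hCR (r n) _ (hp (n + 1)))
      rw [Finset.sum_range_succ, hr1]
      convert this using 1
      simp only [c]
      abel
  have hr0 : Tendsto r atTop (nhds 0) :=
    squeeze_zero_norm hr (tendsto_pow_atTop_nhds_zero_of_lt_one (by norm_num) (by norm_num))
  refine ⟨∑' n, c n, hT.mem_of_tendsto hcs.hasSum.tendsto_sum_nat (Eventually.of_forall fun n =>
    T.sum_mem fun i _ => hCT _ _ (hp _)), tsum_of_norm_bounded hg hc, ?_⟩
  have hlim : Tendsto (fun n => a - ∑ i ∈ Finset.range n, c i - r n) atTop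
      (nhds (a - (∑' n, c n) - 0)) :=
    (tendsto_const_nhds.sub hcs.hasSum.tendsto_sum_nat).sub hr0
  rw [sub_zero] at hlim
  exact hJ.mem_of_tendsto hlim (Eventually.of_forall hpart)

lemma isClosedIdealW_wienerAlg : IsClosedIdealW WienerAlg :=
  ⟨Subset.rfl, fun _ hf _ hg => ((isWienerRep_fcoeff hf).add (isWienerRep_fcoeff hg)).mem,
    fun _ hf _ hg => by
      obtain ⟨c, hc, -⟩ := (isWienerRep_fcoeff hf).mul (isWienerRep_fcoeff hg)
      exact hc.mem,
    fun _ hf _ => hf⟩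

lemma isClosedIdealW_idealGenW {I : Set (ℂ → ℂ)} (hI : I ⊆ WienerAlg) :
    IsClosedIdealW (IdealGenW I) := by
  refine ⟨fun f hf => hf WienerAlg ⟨isClosedIdealW_wienerAlg, hI⟩,
    fun f hf g hg J hJ => hJ.1.2.1 f (hf J hJ) g (hg J hJ),
    fun f hf g hg J hJ => hJ.1.2.2.1 f hf g (hg J hJ), fun f hf h J hJ => ?_⟩
  refine hJ.1.2.2.2 f hf fun ε hε => ?_
  obtain ⟨g, hg, hlt⟩ := h ε hε
  exact ⟨g, hg J hJ, hlt⟩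

lemma subset_idealGenW (I : Set (ℂ → ℂ)) : I ⊆ IdealGenW I := fun _ hf _ hJ => hJ.2 hf

lemma IsClosedIdealW.mem_of_eqOn {J : Set (ℂ → ℂ)} (hJ : IsClosedIdealW J) {f g : ℂ → ℂ}
    (hf : f ∈ J) (h : ∀ z ∈ sphere (0 : ℂ) 1, f z = g z) : g ∈ J := by
  refine hJ.2.2.2 g ((isWienerRep_fcoeff (hJ.1 hf)).congr h).mem fun ε hε => ⟨f, hf, ?_⟩
  have : IsWienerRep (g - f) 0 := ⟨by simp, fun z hz => by simp [h z hz]⟩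
  rw [this.wienerNorm_eq]
  simpa using hε

lemma IsClosedIdealW.mul_single_mem {J : Set (ℂ → ℂ)} (hJ : IsClosedIdealW J) {f : ℂ → ℂ}
    (hf : f ∈ J) (n : ℤ) (c : ℂ) :
    (fun z => c * z ^ n * f z) ∈ J :=
  hJ.2.2.1 _ (isWienerRep_single n c).mem f hf

/-- The sequence space `ℓ¹(ℤ)`. -/
abbrev EllOne : Type := lp (fun _ : ℤ => ℂ) 1

lemma EllOne.summable_norm (a : EllOne) : Summable fun n => ‖a n‖ := by
  simpa using (lp.memℓp a).summable (by simp)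

lemma EllOne.norm_eq (a : EllOne) : ‖a‖ = ∑' n, ‖a n‖ := by
  simp [lp.norm_eq_tsum_rpow (p := 1) (by simp) a]

/-- The function on the unit circle with Fourier coefficients `a`. -/
def EllOne.toFun (a : EllOne) (z : ℂ) : ℂ := ∑' n, a n * z ^ n

lemma EllOne.isWienerRep (a : EllOne) : IsWienerRep a.toFun a := by
  refine ⟨a.summable_norm, fun z hz => Summable.hasSum (Summable.of_norm ?_)⟩
  have hz1 : ‖z‖ = 1 := by simpa using hz
  simpa [hz1] using a.summable_norm

lemma IsWienerRep.exists_ellOne {f : ℂ → ℂ} {a : ℤ → ℂ} (h : IsWienerRep f a) :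
    ∃ b : EllOne, (b : ℤ → ℂ) = a ∧ ∀ z ∈ sphere (0 : ℂ) 1, b.toFun z = f z :=
  ⟨⟨a, memℓp_gen (by simpa using h.1)⟩, rfl, fun z hz => (h.2 z hz).tsum_eq⟩

lemma EllOne.toFun_add (a b : EllOne) {z : ℂ} (hz : z ∈ sphere (0 : ℂ) 1) :
    (a + b).toFun z = a.toFun z + b.toFun z :=
  ((a + b).isWienerRep.2 z hz).unique ((a.isWienerRep.add b.isWienerRep).2 z hz)

lemma EllOne.toFun_neg (a : EllOne) {z : ℂ} (hz : z ∈ sphere (0 : ℂ) 1) :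
    (-a).toFun z = -a.toFun z := by
  refine ((-a).isWienerRep.2 z hz).unique ?_
  simpa using (a.isWienerRep.2 z hz).neg

lemma EllOne.toFun_sub (a b : EllOne) {z : ℂ} (hz : z ∈ sphere (0 : ℂ) 1) :
    (a - b).toFun z = a.toFun z - b.toFun z := by
  rw [sub_eq_add_neg, toFun_add _ _ hz, toFun_neg _ hz, sub_eq_add_neg]

lemma EllOne.toFun_single (n : ℤ) (c : ℂ) {z : ℂ} (hz : z ∈ sphere (0 : ℂ) 1) :
    EllOne.toFun (lp.single 1 n c) z = c * z ^ n := by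
  refine ((EllOne.isWienerRep (lp.single 1 n c)).2 z hz).unique ?_
  simpa using (isWienerRep_single n c).2 z hz

/-- The subgroup of `ℓ¹(ℤ)` corresponding to a closed ideal of the Wiener algebra. -/
def IsClosedIdealW.toAddSubgroup {J : Set (ℂ → ℂ)} (hJ : IsClosedIdealW J) (h0 : J.Nonempty) :
    AddSubgroup EllOne where
  carrier := {a | a.toFun ∈ J}
  zero_mem' := by
    obtain ⟨f, hf⟩ := h0
    exact hJ.mem_of_eqOn (hJ.mul_single_mem hf 0 0) fun z _ => by simp [EllOne.toFun]
  add_mem' {a b} ha hb := hJ.mem_of_eqOn (hJ.2.1 _ ha _ hb) fun z hz => (a.toFun_add b hz).symm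
  neg_mem' {a} ha := hJ.mem_of_eqOn (hJ.mul_single_mem ha 0 (-1)) fun z hz => by
    simp [a.toFun_neg hz]

lemma IsClosedIdealW.isClosed_toAddSubgroup {J : Set (ℂ → ℂ)} (hJ : IsClosedIdealW J)
    (h0 : J.Nonempty) : IsClosed (hJ.toAddSubgroup h0 : Set EllOne) := by
  refine isClosed_of_closure_subset fun a ha => ?_
  refine hJ.2.2.2 _ a.isWienerRep.mem fun ε hε => ?_
  obtain ⟨b, hb, hab⟩ := Metric.mem_closure_iff.mp ha ε hε
  refine ⟨b.toFun, hb, ?_⟩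
  have : IsWienerRep (a.toFun - b.toFun) (a - b : EllOne) :=
    (a - b).isWienerRep.congr fun z hz => a.toFun_sub b hz
  rwa [this.wienerNorm_eq, ← EllOne.norm_eq, ← dist_eq_norm]

/-- The sequences in `ℓ¹(ℤ)` supported in `[N, ∞)`. -/
def tailSubgroup (N : ℤ) : AddSubgroup EllOne where
  carrier := {a | ∀ n < N, a n = 0}
  zero_mem' := by simp
  add_mem' {a b} ha hb n hn := by simp [ha n hn, hb n hn]
  neg_mem' {a} ha n hn := by simp [ha n hn]

lemma isClosed_tailSubgroup (N : ℤ) : IsClosed (tailSubgroup N : Set EllOne) := by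
  have : (tailSubgroup N : Set EllOne) = ⋂ n, ⋂ (_ : n < N), {a : EllOne | a n = 0} := by
    ext a
    simp only [mem_iInter]
    rfl
  rw [this]
  exact isClosed_iInter fun n => isClosed_iInter fun _ => isClosed_eq
    ((lp.evalCLM ℂ (fun _ : ℤ => ℂ) 1 n).continuous) continuous_const

theorem IsClosedIdealW.exists_tail {J : Set (ℂ → ℂ)} (hJ : IsClosedIdealW J)
    (h : ∀ ε > 0, ∀ N : ℕ, ∃ m ≥ N, ∃ (Q : ℂ → ℂ) (q : ℤ → ℂ), IsWienerRep Q q ∧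
      ∑' n, ‖q n‖ < ε ∧ (fun z => 1 - z ^ m - Q z) ∈ J) (N : ℕ) :
    ∃ c : EllOne, (∀ n < (N : ℤ), c n = 0) ∧ ‖c‖ ≤ 2 ∧ (fun z => 1 - c.toFun z) ∈ J := by
  have h0 : J.Nonempty := by
    obtain ⟨m, -, Q, q, -, -, hmem⟩ := h 1 one_pos 0
    exact ⟨_, hmem⟩
  set J' := hJ.toAddSubgroup h0 with hJ'
  have hsingle : ∀ (n : ℤ) (α : ℂ), ∀ ε > 0, ∃ c ∈ tailSubgroup N, ∃ r : EllOne,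
      ‖c‖ ≤ ‖α‖ ∧ ‖r‖ < ε ∧ lp.single 1 n α - c - r ∈ J' := fun n α ε hε => by
    obtain ⟨m, hm, Q, q, hQ, hq, hmem⟩ := h (ε / (‖α‖ + 1)) (by positivity) (N + n.natAbs)
    obtain ⟨b, hb, hble⟩ := (isWienerRep_single n α).mul hQ
    obtain ⟨r, hrb, hr⟩ := hb.exists_ellOne
    refine ⟨lp.single 1 (n + m) α, fun k hk => ?_, r, ?_, ?_, ?_⟩
    · rw [lp.coeFn_single, Pi.single_eq_of_ne]
      omega
    · rw [lp.norm_single (by simp)]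
    · rw [EllOne.norm_eq, hrb]
      refine hble.trans_lt ?_
      have h1 : ∑' k, ‖(Pi.single n α : ℤ → ℂ) k‖ = ‖α‖ := by
        rw [tsum_eq_single n fun k hk => by simp [Pi.single_eq_of_ne hk]]
        simp
      rw [h1]
      rw [lt_div_iff₀ (by positivity)] at hq
      have : 0 ≤ ∑' k, ‖q k‖ := tsum_nonneg fun _ => norm_nonneg _
      nlinarith
    · refine hJ.mem_of_eqOn (hJ.mul_single_mem hmem n α) fun z hz => ?_
      rw [EllOne.toFun_sub _ _ hz, EllOne.toFun_sub _ _ hz, EllOne.toFun_single _ _ hz,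
        EllOne.toFun_single _ _ hz, hr z hz, zpow_add₀ (ne_zero_of_mem_sphere_one hz),
        zpow_natCast]
      ring
  have hfin : ∀ (a : EllOne) (s : Finset ℤ), ∀ ε > 0, ∃ c ∈ tailSubgroup N, ∃ r : EllOne,
      ‖c‖ ≤ ∑ n ∈ s, ‖a n‖ ∧ ‖r‖ < ε ∧ ∑ n ∈ s, lp.single 1 n (a n) - c - r ∈ J' := fun a s => by
    induction s using Finset.induction_on with
    | empty => exact fun ε hε => ⟨0, zero_mem _, 0, by simp, by simpa using hε, by
        simp [zero_mem]⟩
    | insert n s hn ih =>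
      intro ε hε
      obtain ⟨c, hc, r, hca, hr, hmem⟩ := ih (ε / 2) (half_pos hε)
      obtain ⟨c', hc', r', hca', hr', hmem'⟩ := hsingle n (a n) (ε / 2) (half_pos hε)
      refine ⟨c' + c, add_mem hc' hc, r' + r, ?_, ?_, ?_⟩
      · rw [Finset.sum_insert hn]
        exact (norm_add_le _ _).trans (add_le_add hca' hca)
      · exact (norm_add_le _ _).trans_lt (by linarith)
      · rw [Finset.sum_insert hn]
        convert add_mem hmem' hmem using 1
        abel
  have hstep : ∀ a : EllOne, ∀ ε > 0, ∃ c ∈ tailSubgroup N, ∃ r : EllOne,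
      ‖c‖ ≤ ‖a‖ ∧ ‖r‖ < ε ∧ a - c - r ∈ J' := fun a ε hε => by
    have hs := lp.hasSum_single (p := 1) (by simp) a
    obtain ⟨s, hs⟩ := (Metric.tendsto_nhds.mp hs (ε / 2) (half_pos hε)).exists
    obtain ⟨c, hc, r, hca, hr, hmem⟩ := hfin a s (ε / 2) (half_pos hε)
    refine ⟨c, hc, r + (a - ∑ n ∈ s, lp.single 1 n (a n)), hca.trans ?_, ?_, ?_⟩
    · rw [EllOne.norm_eq]
      exact a.summable_norm.sum_le_tsum s fun _ _ => norm_nonneg _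
    · refine (norm_add_le _ _).trans_lt ?_
      rw [dist_comm, dist_eq_norm] at hs
      linarith
    · convert hmem using 1
      abel
  obtain ⟨c, hc, hc2, hmem⟩ := exists_mem_sub_mem_of_approx (hJ.isClosed_toAddSubgroup h0)
    (isClosed_tailSubgroup N) hstep (a := lp.single 1 0 1)
    (by rw [lp.norm_single (by simp)]; simp)
  refine ⟨c, hc, hc2, hJ.mem_of_eqOn hmem fun z hz => ?_⟩
  rw [EllOne.toFun_sub _ _ hz, EllOne.toFun_single _ _ hz]
  simp

lemma contDiffAt_bump_mul {χ : ContDiffBump (1 : ℂ)} (hχ : χ.rOut < 1) {f : ℂ → ℂ}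
    (hf : DifferentiableOn ℂ f slitPlane) : ContDiff ℝ 2 fun w => ((χ w : ℝ) : ℂ) * f w := by
  refine contDiff_iff_contDiffAt.mpr fun w => ?_
  by_cases hw : w ∈ tsupport χ
  · rw [χ.tsupport_eq] at hw
    have hball : w ∈ slitPlane := ball_one_subset_slitPlane (closedBall_subset_ball hχ hw)
    exact (ofRealCLM.contDiff.contDiffAt.comp w χ.contDiffAt).mul
      (hf.contDiffAt_real isOpen_slitPlane hball)
  · refine contDiffAt_const (c := (0 : ℂ)) |>.congr_of_eventuallyEq ?_
    filter_upwards [notMem_tsupport_iff_eventuallyEq.mp hw] with z hz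
    simp [hz]

lemma mem_wienerAlg_of_contDiffAt {f : ℂ → ℂ} (hf : ∀ z ∈ sphere (0 : ℂ) 1, ContDiffAt ℝ 2 f z) :
    f ∈ WienerAlg :=
  mem_wienerAlg_of_contDiff (contDiff_comp_exp_of_contDiffAt hf)

lemma eventually_log_pow (L : ℕ) :
    ∀ᶠ w : ℂ in nhds 1, log (w ^ L) = L * log w := by
  have hc : ContinuousAt (fun w : ℂ => ((L : ℂ) * log w).im) 1 :=
    (continuous_im.continuousAt).comp (continuousAt_const.mul (continuousAt_clog one_mem_slitPlane))
  have h1 : ((L : ℂ) * log 1).im ∈ Ioo (-Real.pi) Real.pi := by simp [Real.pi_pos]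
  filter_upwards [hc.eventually (isOpen_Ioo.mem_nhds h1), eventually_ne_nhds one_ne_zero]
    with w hw h0
  rw [← log_exp hw.1 hw.2.le, exp_nat_mul, exp_log h0]

lemma exists_small_one_sub {ε : ℝ} (hε : 0 < ε) :
    ∃ (Q : ℂ → ℂ) (q : ℤ → ℂ) (τ : ℝ), 0 < τ ∧ ContDiff ℝ 2 Q ∧ IsWienerRep Q q ∧
      ∑' n, ‖q n‖ < ε ∧ ∀ w, ‖w - 1‖ < τ → Q w = 1 - w := by
  let χ : ContDiffBump (1 : ℂ) := ⟨1 / 4, 1 / 2, by norm_num, by norm_num⟩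
  have hχ : χ.rOut < 1 := by norm_num [χ]
  have hlog : DifferentiableOn ℂ log slitPlane := fun w hw =>
    (differentiableAt_log hw).differentiableWithinAt
  have hE : Differentiable ℂ (dslope exp (0 : ℂ)) := differentiableOn_univ.mp
    ((differentiableOn_dslope univ_mem).mpr differentiable_exp.differentiableOn)
  have hs := contDiffAt_bump_mul hχ hlog
  have hG := contDiffAt_bump_mul hχ (hE.comp_differentiableOn hlog)
  set s : ℂ → ℂ := fun w => ((χ w : ℝ) : ℂ) * log w with hs'
  set G : ℂ → ℂ := fun w => ((χ w : ℝ) : ℂ) * (dslope exp 0 ∘ log) w with hG'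
  have hsW := isWienerRep_fcoeff (mem_wienerAlg_of_contDiffAt fun z _ => hs.contDiffAt (x := z))
  have hGW := isWienerRep_fcoeff (mem_wienerAlg_of_contDiffAt fun z _ => hG.contDiffAt (x := z))
  set B : ℝ := (∑' n, ‖fcoeff s n‖) * ∑' n, ‖fcoeff G n‖ with hB
  obtain ⟨L, hL⟩ := exists_nat_gt (B / ε)
  have hB0 : 0 ≤ B := mul_nonneg (tsum_nonneg fun _ => norm_nonneg _)
    (tsum_nonneg fun _ => norm_nonneg _)
  have hL0 : (0 : ℝ) < L := (div_nonneg hB0 hε.le).trans_lt hL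
  have hLn : L ≠ 0 := by rintro rfl; simp at hL0
  have hLc : (L : ℂ) ≠ 0 := by exact_mod_cast hLn
  obtain ⟨c, hc, hcn⟩ := hsW.comp_pow hLn
  obtain ⟨d, hd, hdn⟩ := hc.mul hGW
  have hev : ∀ᶠ w : ℂ in nhds 1, (-(L : ℂ)⁻¹) * (s (w ^ L) * G w) = 1 - w := by
    have hpow : Tendsto (fun w : ℂ => w ^ L) (nhds 1) (nhds 1) := by
      simpa using (continuous_pow L).tendsto (1 : ℂ)
    have hχ1 := χ.eventuallyEq_one
    filter_upwards [hχ1, hpow.eventually hχ1, eventually_log_pow L, eventually_ne_nhds one_ne_zero]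
      with w h1 h2 h3 h0
    have h4 := sub_smul_dslope exp (0 : ℂ) (log w)
    simp only [sub_zero, smul_eq_mul, exp_log h0, exp_zero] at h4
    simp only [hs', hG', h1, h2, h3, Function.comp_apply, Pi.one_apply, ofReal_one, one_mul]
    rw [mul_assoc, h4]
    field_simp
    ring
  obtain ⟨τ, hτ, hτb⟩ := Metric.eventually_nhds_iff.mp hev
  refine ⟨fun w => (-(L : ℂ)⁻¹) * (s (w ^ L) * G w), _, τ, hτ,
    contDiff_const.mul ((hs.comp (contDiff_id.pow L)).mul hG), hd.const_mul _, ?_,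
    fun w hw => hτb (by rwa [dist_eq_norm])⟩
  simp only [norm_mul, norm_neg, norm_inv, norm_natCast]
  rw [tsum_mul_left, inv_mul_lt_iff₀ hL0]
  rw [hcn] at hdn
  rw [div_lt_iff₀ hε] at hL
  exact hdn.trans_lt hL

lemma IsClosedIdealW.mem_of_outerFun_mem {J : Set (ℂ → ℂ)} (hJ : IsClosedIdealW J) {F U V : Set ℂ}
    {h Y : ℂ → ℂ} (hU : IsOpen U) (hFU : closedBall 0 1 \ F ⊆ U) (hh : DifferentiableOn ℂ h U)
    (hmem : outerFun F h 1 ∈ J) (hV : IsOpen V) (hFV : F ⊆ V) (hY : ContDiff ℝ 2 Y)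
    (hYV : ∀ z ∈ V, Y z = 0) : Y ∈ J := by
  have hy : (fun z => Y z * exp (h z)) ∈ WienerAlg := by
    refine mem_wienerAlg_of_contDiffAt fun z hz => ?_
    by_cases hzV : z ∈ V
    · refine contDiffAt_const (c := (0 : ℂ)) |>.congr_of_eventuallyEq ?_
      filter_upwards [hV.mem_nhds hzV] with w hw
      simp [hYV w hw]
    · have hzU : z ∈ U := hFU ⟨sphere_subset_closedBall hz, fun hF => hzV (hFV hF)⟩
      exact hY.contDiffAt.mul (hh.cexp.contDiffAt_real hU hzU)
  refine hJ.mem_of_eqOn (hJ.2.2.1 _ hy _ hmem) fun z _ => ?_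
  by_cases hzF : z ∈ F
  · simp [hYV z (hFV hzF)]
  · simp [outerFun_of_notMem hzF, mul_assoc, ← exp_add]

lemma IsClosedIdealW.exists_one_sub_pow_mem {J : Set (ℂ → ℂ)} (hJ : IsClosedIdealW J) {N : ℕ → ℕ}
    (hN : ∀ k, k ≤ N k)
    (hout : ∀ k, ∃ (h : ℂ → ℂ) (U : Set ℂ), IsOpen U ∧
      closedBall 0 1 \ (cantorPoint '' approxSet N recurrentDenseSeq (fun k => 1 / ((k : ℝ) + 1)) k)
        ⊆ U ∧ DifferentiableOn ℂ h U ∧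
      outerFun (cantorPoint '' approxSet N recurrentDenseSeq (fun k => 1 / ((k : ℝ) + 1)) k) h 1
        ∈ J) {ε : ℝ} (hε : 0 < ε) (M : ℕ) :
    ∃ m ≥ M, ∃ (Q : ℂ → ℂ) (q : ℤ → ℂ), IsWienerRep Q q ∧ ∑' n, ‖q n‖ < ε ∧
      (fun z => 1 - z ^ m - Q z) ∈ J := by
  obtain ⟨Q, q, τ, hτ, hQ, hq, hqε, hQτ⟩ := exists_small_one_sub hε
  obtain ⟨k, hk, hkτ, hu⟩ := exists_recurrentDenseSeq_near 1 (half_pos hτ) (max M 1)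
  have hNk : max M 1 ≤ N k := hk.trans (hN k)
  obtain ⟨c, hc, hcq⟩ := hq.comp_pow (L := N k) (by omega)
  obtain ⟨h, U, hU, hFU, hh, hmem⟩ := hout (k + 1)
  refine ⟨N k, (le_max_left _ _).trans hNk, _, c, hc, hcq.trans_lt hqε,
    hJ.mem_of_outerFun_mem hU hFU hh hmem (V := {z | ‖z ^ N k - 1‖ < τ})
      (isOpen_lt (by fun_prop) continuous_const) ?_
      ((contDiff_const.sub (contDiff_id.pow _)).sub (hQ.comp (contDiff_id.pow _))) fun z hz => ?_⟩
  · rintro _ ⟨ω, hω, rfl⟩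
    have h1 := hω k (Nat.lt_succ_self k)
    have h2 := hu ω
    rw [norm_sub_rev] at h2
    simp only [ContinuousMap.one_apply, Circle.coe_one] at h2
    have := norm_sub_le_norm_sub_add_norm_sub ((cantorCircle ω : ℂ) ^ N k)
      (recurrentDenseSeq k ω : ℂ) 1
    change ‖(cantorCircle ω : ℂ) ^ N k - 1‖ < τ
    simp only at h1
    linarith
  · rw [hQτ _ hz, sub_self]

lemma IsTaylorRep.isWienerRep {f : ℂ → ℂ} {a : ℕ → ℂ} (h : IsTaylorRep f a) :
    IsWienerRep f (extendInt a) := isWienerRep_extendInt h.1 h.2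

/-- The Taylor series with the nonnegative part of `c` as coefficients. -/
lemma EllOne.isTaylorRep (c : EllOne) :
    IsTaylorRep (fun z => ∑' n : ℕ, c n * z ^ n) fun n : ℕ => c n := by
  have hs : Summable fun n : ℕ => ‖c n‖ := c.summable_norm.comp_injective Nat.cast_injective
  refine ⟨hs, fun z hz => Summable.hasSum (Summable.of_norm_bounded hs fun n => ?_)⟩
  rw [norm_mul, norm_pow]
  exact mul_le_of_le_one_right (norm_nonneg _)
    (pow_le_one₀ (norm_nonneg _) (mem_closedBall_zero_iff.mp hz))

lemma EllOne.hasSum_nat {c : EllOne} (hc : ∀ n < 0, c n = 0) {z : ℂ}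
    (hz : z ∈ sphere (0 : ℂ) 1) : HasSum (fun n : ℕ => c n * z ^ n) (c.toFun z) := by
  have h := c.isWienerRep.2 z hz
  rw [← (Nat.cast_injective (R := ℤ)).hasSum_iff fun n hn => ?_] at h
  · simpa [Function.comp_def] using h
  · rw [hc n, zero_mul]
    by_contra h0
    exact hn ⟨n.toNat, Int.toNat_of_nonneg (not_lt.mp h0)⟩

lemma isTaylorRep_one : IsTaylorRep (fun _ => 1) (Pi.single 0 1) := by
  have h0 : ∀ n : ℕ, n ≠ 0 → (Pi.single 0 1 : ℕ → ℂ) n = 0 := fun n hn => Pi.single_eq_of_ne hn _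
  refine ⟨summable_of_ne_finset_zero (s := {0}) fun n hn => ?_, fun z _ => ?_⟩
  · rw [h0 n (by simpa using hn), norm_zero]
  · simpa using hasSum_single (f := fun n => (Pi.single 0 1 : ℕ → ℂ) n * z ^ n) 0
      fun n hn => by rw [h0 n hn, zero_mul]

lemma one_sub_notMem_annihilatorIdeal {E : Set ℂ} {φ : ℕ → ℂ} {B : ℝ} (hφ : ∀ n, ‖φ n‖ ≤ B)
    (hφ0 : 1 / 2 ≤ ‖φ 0‖) {N : ℕ} (hN : ∀ n ≥ N, ‖φ n‖ ≤ 1 / 8) {f : ℂ → ℂ} {a : ℕ → ℂ}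
    (hf : IsTaylorRep f a) (ha : ∀ n < N, a n = 0) (ha2 : ∑' n, ‖a n‖ ≤ 2) :
    (fun z => 1 - f z) ∉ annihilatorIdeal E φ := fun h => by
  have hrep := isTaylorRep_one.sub hf
  have h0 := h.2.2 0
  rw [show taylorCoeff (fun z => 1 - f z) = Pi.single 0 1 - a from
    funext fun n => hrep.taylorCoeff_eq n, shiftPairing_sub hφ isTaylorRep_one.1 hf.1,
    sub_eq_zero] at h0
  have h1 : shiftPairing φ 0 (Pi.single 0 1) = φ 0 := by
    rw [shiftPairing, tsum_eq_single 0 fun n hn => by simp [Pi.single_eq_of_ne hn]]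
    simp
  have h2 : ‖shiftPairing φ 0 a‖ ≤ ∑' n, ‖a n‖ * (1 / 8) := by
    refine tsum_of_norm_bounded (hf.1.mul_right _).hasSum fun n => ?_
    rw [norm_mul]
    rcases lt_or_ge n N with hn | hn
    · simp [ha n hn]
    · exact mul_le_mul_of_nonneg_left (hN _ (by omega)) (norm_nonneg _)
  rw [tsum_mul_right, ← h0, h1] at h2
  linarith

lemma exists_notMem_image_of_notMem_image_iInter {K : ℕ → Set CantorGroup}
    (hK : ∀ k, IsClosed (K k)) (hanti : Antitone K) {z : ℂ} (hz : z ∉ cantorPoint '' ⋂ k, K k) :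
    ∃ k, z ∉ cantorPoint '' K k := by
  by_contra! hall
  have hfib : IsClosed (cantorPoint ⁻¹' {z}) := isClosed_singleton.preimage continuous_cantorPoint
  have hcl : ∀ k, IsClosed (K k ∩ cantorPoint ⁻¹' {z}) := fun k => (hK k).inter hfib
  obtain ⟨ω, hω⟩ := IsCompact.nonempty_iInter_of_directed_nonempty_isCompact_isClosed
    (fun k => K k ∩ cantorPoint ⁻¹' {z})
    (Antitone.directed_ge fun i j hij => inter_subset_inter_left _ (hanti hij))
    (fun k => let ⟨ω, hω, hz⟩ := hall k; ⟨ω, hω, hz⟩) (fun k => (hcl k).isCompact) hcl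
  rw [mem_iInter] at hω
  exact hz ⟨ω, mem_iInter.mpr fun k => (hω k).1, (hω 0).2⟩

/-- There is a Kronecker set `E` and a closed ideal `I ≠ {0}` of `A⁺` with
`S_I = 1` and `h(I) = E` for which the Bennett–Gilbert conjecture
`I = I^A ∩ S_I·H^∞` fails. -/
theorem stmt_1 :
    ∃ E : Set ℂ, IsKronecker E ∧
      ∃ I : Set (ℂ → ℂ), IsClosedIdealAPlus I ∧ NontrivialIdeal I ∧
        IsGcdInner I (fun _ => 1) ∧ hull I = E ∧
        ¬ (∀ f : ℂ → ℂ, f ∈ I ↔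
            (f ∈ APlus ∧ f ∈ IdealGenW I ∧ InnerDivides (fun _ => 1) f)) := by
  obtain ⟨N, g, φ, hN, hg, hφ, hb, hφ0, hφ1⟩ := exists_pseudo_density recurrentDenseSeq
    (fun k => 1 / ((k : ℝ) + 1)) fun k => by positivity
  set K : ℕ → Set CantorGroup := approxSet N recurrentDenseSeq fun k => 1 / ((k : ℝ) + 1) with hK
  have hKc : ∀ k, IsClosed (K k) := isClosed_approxSet _ _ _
  have hKa : Antitone K := approxSet_anti _ _ _
  have hgK : ∀ j, ∀ ω ∉ K j, g j ω = 0 := fun j ω hω => by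
    obtain ⟨i, hi, hlt⟩ : ∃ i, ∃ _ : i < j, 1 / ((i : ℝ) + 1) <
        ‖(cantorCircle ω : ℂ) ^ N i - recurrentDenseSeq i ω‖ := by
      by_contra! hcon
      exact hω hcon
    exact hg i j ω hi hlt
  have hKne : ∀ k, (K k).Nonempty := fun k => by
    rw [nonempty_iff_ne_empty]
    intro hempty
    have hzero : φ 0 = 0 := by
      refine tendsto_nhds_unique (hφ 0) (tendsto_const_nhds.congr' ?_)
      filter_upwards [eventually_ge_atTop k] with j hj
      have : g j = 0 := ContinuousMap.ext fun ω => hgK j ω fun h => by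
        have := hKa hj h
        rw [hempty] at this
        exact this
      simp [cantorCoeff, this]
    norm_num [hzero] at hφ1
  have hφ2 : ∀ n, ‖φ n‖ ≤ 2 := fun n =>
    le_of_tendsto (hφ n).norm (Eventually.of_forall fun j => hb j n)
  set E := cantorPoint '' ⋂ k, K k with hE
  have hEk : ∀ k, E ⊆ cantorPoint '' K k := fun k => image_mono (iInter_subset _ k)
  have hsphere : ∀ k, cantorPoint '' K k ⊆ sphere 0 1 := fun k => by
    rintro _ ⟨ω, -, rfl⟩
    simp [norm_cantorPoint]
  have hball : ∀ k, ∀ z ∈ ball (0 : ℂ) 1, z ∉ cantorPoint '' K k := fun k z hz h => by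
    have h1 := hsphere k h
    rw [mem_sphere_zero_iff_norm] at h1
    rw [mem_ball_zero_iff, h1] at hz
    exact lt_irrefl _ hz
  have hEcb : E ⊆ closedBall 0 1 := (hEk 0).trans ((hsphere 0).trans sphere_subset_closedBall)
  choose h U hU hKU hh hre hA using fun k => exists_outer_family (hKc k) (hKne k)
  have hI : ∀ k, ∀ ε > 0, outerFun (cantorPoint '' K k) (h k) ε ∈ annihilatorIdeal E φ :=
    fun k ε hε => ⟨hA k ε hε, fun z hz => outerFun_of_mem (hEk k hz), fun m => by
      refine shiftPairing_eq_zero hφ hb (hA k ε hε) ?_ m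
      filter_upwards [eventually_ge_atTop k] with j hj ω
      by_cases hω : ω ∈ K j
      · rw [outerFun_of_mem (mem_image_of_mem _ (hKa hj hω)), mul_zero]
      · rw [hgK j ω hω, zero_mul]⟩
  have hIA : annihilatorIdeal E φ ⊆ APlus := fun f hf => hf.1
  refine ⟨E, isKronecker_image_iInter_approxSet N, annihilatorIdeal E φ,
    isClosedIdealAPlus_annihilatorIdeal hEcb hφ2,
    ⟨_, hI 0 1 one_pos, 0, by simp, ?_⟩, ?_, ?_, fun hiff => ?_⟩
  · rw [outerFun_of_notMem (hball 0 0 (by simp))]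
    exact exp_ne_zero _
  · exact isGcdInner_one hIA (h := h 0)
      (fun z hz => hre 0 z ⟨ball_subset_closedBall hz, hball 0 z hz⟩)
      fun ε hε => ⟨_, hI 0 ε hε, fun z hz => outerFun_of_notMem (hball 0 z hz)⟩
  · refine Subset.antisymm (fun z hz => ?_) fun z hz => ⟨hEcb hz, fun f hf => hf.2.1 z hz⟩
    by_contra hzE
    obtain ⟨k, hk⟩ := exists_notMem_image_of_notMem_image_iInter hKc hKa hzE
    have := hz.2 _ (hI k 1 one_pos)
    rw [outerFun_of_notMem hk] at this
    exact exp_ne_zero _ this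
  · have hIW : annihilatorIdeal E φ ⊆ WienerAlg := fun f hf =>
      (isTaylorRep_taylorCoeff hf.1).isWienerRep.mem
    have hJ := isClosedIdealW_idealGenW hIW
    obtain ⟨M, hM⟩ := eventually_atTop.mp <|
      (tendsto_zero_iff_norm_tendsto_zero.mp hφ0).eventually_le_const (u := 1 / 8) (by norm_num)
    obtain ⟨c, hcM, hc2, hcJ⟩ := hJ.exists_tail (fun ε hε n =>
      hJ.exists_one_sub_pow_mem (fun k => (hN k).1) (fun k => ⟨h k, U k, hU k, hKU k, hh k,
        subset_idealGenW _ (hI k 1 one_pos)⟩) hε n) M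
    have hrep := c.isTaylorRep
    have hmem : (fun z => 1 - ∑' n : ℕ, c n * z ^ n) ∈ IdealGenW (annihilatorIdeal E φ) :=
      hJ.mem_of_eqOn hcJ fun z hz => by
        rw [(EllOne.hasSum_nat (fun n hn => hcM n (by omega)) hz).tsum_eq]
    have hAP := (isTaylorRep_one.sub hrep).mem
    refine one_sub_notMem_annihilatorIdeal hφ2 hφ1 hM hrep (fun n hn => hcM n (by omega)) ?_
      ((hiff _).mpr ⟨hAP, hmem, innerDivides_one hAP⟩)
    refine le_trans ?_ (c.norm_eq.symm.trans_le hc2)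
    exact tsum_comp_le_tsum_of_inj c.summable_norm (fun _ => norm_nonneg _) Nat.cast_injective
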